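/- arXiv:0804.2187 — 5 statements merged into one kernel-verified Lean document; each statement's English description precedes it below -/
import Mathlib

section
/- Let u₁, u₂, u₃ be a smooth periodic solution of the quasi-linear system (the n=3 dispersionless Lax reduction of the Benney chain). Then the solution is a traveling wave in which u₁, u₂, u₃ do not depend on t: ∂_t u₁ = ∂_t u₂ = ∂_t u₃ = 0 identically on ℝ². -/
open Filter Topology Set

namespace Benney

/-- The linear functional with partial derivatives `p` and `q`. -/
noncomputable def L (p q : ℝ) : ℝ × ℝ →L[ℝ] ℝ :=
  p • ContinuousLinearMap.fst ℝ ℝ ℝ + q • ContinuousLinearMap.snd ℝ ℝ ℝ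

@[simp] lemma L_apply (p q : ℝ) (x : ℝ × ℝ) : L p q x = p * x.1 + q * x.2 := by
  simp [L]

lemma eq_L (f : ℝ × ℝ →L[ℝ] ℝ) : f = L (f (1, 0)) (f (0, 1)) := by
  ext <;> simp

/-- Double periodicity. -/
def Per {α : Type} (f : ℝ × ℝ → α) : Prop :=
  ∀ x : ℝ × ℝ, f (x.1 + 1, x.2) = f x ∧ f (x.1, x.2 + 1) = f x

lemma div_zero_aux {P Q S : ℝ × ℝ → ℝ} {P' Q' : ℝ × ℝ → ℝ × ℝ →L[ℝ] ℝ}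
    (hP : ∀ x, HasFDerivAt P (P' x) x) (hQ : ∀ x, HasFDerivAt Q (Q' x) x)
    (hS : ∀ x, Q' x (1, 0) + P' x (0, 1) = S x) (hc : Continuous S) (h0 : ∀ x, 0 ≤ S x)
    (pP : Per P) (pQ : Per Q) (x : ℝ × ℝ) : S x = 0 := by
  have key := MeasureTheory.integral2_divergence_prod_of_hasFDerivAt Q P Q' P'
    x.1 x.2 (x.1 + 1) (x.2 + 1)
    (fun y _ => (hQ y).continuousAt.continuousWithinAt)
    (fun y _ => (hP y).continuousAt.continuousWithinAt)
    (fun y _ => hQ y) (fun y _ => hP y)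
    (by
      simp only [hS]
      exact hc.continuousOn.integrableOn_compact (isCompact_uIcc.prod isCompact_uIcc))
  have e1 : ∀ y, P (y, x.2 + 1) = P (y, x.2) := fun y => (pP (y, x.2)).2
  have e2 : ∀ y, Q (x.1 + 1, y) = Q (x.1, y) := fun y => (pQ (x.1, y)).1
  simp only [hS, e1, e2] at key
  have key' : (∫ y in x.1..(x.1 + 1), ∫ z in x.2..(x.2 + 1), S (y, z)) = 0 := by
    rw [key]; ring
  by_contra hne
  have hpos : 0 < S x := lt_of_le_of_ne (h0 x) (Ne.symm hne)
  have hI : Continuous fun y => ∫ z in x.2..(x.2 + 1), S (y, z) :=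
    intervalIntegral.continuous_parametric_intervalIntegral_of_continuous'
      (f := fun y z => S (y, z)) (by exact hc) _ _
  have h1 : 0 < ∫ z in x.2..(x.2 + 1), S (x.1, z) :=
    intervalIntegral.integral_pos (by linarith) (by fun_prop) (fun _ _ => h0 _)
      ⟨x.2, by simp, hpos⟩
  have h2 : 0 < ∫ y in x.1..(x.1 + 1), ∫ z in x.2..(x.2 + 1), S (y, z) :=
    intervalIntegral.integral_pos (by linarith) hI.continuousOn
      (fun y _ => intervalIntegral.integral_nonneg (by linarith) (fun _ _ => h0 _))
      ⟨x.1, by simp, h1⟩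
  linarith

lemma glue {U : Set (ℝ × ℝ)} (hU : IsOpen U) (pU : Per (fun x => x ∈ U))
    {P Q S : ℝ × ℝ → ℝ} (pP : Per P) (pQ : Per Q)
    (hin : ∀ x ∈ U, ContinuousAt S x ∧ 0 ≤ S x ∧ ∃ P' Q' : ℝ × ℝ →L[ℝ] ℝ,
      HasFDerivAt P P' x ∧ HasFDerivAt Q Q' x ∧ P' (0, 1) + Q' (1, 0) = S x)
    (hout : ∀ x, x ∉ U → ∀ᶠ y in 𝓝 x, y ∈ U → P y = 0 ∧ Q y = 0 ∧ S y = 0) :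
    ∀ x ∈ U, S x = 0 := by
  classical
  have evin : ∀ f : ℝ × ℝ → ℝ, ∀ x ∈ U, U.indicator f =ᶠ[𝓝 x] f := fun f x hx => by
    filter_upwards [hU.mem_nhds hx] with y hy
    simp [hy]
  have per_ind : ∀ f : ℝ × ℝ → ℝ, Per f → Per (U.indicator f) := by
    intro f pf x
    have h1 := pU x
    have h2 := pf x
    simp only [Set.indicator, h2, eq_iff_iff] at h1 ⊢
    simp only [h1, and_self]
  have hP : ∀ x, ∃ P' Q' : ℝ × ℝ →L[ℝ] ℝ, HasFDerivAt (U.indicator P) P' x ∧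
      HasFDerivAt (U.indicator Q) Q' x ∧ Q' (1, 0) + P' (0, 1) = U.indicator S x ∧
      ContinuousAt (U.indicator S) x := by
    intro x
    by_cases hx : x ∈ U
    · obtain ⟨h1, h2, P', Q', h3, h4, h5⟩ := hin x hx
      refine ⟨P', Q', h3.congr_of_eventuallyEq (evin P x hx),
        h4.congr_of_eventuallyEq (evin Q x hx), ?_, h1.congr (evin S x hx).symm⟩
      simp [hx, ← h5, add_comm]
    · have h := hout x hx
      have z : ∀ f : ℝ × ℝ → ℝ, (∀ᶠ y in 𝓝 x, y ∈ U → f y = 0) →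
          U.indicator f =ᶠ[𝓝 x] fun _ => 0 := by
        intro f hf
        filter_upwards [hf] with y hy
        by_cases hyU : y ∈ U <;> simp [hyU, hy]
      refine ⟨0, 0, (hasFDerivAt_const 0 x).congr_of_eventuallyEq
        (z P (h.mono fun y hy hyU => (hy hyU).1)), (hasFDerivAt_const 0 x).congr_of_eventuallyEq
        (z Q (h.mono fun y hy hyU => (hy hyU).2.1)), by simp [hx],
        continuousAt_const.congr (z S (h.mono fun y hy hyU => (hy hyU).2.2)).symm⟩
  choose P' Q' h1 h2 h3 h4 using hP
  intro x hx
  have := div_zero_aux h1 h2 h3 (continuous_iff_continuousAt.2 h4)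
    (fun x => by
      by_cases hx : x ∈ U
      · simpa [hx] using (hin x hx).2.1
      · simp [hx]) (per_ind P pP) (per_ind Q pQ) x
  simpa [hx] using this

/-- Truncated square. -/
noncomputable def msq (x : ℝ) : ℝ := max x 0 ^ 2

lemma msq_deriv (x : ℝ) : HasDerivAt msq (2 * max x 0) x := by
  rcases lt_trichotomy x 0 with h | h | h
  · rw [max_eq_right h.le]
    have : msq =ᶠ[𝓝 x] fun _ => 0 := by
      filter_upwards [gt_mem_nhds h] with y hy
      simp [msq, max_eq_right (le_of_lt hy)]
    simpa using (hasDerivAt_const x (0:ℝ)).congr_of_eventuallyEq this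
  · subst h
    simp only [max_self, mul_zero]
    have h0 : msq 0 = 0 := by simp [msq]
    rw [hasDerivAt_iff_isLittleO_nhds_zero]
    have : (fun h : ℝ => msq (0 + h) - msq 0 - h • (0:ℝ)) =O[𝓝 0] fun h => h ^ 2 := by
      refine Asymptotics.IsBigO.of_bound 1 (Eventually.of_forall fun y => ?_)
      have e : msq (0 + y) - msq 0 - y • (0:ℝ) = max y 0 ^ 2 := by rw [h0]; simp [msq]
      rw [e, one_mul, norm_pow, norm_pow]
      refine pow_le_pow_left₀ (norm_nonneg _) ?_ 2
      rcases le_total y 0 with h | h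
      · simp [max_eq_right h]
      · simp [max_eq_left h]
    exact this.trans_isLittleO (by simpa using Asymptotics.isLittleO_pow_id (𝕜 := ℝ) one_lt_two)
  · rw [max_eq_left h.le]
    have : msq =ᶠ[𝓝 x] fun y => y ^ 2 := by
      filter_upwards [lt_mem_nhds h] with y hy
      simp [msq, max_eq_left (le_of_lt hy)]
    have h2 := (hasDerivAt_pow 2 x).congr_of_eventuallyEq this
    simpa using h2

lemma msq_zero {x : ℝ} (h : x ≤ 0) : msq x = 0 := by simp [msq, h]
lemma msq_nonneg (x : ℝ) : 0 ≤ msq x := by unfold msq; positivity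
lemma msq_pos {x : ℝ} (h : 0 < x) : 0 < msq x := by
  unfold msq; rw [max_eq_left h.le]; positivity
lemma msq_cont : Continuous msq := by unfold msq; fun_prop

lemma root_diff {f : ℝ × ℝ → ℝ} {y : ℝ × ℝ} (O : Set ((ℝ × ℝ) × ℝ)) (hO : IsOpen O)
    (hy : (y, f y) ∈ O) (hr : f y ^ 3 + 2 * y.1 * f y + y.2 = 0)
    (hs : 3 * f y ^ 2 + 2 * y.1 ≠ 0)
    (hun : ∀ x p, (x, p) ∈ O → p ^ 3 + 2 * x.1 * p + x.2 = 0 → f x = p) :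
    DifferentiableAt ℝ f y := by
  let G : (ℝ × ℝ) × ℝ → ℝ := fun z => z.2 ^ 3 + 2 * z.1.1 * z.2 + z.1.2
  have hG : ContDiff ℝ 1 G := by fun_prop
  have dG := (hG.contDiffAt (x := (y, f y))).hasStrictFDerivAt (by simp)
  have hsl : HasDerivAt (fun p => G (y, p)) (3 * f y ^ 2 + 2 * y.1) (f y) := by
    have := (((hasDerivAt_pow 3 (f y)).add ((hasDerivAt_id (f y)).const_mul (2 * y.1))).add_const
      y.2)
    simpa [G] using this
  have hsl2 : HasFDerivAt (fun p => G (y, p))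
      ((fderiv ℝ G (y, f y)) ∘L .inr ℝ (ℝ × ℝ) ℝ) (f y) :=
    dG.hasFDerivAt.comp (f y) (hasFDerivAt_prodMk_right y (f y))
  have hval : ((fderiv ℝ G (y, f y)) ∘L .inr ℝ (ℝ × ℝ) ℝ) 1 = 3 * f y ^ 2 + 2 * y.1 :=
    hsl2.hasDerivAt.unique hsl
  have inv : ((fderiv ℝ G (y, f y)) ∘L .inr ℝ (ℝ × ℝ) ℝ).IsInvertible := by
    refine ⟨ContinuousLinearEquiv.unitsEquivAut ℝ (Units.mk0 _ hs), ?_⟩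
    ext
    rw [hval]
    simp
  have hd := (dG.hasStrictFDerivAt_implicitFunctionOfProdDomain inv).hasFDerivAt
  have ht := dG.tendsto_implicitFunctionOfProdDomain inv
  have he := dG.eventually_apply_implicitFunctionOfProdDomain inv
  set ψ := dG.implicitFunctionOfProdDomain inv
  have hG0 : G (y, f y) = 0 := hr
  have hev : f =ᶠ[𝓝 y] ψ := by
    have hmem : ∀ᶠ x in 𝓝 y, (x, ψ x) ∈ O :=
      (Tendsto.prodMk_nhds tendsto_id ht).eventually (hO.mem_nhds hy)
    filter_upwards [he, hmem] with x h1 h2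
    exact hun x _ h2 (by rw [hG0] at h1; exact h1)
  exact hd.differentiableAt.congr_of_eventuallyEq hev

lemma D_mul {f g : ℝ × ℝ → ℝ} {x : ℝ × ℝ} {f1 f2 g1 g2 : ℝ} (hf : HasFDerivAt f (L f1 f2) x)
    (hg : HasFDerivAt g (L g1 g2) x) :
    HasFDerivAt (fun y => f y * g y) (L (f1 * g x + f x * g1) (f2 * g x + f x * g2)) x := by
  refine (hf.mul hg).congr_fderiv ?_
  ext <;> simp <;> ring

lemma D_add {f g : ℝ × ℝ → ℝ} {x : ℝ × ℝ} {f1 f2 g1 g2 : ℝ} (hf : HasFDerivAt f (L f1 f2) x)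
    (hg : HasFDerivAt g (L g1 g2) x) :
    HasFDerivAt (fun y => f y + g y) (L (f1 + g1) (f2 + g2)) x := by
  refine (hf.add hg).congr_fderiv ?_
  ext <;> simp

lemma D_const (k : ℝ) (x : ℝ × ℝ) : HasFDerivAt (fun _ : ℝ × ℝ => k) (L 0 0) x := by
  refine (hasFDerivAt_const k x).congr_fderiv ?_
  ext <;> simp

lemma D_cmul {f : ℝ × ℝ → ℝ} {x : ℝ × ℝ} {f1 f2 : ℝ} (k : ℝ) (hf : HasFDerivAt f (L f1 f2) x) :
    HasFDerivAt (fun y => k * f y) (L (k * f1) (k * f2)) x := by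
  refine (hf.const_mul k).congr_fderiv ?_
  ext <;> simp

lemma D_sub {f g : ℝ × ℝ → ℝ} {x : ℝ × ℝ} {f1 f2 g1 g2 : ℝ} (hf : HasFDerivAt f (L f1 f2) x)
    (hg : HasFDerivAt g (L g1 g2) x) :
    HasFDerivAt (fun y => f y - g y) (L (f1 - g1) (f2 - g2)) x := by
  refine (hf.sub hg).congr_fderiv ?_
  ext <;> simp

lemma D_pow {f : ℝ × ℝ → ℝ} {x : ℝ × ℝ} {f1 f2 : ℝ} (n : ℕ) (hf : HasFDerivAt f (L f1 f2) x) :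
    HasFDerivAt (fun y => f y ^ n) (L (n * f x ^ (n - 1) * f1) (n * f x ^ (n - 1) * f2)) x := by
  refine (hf.pow n).congr_fderiv ?_
  ext <;> simp

lemma D_msq {f : ℝ × ℝ → ℝ} {x : ℝ × ℝ} {f1 f2 : ℝ} (hf : HasFDerivAt f (L f1 f2) x) :
    HasFDerivAt (fun y => msq (f y)) (L (2 * max (f x) 0 * f1) (2 * max (f x) 0 * f2)) x := by
  refine ((msq_deriv (f x)).comp_hasFDerivAt x hf).congr_fderiv ?_
  ext <;> simp

lemma D_unique {f : ℝ × ℝ → ℝ} {x : ℝ × ℝ} {f1 f2 g1 g2 : ℝ} (hf : HasFDerivAt f (L f1 f2) x)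
    (hg : HasFDerivAt f (L g1 g2) x) : f1 = g1 ∧ f2 = g2 := by
  have h := hf.unique hg
  have h1 := congrArg (fun l : ℝ × ℝ →L[ℝ] ℝ => l (1, 0)) h
  have h2 := congrArg (fun l : ℝ × ℝ →L[ℝ] ℝ => l (0, 1)) h
  simpa using And.intro h1 h2

/-- Solutions with their derivatives. -/
structure Sol (u v w a b c aq bq cq : ℝ × ℝ → ℝ) : Prop where
  hu : ∀ x, HasFDerivAt u (L (a x) (-b x)) x
  hv : ∀ x, HasFDerivAt v (L (b x) (-c x + 2 * u x * a x)) x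
  hw : ∀ x, HasFDerivAt w (L (c x) (v x * a x)) x
  ha : ∀ x, HasFDerivAt a (L (aq x) (-bq x)) x
  hb : ∀ x, HasFDerivAt b (L (bq x) (-cq x + 2 * a x ^ 2 + 2 * u x * aq x)) x
  hc : ∀ x, HasFDerivAt c (L (cq x) (b x * a x + v x * aq x)) x
  pu : Per u
  pv : Per v
  pa : Per a
  pb : Per b
  pc : Per c

/-- A smooth branch of simple roots. -/
structure Br (u v : ℝ × ℝ → ℝ) (U : Set (ℝ × ℝ)) (r : ℝ × ℝ → ℝ) : Prop where
  isOpen : IsOpen U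
  pU : Per (fun x => x ∈ U)
  pr : Per r
  diff : ∀ x ∈ U, DifferentiableAt ℝ r x
  root : ∀ x ∈ U, r x ^ 3 + 2 * u x * r x + v x = 0
  simple : ∀ x ∈ U, 3 * r x ^ 2 + 2 * u x ≠ 0

section
variable {u v w a b c aq bq cq r : ℝ × ℝ → ℝ} {U : Set (ℝ × ℝ)}

lemma Sol.cu (h : Sol u v w a b c aq bq cq) : Continuous u :=
  continuous_iff_continuousAt.2 fun x => (h.hu x).continuousAt
lemma Sol.cv (h : Sol u v w a b c aq bq cq) : Continuous v :=
  continuous_iff_continuousAt.2 fun x => (h.hv x).continuousAt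
lemma Sol.ca (h : Sol u v w a b c aq bq cq) : Continuous a :=
  continuous_iff_continuousAt.2 fun x => (h.ha x).continuousAt
lemma Sol.cb (h : Sol u v w a b c aq bq cq) : Continuous b :=
  continuous_iff_continuousAt.2 fun x => (h.hb x).continuousAt
lemma Sol.cc (h : Sol u v w a b c aq bq cq) : Continuous c :=
  continuous_iff_continuousAt.2 fun x => (h.hc x).continuousAt

lemma Br.deriv (h : Sol u v w a b c aq bq cq) (B : Br u v U r) {x : ℝ × ℝ} (hx : x ∈ U) :
    ∃ rq rt : ℝ, HasFDerivAt r (L rq rt) x ∧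
      (3 * r x ^ 2 + 2 * u x) * rq = -(2 * a x * r x + b x) ∧
      (3 * r x ^ 2 + 2 * u x) * rt = 2 * b x * r x + c x - 2 * u x * a x := by
  have hr : HasFDerivAt r (L (fderiv ℝ r x (1, 0)) (fderiv ℝ r x (0, 1))) x := by
    rw [← eq_L]; exact (B.diff x hx).hasFDerivAt
  refine ⟨_, _, hr, ?_⟩
  have h1 := D_add (D_add (D_pow 3 hr) (D_mul (D_cmul 2 (h.hu x)) hr)) (h.hv x)
  have h2 : HasFDerivAt (fun y => r y ^ 3 + 2 * u y * r y + v y) (L 0 0) x := by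
    refine (D_const 0 x).congr_of_eventuallyEq ?_
    filter_upwards [B.isOpen.mem_nhds hx] with y hy
    exact B.root y hy
  obtain ⟨e1, e2⟩ := D_unique h1 h2
  norm_num at e1 e2
  constructor
  · linear_combination e1
  · linear_combination e2

/-- simple wave step -/
lemma step_wave (h : Sol u v w a b c aq bq cq) (B : Br u v U r)
    (hb : ∀ x ∈ U, b x = r x * a x) (hc : ∀ x ∈ U, c x = (r x ^ 2 + 2 * u x) * a x)
    (hout : ∀ x, x ∉ U → ∀ ε > 0, ∀ᶠ y in 𝓝 x, y ∈ U →
      (r y * (3 / 4 * r y ^ 2 + 2 * u y) * (3 * r y ^ 2 + 2 * u y)) ^ 2 ≤ ε) :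
    ∀ x ∈ U, r x ≠ 0 → 3 / 4 * r x ^ 2 + 2 * u x ≠ 0 → a x = 0 := by
  have main : ∀ ε > 0, ∀ x ∈ U, 6 * r x ^ 2 * a x ^ 4 *
      msq ((r x * (3 / 4 * r x ^ 2 + 2 * u x) * (3 * r x ^ 2 + 2 * u x)) ^ 2 - ε) = 0 := by
    intro ε hε
    refine glue (U := U)
      (P := fun x => r x * (3 * r x ^ 2 + 2 * u x) *
        msq ((r x * (3 / 4 * r x ^ 2 + 2 * u x) * (3 * r x ^ 2 + 2 * u x)) ^ 2 - ε) * a x ^ 3)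
      (Q := fun x => r x * (r x * (3 * r x ^ 2 + 2 * u x) *
        msq ((r x * (3 / 4 * r x ^ 2 + 2 * u x) * (3 * r x ^ 2 + 2 * u x)) ^ 2 - ε) * a x ^ 3))
      B.isOpen B.pU ?_ ?_ ?_ ?_
    · intro x
      simp only [B.pr x, h.pu x, h.pa x, and_self]
    · intro x
      simp only [B.pr x, h.pu x, h.pa x, and_self]
    · intro x hx
      obtain ⟨rq, rt, hr, e1, e2⟩ := B.deriv h hx
      have hs := B.simple x hx
      have c1 := h.cu.continuousAt (x := x)
      have c2 := h.ca.continuousAt (x := x)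
      have c3 := hr.continuousAt
      have hrt : rt = -r x * rq := by
        apply mul_left_cancel₀ hs
        rw [hb x hx] at e1 e2
        rw [hc x hx] at e2
        linear_combination e2 + r x * e1
      have hbq : bq x = rq * a x + r x * aq x := by
        have h1 := D_mul hr (h.ha x)
        have h2 : HasFDerivAt (fun y => r y * a y) _ x := (h.hb x).congr_of_eventuallyEq (by
          filter_upwards [B.isOpen.mem_nhds hx] with y hy
          exact (hb y hy).symm)
        exact (D_unique h2 h1).1
      refine ⟨?_, ?_, ?_⟩
      · have := msq_cont
        exact ((continuousAt_const.mul (c3.pow 2)).mul (c2.pow 4)).mul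
          (msq_cont.continuousAt.comp (by fun_prop))
      · have := msq_nonneg ((r x * (3 / 4 * r x ^ 2 + 2 * u x) * (3 * r x ^ 2 + 2 * u x)) ^ 2 - ε)
        positivity
      · have hS := D_add (D_cmul 3 (D_pow 2 hr)) (D_cmul 2 (h.hu x))
        have hD := D_add (D_cmul (3 / 4) (D_pow 2 hr)) (D_cmul 2 (h.hu x))
        have hK := D_msq (D_sub (D_pow 2 (D_mul (D_mul hr hD) hS)) (D_const ε x))
        have hP := D_mul (D_mul (D_mul hr hS) hK) (D_pow 3 (h.ha x))
        have hQ := D_mul hr hP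
        refine ⟨_, _, hP, hQ, ?_⟩
        rw [hb x hx] at e1
        simp only [L_apply, hrt, hbq, hb x hx]
        push_cast
        generalize msq _ = M
        generalize max (_ : ℝ) _ = N
        norm_num
        linear_combination (-2 * r x * M * a x ^ 3) * e1
    · intro x hx
      filter_upwards [hout x hx ε hε] with y hy hyU
      simp [msq_zero (sub_nonpos.2 (hy hyU))]
  intro x hx h1 h2
  have hs := B.simple x hx
  have hk : 0 < (r x * (3 / 4 * r x ^ 2 + 2 * u x) * (3 * r x ^ 2 + 2 * u x)) ^ 2 := by positivity
  have := main _ (half_pos hk) x hx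
  rw [sub_half] at this
  have h3 := (msq_pos (half_pos hk)).ne'
  simpa [h1, h3] using this

/-- Lax type step -/
lemma step_lax (h : Sol u v w a b c aq bq cq) (B : Br u v U r) (hpos : ∀ x ∈ U, 0 < r x)
    (hout : ∀ x, x ∉ U → ∀ ε > 0, ∀ᶠ y in 𝓝 x, y ∈ U →
      (a y * r y ^ 2 + b y * r y + c y) ^ 4 * (3 * r y ^ 2 + 2 * u y) ^ 2 ≤ ε) :
    ∀ x ∈ U, a x * r x ^ 2 + b x * r x + c x = 0 := by
  have main : ∀ ε > 0, ∀ x ∈ U, 24 * r x * (a x * r x ^ 2 + b x * r x + c x) ^ 6 *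
      max ((a x * r x ^ 2 + b x * r x + c x) ^ 4 * (3 * r x ^ 2 + 2 * u x) ^ 2 - ε) 0 = 0 := by
    intro ε hε
    refine glue (U := U)
      (P := fun x => (a x * r x ^ 2 + b x * r x + c x) *
        msq ((a x * r x ^ 2 + b x * r x + c x) ^ 4 * (3 * r x ^ 2 + 2 * u x) ^ 2 - ε))
      (Q := fun x => r x * ((a x * r x ^ 2 + b x * r x + c x) *
        msq ((a x * r x ^ 2 + b x * r x + c x) ^ 4 * (3 * r x ^ 2 + 2 * u x) ^ 2 - ε)))
      B.isOpen B.pU ?_ ?_ ?_ ?_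
    · intro x
      simp only [B.pr x, h.pu x, h.pa x, h.pb x, h.pc x, and_self]
    · intro x
      simp only [B.pr x, h.pu x, h.pa x, h.pb x, h.pc x, and_self]
    · intro x hx
      obtain ⟨rq, rt, hr, e1, e2⟩ := B.deriv h hx
      have hroot := B.root x hx
      have c1 := h.cu.continuousAt (x := x)
      have c2 := h.ca.continuousAt (x := x)
      have c3 := hr.continuousAt
      have c4 := h.cb.continuousAt (x := x)
      have c5 := h.cc.continuousAt (x := x)
      refine ⟨by fun_prop, ?_, ?_⟩
      · have := hpos x hx
        positivity
      · have hS := D_add (D_cmul 3 (D_pow 2 hr)) (D_cmul 2 (h.hu x))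
        have hZ := D_add (D_add (D_mul (h.ha x) (D_pow 2 hr)) (D_mul (h.hb x) hr)) (h.hc x)
        generalize hsq : 3 * (((2:ℕ):ℝ) * r x ^ (2 - 1) * rq) + 2 * a x = sq at hS
        generalize hst : 3 * (((2:ℕ):ℝ) * r x ^ (2 - 1) * rt) + 2 * -b x = st at hS
        obtain ⟨zq, hzq⟩ : ∃ z, z = aq x * r x ^ 2 + a x * (((2:ℕ):ℝ) * r x ^ (2 - 1) * rq) +
          (bq x * r x + b x * rq) + cq x := ⟨_, rfl⟩
        obtain ⟨zt, hzt⟩ : ∃ z, z = -bq x * r x ^ 2 + a x * (((2:ℕ):ℝ) * r x ^ (2 - 1) * rt) +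
          ((-cq x + 2 * a x ^ 2 + 2 * u x * aq x) * r x + b x * rt) +
          (b x * a x + v x * aq x) := ⟨_, rfl⟩
        rw [← hzq, ← hzt] at hZ
        have k1 : zt + r x * zq + rq * (a x * r x ^ 2 + b x * r x + c x) = 0 := by
          rw [hzq, hzt]
          norm_num
          linear_combination aq x * hroot + (a x + (rt + r x * rq)) * e1 - rq * (e2 + r x * e1)
        have k2 : (3 * r x ^ 2 + 2 * u x) * (st + r x * sq) - 2 * rq * (3 * r x ^ 2 + 2 * u x) ^ 2
            = 6 * r x * (a x * r x ^ 2 + b x * r x + c x) := by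
          rw [← hst, ← hsq]
          norm_num
          linear_combination 6 * r x * (e2 + r x * e1) - 2 * (3 * r x ^ 2 + 2 * u x) * e1
        have hK := D_msq (D_sub (D_mul (D_pow 4 hZ) (D_pow 2 hS)) (D_const ε x))
        have hP := D_mul hZ hK
        have hQ := D_mul hr hP
        refine ⟨_, _, hP, hQ, ?_⟩
        simp only [L_apply]
        push_cast
        generalize msq _ = M
        generalize max (_ : ℝ) _ = N
        generalize a x * r x ^ 2 + b x * r x + c x = z at *
        generalize 3 * r x ^ 2 + 2 * u x = s at *
        norm_num
        linear_combination (M + 8 * N * z ^ 4 * s ^ 2) * k1 + 4 * z ^ 5 * N * k2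
    · intro x hx
      filter_upwards [hout x hx ε hε] with y hy hyU
      simp [msq_zero (sub_nonpos.2 (hy hyU)), hy hyU]
  intro x hx
  by_contra hz
  have hs := B.simple x hx
  have hk : 0 < (a x * r x ^ 2 + b x * r x + c x) ^ 4 * (3 * r x ^ 2 + 2 * u x) ^ 2 := by positivity
  have := main _ (half_pos hk) x hx
  rw [sub_half, max_eq_left (half_pos hk).le] at this
  have h1 := (hpos x hx).ne'
  simp [h1, hz, hs] at this

/-- Elliptic step -/
lemma step_ell (h : Sol u v w a b c aq bq cq) (B : Br u v U r) (hpos : ∀ x ∈ U, 0 < r x)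
    (hD : ∀ x ∈ U, 0 < 3 / 4 * r x ^ 2 + 2 * u x)
    (hout : ∀ x, x ∉ U → ∀ ε > 0, ∀ᶠ y in 𝓝 x, y ∈ U →
      r y ^ 2 * (3 / 4 * r y ^ 2 + 2 * u y) ^ 3 ≤ ε) :
    ∀ x ∈ U, b x = r x * a x ∧ c x = (r x ^ 2 + 2 * u x) * a x := by
  have main : ∀ ε > 0, ∀ x ∈ U, 4 * max (r x ^ 2 * (3 / 4 * r x ^ 2 + 2 * u x) ^ 3 - ε) 0 *
      r x * (3 / 4 * r x ^ 2 + 2 * u x) ^ 2 *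
      ((c x - a x * (1 / 2 * r x ^ 2 + 2 * u x) - 1 / 2 * (r x * b x)) ^ 2 +
      (3 / 4 * r x ^ 2 + 2 * u x) * (b x - r x * a x) ^ 2) = 0 := by
    intro ε hε
    refine glue (U := U)
      (P := fun x => msq (r x ^ 2 * (3 / 4 * r x ^ 2 + 2 * u x) ^ 3 - ε) *
        (c x - a x * (1 / 2 * r x ^ 2 + 2 * u x) - 1 / 2 * (r x * b x)))
      (Q := fun x => msq (r x ^ 2 * (3 / 4 * r x ^ 2 + 2 * u x) ^ 3 - ε) *
        ((-1 / 2) * (r x * (c x - a x * (1 / 2 * r x ^ 2 + 2 * u x) - 1 / 2 * (r x * b x))) -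
          (3 / 4 * r x ^ 2 + 2 * u x) * (b x - r x * a x)))
      B.isOpen B.pU ?_ ?_ ?_ ?_
    · intro x
      simp only [B.pr x, h.pu x, h.pa x, h.pb x, h.pc x, and_self]
    · intro x
      simp only [B.pr x, h.pu x, h.pa x, h.pb x, h.pc x, and_self]
    · intro x hx
      obtain ⟨rq, rt, hr, e1, e2⟩ := B.deriv h hx
      have hroot := B.root x hx
      have c1 := h.cu.continuousAt (x := x)
      have c2 := h.ca.continuousAt (x := x)
      have c3 := hr.continuousAt
      have c4 := h.cb.continuousAt (x := x)
      have c5 := h.cc.continuousAt (x := x)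
      refine ⟨by fun_prop, ?_, ?_⟩
      · have := hpos x hx
        have := hD x hx
        positivity
      · have hDd := D_add (D_cmul (3 / 4) (D_pow 2 hr)) (D_cmul 2 (h.hu x))
        have hX := D_sub (D_sub (h.hc x) (D_mul (h.ha x) (D_add (D_cmul (1 / 2) (D_pow 2 hr))
          (D_cmul 2 (h.hu x))))) (D_cmul (1 / 2) (D_mul hr (h.hb x)))
        have hY := D_sub (h.hb x) (D_mul hr (h.ha x))
        have hK := D_msq (D_sub (D_mul (D_pow 2 hr) (D_pow 3 hDd)) (D_const ε x))
        have hP := D_mul hK hX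
        have hQ := D_mul hK (D_sub (D_cmul (-1 / 2) (D_mul hr hX)) (D_mul hDd hY))
        refine ⟨_, _, hP, hQ, ?_⟩
        simp only [L_apply]
        push_cast
        generalize msq _ = M
        generalize max (_ : ℝ) _ = N
        norm_num
        linear_combination 
          M * (aq x * hroot - rt / 2 * e1 + a x * e1 + 1 / 2 * rq * e2) +
          2 * N * r x * (3 / 4 * r x ^ 2 + 2 * u x) ^ 2 *
            ((c x - a x * (1 / 2 * r x ^ 2 + 2 * u x) - 1 / 2 * (r x * b x)) * 2 * e2 +
            ((-1 / 2) * (r x * (c x - a x * (1 / 2 * r x ^ 2 + 2 * u x) - 1 / 2 * (r x * b x))) -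
          (3 / 4 * r x ^ 2 + 2 * u x) * (b x - r x * a x)) * 2 * e1)
    · intro x hx
      filter_upwards [hout x hx ε hε] with y hy hyU
      simp [msq_zero (sub_nonpos.2 (hy hyU)), hy hyU]
  intro x hx
  have h1 := hpos x hx
  have h2 := hD x hx
  have hk : 0 < r x ^ 2 * (3 / 4 * r x ^ 2 + 2 * u x) ^ 3 := by positivity
  have h3 := main _ (half_pos hk) x hx
  rw [sub_half, max_eq_left (half_pos hk).le] at h3
  have h4 : (c x - a x * (1 / 2 * r x ^ 2 + 2 * u x) - 1 / 2 * (r x * b x)) ^ 2 +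
      (3 / 4 * r x ^ 2 + 2 * u x) * (b x - r x * a x) ^ 2 = 0 := by
    refine (mul_eq_zero.1 h3).resolve_left ?_
    positivity
  have h5 : 0 ≤ (3 / 4 * r x ^ 2 + 2 * u x) * (b x - r x * a x) ^ 2 := by positivity
  have h6 : (c x - a x * (1 / 2 * r x ^ 2 + 2 * u x) - 1 / 2 * (r x * b x)) ^ 2 = 0 := by
    nlinarith [sq_nonneg (c x - a x * (1 / 2 * r x ^ 2 + 2 * u x) - 1 / 2 * (r x * b x))]
  have h7 : (3 / 4 * r x ^ 2 + 2 * u x) * (b x - r x * a x) ^ 2 = 0 := by linarith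
  have h8 : b x - r x * a x = 0 := by
    rcases mul_eq_zero.1 h7 with h | h
    · exact absurd h h2.ne'
    · exact pow_eq_zero_iff (two_ne_zero) |>.1 h
  have h9 := pow_eq_zero_iff (two_ne_zero) |>.1 h6
  exact ⟨by linarith, by linear_combination h9 + 1 / 2 * r x * h8⟩

end
/-- Positive simple root with positive slope. -/
def PosR (y : ℝ × ℝ) (p : ℝ) : Prop :=
  0 < p ∧ 0 < 3 * p ^ 2 + 2 * y.1 ∧ p ^ 3 + 2 * y.1 * p + y.2 = 0

/-- Root with negative slope. -/
def MidR (y : ℝ × ℝ) (p : ℝ) : Prop :=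
  3 * p ^ 2 + 2 * y.1 < 0 ∧ p ^ 3 + 2 * y.1 * p + y.2 = 0

/-- choice of the positive root -/
noncomputable def rpos (y : ℝ × ℝ) : ℝ := Classical.epsilon (PosR y)
/-- choice of the middle root -/
noncomputable def rmid (y : ℝ × ℝ) : ℝ := Classical.epsilon (MidR y)

lemma rpos_spec {y : ℝ × ℝ} (h : ∃ p, PosR y p) : PosR y (rpos y) := Classical.epsilon_spec h
lemma rmid_spec {y : ℝ × ℝ} (h : ∃ p, MidR y p) : MidR y (rmid y) := Classical.epsilon_spec h

lemma vieta {u v p p' : ℝ} (h : p ^ 3 + 2 * u * p + v = 0) (h' : p' ^ 3 + 2 * u * p' + v = 0)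
    (hne : p ≠ p') : p ^ 2 + p * p' + p' ^ 2 + 2 * u = 0 := by
  have : (p - p') * (p ^ 2 + p * p' + p' ^ 2 + 2 * u) = 0 := by linear_combination h - h'
  exact (mul_eq_zero.1 this).resolve_left (sub_ne_zero.2 hne)

lemma PosR.unique {y : ℝ × ℝ} {p p' : ℝ} (h : PosR y p) (h' : PosR y p') : p = p' := by
  by_contra hne
  obtain ⟨h1, h2, h3⟩ := h
  obtain ⟨k1, k2, k3⟩ := h'
  have e := vieta h3 k3 hne
  rcases lt_or_gt_of_ne hne with hl | hl
  · nlinarith [mul_pos (sub_pos.2 hl) h1, mul_pos (sub_pos.2 hl) k1]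
  · nlinarith [mul_pos (sub_pos.2 hl) h1, mul_pos (sub_pos.2 hl) k1]

lemma MidR.unique {y : ℝ × ℝ} {p p' : ℝ} (h : MidR y p) (h' : MidR y p') : p = p' := by
  by_contra hne
  obtain ⟨h2, h3⟩ := h
  obtain ⟨k2, k3⟩ := h'
  have e := vieta h3 k3 hne
  have e1 : (p - p') * (2 * p + p') < 0 := by nlinarith
  have e2 : (p - p') * (p + 2 * p') > 0 := by nlinarith
  nlinarith [sq_nonneg (p - p')]

lemma big_pos {u v p : ℝ} (hp : 1 + 2 * |u| + |v| ≤ p) : 0 < p ^ 3 + 2 * u * p + v := by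
  have h1 := abs_nonneg u
  have h2 := abs_nonneg v
  have h3 := neg_abs_le u
  have h4 := neg_abs_le v
  have h5 : 1 + |v| ≤ p ^ 2 + 2 * u := by nlinarith
  nlinarith

lemma PosR.le {y : ℝ × ℝ} {p : ℝ} (h : PosR y p) : p ≤ 1 + 2 * |y.1| + |y.2| := by
  by_contra hc
  have := big_pos (not_le.1 hc).le
  linarith [h.2.2]

lemma exists_pos_of_neg {y : ℝ × ℝ} (h : y.2 < 0) : ∃ p, PosR y p := by
  have hM : 0 ≤ 1 + 2 * |y.1| + |y.2| := by positivity
  have hc : ContinuousOn (fun p : ℝ => p ^ 3 + 2 * y.1 * p + y.2)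
    (Icc 0 (1 + 2 * |y.1| + |y.2|)) := by fun_prop
  obtain ⟨p, hp, hp0⟩ := intermediate_value_Icc hM hc
    (show (0:ℝ) ∈ _ from ⟨by simpa using h.le, (big_pos le_rfl).le⟩)
  simp only at hp0
  have hpp : 0 < p := by
    rcases hp.1.lt_or_eq with h1 | h1
    · exact h1
    · rw [← h1] at hp0
      norm_num at hp0
      linarith
  refine ⟨p, hpp, ?_, hp0⟩
  have : 0 < p * (3 * p ^ 2 + 2 * y.1) := by
    have : p * (3 * p ^ 2 + 2 * y.1) = 2 * p ^ 3 - y.2 := by linear_combination hp0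
    rw [this]
    have : 0 < p ^ 3 := by positivity
    linarith
  exact pos_of_mul_pos_right this hpp.le

lemma exists_m {y : ℝ × ℝ} (h : 0 < -32 * y.1 ^ 3 - 27 * y.2 ^ 2) :
    ∃ m, 0 < m ∧ 2 * y.1 = -3 * m ^ 2 ∧ y.2 < 2 * m ^ 3 ∧ -(2 * m ^ 3) < y.2 := by
  have hu : y.1 < 0 := by
    by_contra hc
    have : 0 ≤ y.1 ^ 3 := pow_nonneg (not_lt.1 hc) 3
    nlinarith [sq_nonneg y.2]
  have e : √(-2 * y.1 / 3) ^ 2 = -2 * y.1 / 3 := Real.sq_sqrt (by linarith)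
  have hm : 0 < √(-2 * y.1 / 3) := Real.sqrt_pos.2 (by linarith)
  generalize √(-2 * y.1 / 3) = m at *
  have e2 : y.1 = -3 / 2 * m ^ 2 := by linarith
  have h3 : y.2 ^ 2 < (2 * m ^ 3) ^ 2 := by
    rw [e2] at h
    nlinarith
  have := abs_lt_of_sq_lt_sq h3 (by positivity)
  exact ⟨m, hm, by linarith, (abs_lt.1 this).2, (abs_lt.1 this).1⟩

lemma exists_pos_of_disc {y : ℝ × ℝ} (h : 0 < -32 * y.1 ^ 3 - 27 * y.2 ^ 2) : ∃ p, PosR y p := by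
  obtain ⟨m, hm, e, h1, h2⟩ := exists_m h
  have hc : ContinuousOn (fun p : ℝ => p ^ 3 + 2 * y.1 * p + y.2) (Icc m (2 * m)) := by fun_prop
  obtain ⟨p, hp, hp0⟩ := intermediate_value_Ioo (by linarith) hc
    (show (0:ℝ) ∈ _ from ⟨by simp only [e]; nlinarith, by simp only [e]; nlinarith⟩)
  exact ⟨p, hm.trans hp.1, by rw [e]; nlinarith [hp.1], hp0⟩

lemma exists_mid_of_disc {y : ℝ × ℝ} (h : 0 < -32 * y.1 ^ 3 - 27 * y.2 ^ 2) : ∃ p, MidR y p := by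
  obtain ⟨m, hm, e, h1, h2⟩ := exists_m h
  have hc : ContinuousOn (fun p : ℝ => p ^ 3 + 2 * y.1 * p + y.2) (Icc (-m) m) := by fun_prop
  obtain ⟨p, hp, hp0⟩ := intermediate_value_Ioo' (by linarith) hc
    (show (0:ℝ) ∈ _ from ⟨by simp only [e]; nlinarith, by simp only [e]; nlinarith⟩)
  exact ⟨p, by rw [e]; nlinarith [mul_pos (sub_pos.2 hp.1) (sub_pos.2 hp.2)], hp0⟩

lemma rpos_diff {y : ℝ × ℝ} (h : ∃ p, PosR y p) : DifferentiableAt ℝ rpos y := by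
  have hs := rpos_spec h
  refine root_diff {z | 0 < z.2 ∧ 0 < 3 * z.2 ^ 2 + 2 * z.1.1} ?_ ⟨hs.1, hs.2.1⟩ hs.2.2
    hs.2.1.ne' ?_
  · have h1 : IsOpen {z : (ℝ × ℝ) × ℝ | 0 < z.2} := isOpen_lt (by fun_prop) (by fun_prop)
    have h2 : IsOpen {z : (ℝ × ℝ) × ℝ | 0 < 3 * z.2 ^ 2 + 2 * z.1.1} :=
      isOpen_lt (by fun_prop) (by fun_prop)
    exact h1.inter h2
  · intro x p hp hr
    have : PosR x p := ⟨hp.1, hp.2, hr⟩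
    exact (rpos_spec ⟨p, this⟩).unique this

lemma rmid_diff {y : ℝ × ℝ} (h : ∃ p, MidR y p) : DifferentiableAt ℝ rmid y := by
  have hs := rmid_spec h
  refine root_diff {z | 3 * z.2 ^ 2 + 2 * z.1.1 < 0} ?_ hs.1 hs.2 hs.1.ne ?_
  · exact isOpen_lt (by fun_prop) (by fun_prop)
  · intro x p hp hr
    have : MidR x p := ⟨hp, hr⟩
    exact (rmid_spec ⟨p, this⟩).unique this

section
variable {u v w a b c aq bq cq r : ℝ × ℝ → ℝ} {U : Set (ℝ × ℝ)}

lemma Sol.cuv (h : Sol u v w a b c aq bq cq) : Continuous fun x => (u x, v x) :=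
  h.cu.prodMk h.cv

lemma br_pos (h : Sol u v w a b c aq bq cq) {W : Set (ℝ × ℝ)} (hW : IsOpen W)
    (hex : ∀ x, (u x, v x) ∈ W → ∃ p, PosR (u x, v x) p) :
    Br u v {x | (u x, v x) ∈ W} (fun x => rpos (u x, v x)) where
  isOpen := hW.preimage h.cuv
  pU := fun x => by simp [h.pu x, h.pv x]
  pr := fun x => by simp [h.pu x, h.pv x]
  diff := fun x hx => by
    have h1 := rpos_diff (hex x hx)
    exact DifferentiableAt.comp (g := rpos) (f := fun x => (u x, v x)) x h1 ((h.hu x).differentiableAt.prodMk (h.hv x).differentiableAt)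
  root := fun x hx => (rpos_spec (hex x hx)).2.2
  simple := fun x hx => (rpos_spec (hex x hx)).2.1.ne'

lemma br_mid (h : Sol u v w a b c aq bq cq) {W : Set (ℝ × ℝ)} (hW : IsOpen W)
    (hex : ∀ x, (u x, v x) ∈ W → ∃ p, MidR (u x, v x) p) :
    Br u v {x | (u x, v x) ∈ W} (fun x => rmid (u x, v x)) where
  isOpen := hW.preimage h.cuv
  pU := fun x => by simp [h.pu x, h.pv x]
  pr := fun x => by simp [h.pu x, h.pv x]
  diff := fun x hx => by
    have h1 := rmid_diff (hex x hx)
    exact DifferentiableAt.comp (g := rmid) (f := fun x => (u x, v x)) x h1 ((h.hu x).differentiableAt.prodMk (h.hv x).differentiableAt)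
  root := fun x hx => (rmid_spec (hex x hx)).2
  simple := fun x hx => (rmid_spec (hex x hx)).1.ne

lemma out_of_bound {κ g : ℝ × ℝ → ℝ} (hg : Continuous g) (hz : ∀ x, x ∉ U → g x = 0)
    (hle : ∀ y ∈ U, κ y ≤ g y) :
    ∀ x, x ∉ U → ∀ ε > 0, ∀ᶠ y in 𝓝 x, y ∈ U → κ y ≤ ε := by
  intro x hx ε hε
  have := (hg.tendsto x).eventually (gt_mem_nhds (show g x < ε by rw [hz x hx]; exact hε))
  filter_upwards [this] with y hy hyU
  exact (hle y hyU).trans (le_of_lt hy)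

lemma out_of_bound3 {κ g : ℝ × ℝ → ℝ} (hg : Continuous g) (hz : ∀ x, x ∉ U → g x = 0)
    (hle : ∀ y ∈ U, κ y ^ 3 ≤ g y) :
    ∀ x, x ∉ U → ∀ ε > 0, ∀ᶠ y in 𝓝 x, y ∈ U → κ y ≤ ε := by
  intro x hx ε hε
  filter_upwards [out_of_bound hg hz hle x hx (ε ^ 3) (by positivity)] with y hy hyU
  by_contra hc
  have := pow_lt_pow_left₀ (not_le.1 hc) hε.le (n := 3) (by norm_num)
  linarith [hy hyU]

lemma const_of (h : Sol u v w a b c aq bq cq) {W : Set (ℝ × ℝ)} (hW : IsOpen W)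
    {x0 : ℝ × ℝ} (h0 : (u x0, v x0) ∈ W)
    (hz : ∀ x, (u x, v x) ∈ W → a x = 0 ∧ b x = 0 ∧ c x = 0) :
    ∀ x, a x = 0 ∧ b x = 0 ∧ c x = 0 := by
  have hcl : IsClopen {x | (u x, v x) = (u x0, v x0)} := by
    refine ⟨isClosed_eq h.cuv continuous_const, ?_⟩
    rw [Metric.isOpen_iff]
    intro x hx
    have hxW : x ∈ (fun x => (u x, v x)) ⁻¹' W := by
      change (u x, v x) ∈ W
      rw [show (u x, v x) = _ from hx]; exact h0
    obtain ⟨ε, hε, hb⟩ := Metric.isOpen_iff.1 (hW.preimage h.cuv) x hxW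
    refine ⟨ε, hε, fun y hy => ?_⟩
    have key : ∀ f : ℝ × ℝ → ℝ, (∀ z ∈ Metric.ball x ε, HasFDerivAt f (0 : ℝ × ℝ →L[ℝ] ℝ) z) →
        f y = f x := by
      intro f hf
      exact Metric.isOpen_ball.is_const_of_fderiv_eq_zero (𝕜 := ℝ)
        (convex_ball x ε).isPreconnected
        (fun z hz => (hf z hz).differentiableAt.differentiableWithinAt)
        (fun z hz => (hf z hz).fderiv) hy (Metric.mem_ball_self hε)
    have k1 := key u fun z hz' => by
      obtain ⟨h1, h2, h3⟩ := hz z (hb hz')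
      refine (h.hu z).congr_fderiv ?_
      ext <;> simp [h1, h2]
    have k2 := key v fun z hz' => by
      obtain ⟨h1, h2, h3⟩ := hz z (hb hz')
      refine (h.hv z).congr_fderiv ?_
      ext <;> simp [h1, h2, h3]
    change (u y, v y) = _
    rw [k1, k2]
    exact hx
  intro x
  have hx : x ∈ {x | (u x, v x) = (u x0, v x0)} := by
    rw [hcl.eq_univ ⟨x0, rfl⟩]; trivial
  apply hz
  rw [show (u x, v x) = _ from hx]
  exact h0

lemma Sol.refl (h : Sol u v w a b c aq bq cq) :
    Sol (fun x => u (-x.1, x.2)) (fun x => -v (-x.1, x.2)) (fun x => w (-x.1, x.2))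
      (fun x => -a (-x.1, x.2)) (fun x => b (-x.1, x.2)) (fun x => -c (-x.1, x.2))
      (fun x => aq (-x.1, x.2)) (fun x => -bq (-x.1, x.2)) (fun x => cq (-x.1, x.2)) := by
  have hσ : ∀ x : ℝ × ℝ, HasFDerivAt (fun x : ℝ × ℝ => (-x.1, x.2))
      ((-ContinuousLinearMap.fst ℝ ℝ ℝ).prod (ContinuousLinearMap.snd ℝ ℝ ℝ)) x :=
    fun x => hasFDerivAt_fst.neg.prodMk hasFDerivAt_snd
  have key : ∀ {f : ℝ × ℝ → ℝ} {x : ℝ × ℝ} {p q p' : ℝ}, HasFDerivAt f (L p q) (-x.1, x.2) →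
      p' = -p → HasFDerivAt (fun x : ℝ × ℝ => f (-x.1, x.2)) (L p' q) x := by
    intro f x p q p' hf e
    refine (HasFDerivAt.comp x hf (hσ x)).congr_fderiv ?_
    ext <;> simp [e]
  have keyn : ∀ {f : ℝ × ℝ → ℝ} {x : ℝ × ℝ} {p q q' : ℝ}, HasFDerivAt f (L p q) (-x.1, x.2) →
      q' = -q → HasFDerivAt (fun x : ℝ × ℝ => -f (-x.1, x.2)) (L p q') x := by
    intro f x p q q' hf e
    refine (HasFDerivAt.comp x hf (hσ x)).neg.congr_fderiv ?_
    ext <;> simp [e]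
  have per : ∀ {f : ℝ × ℝ → ℝ}, Per f → Per (fun x => f (-x.1, x.2)) := by
    intro f hf x
    refine ⟨?_, (hf (-x.1, x.2)).2⟩
    have := (hf (-(x.1 + 1), x.2)).1
    simp only at this ⊢
    rw [← this]
    congr 2
    ring
  have pern : ∀ {f : ℝ × ℝ → ℝ}, Per f → Per (fun x => -f (-x.1, x.2)) := by
    intro f hf x
    have := per hf x
    exact ⟨congrArg Neg.neg this.1, congrArg Neg.neg this.2⟩
  exact
  { hu := fun x => key (h.hu _) (by ring)
    hv := fun x => keyn (h.hv _) (by ring)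
    hw := fun x => by
      have := key (p' := -c (-x.1, x.2)) (h.hw _) (by ring)
      convert this using 2
      ring
    ha := fun x => keyn (h.ha _) (by ring)
    hb := fun x => by
      have := key (p' := -bq (-x.1, x.2)) (h.hb _) (by ring)
      convert this using 2
      ring
    hc := fun x => keyn (h.hc _) (by ring)
    pu := per h.pu
    pv := pern h.pv
    pa := pern h.pa
    pb := per h.pb
    pc := pern h.pc }

end
section
variable {y : ℝ × ℝ} {r : ℝ}

lemma disc_id {u v r : ℝ} (h : r ^ 3 + 2 * u * r + v = 0) :
    4 * (3 / 4 * r ^ 2 + 2 * u) * (3 * r ^ 2 + 2 * u) ^ 2 = -(-32 * u ^ 3 - 27 * v ^ 2) := by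
  have : v = -(r ^ 3 + 2 * u * r) := by linarith
  rw [this]; ring

lemma PosR.D_pos (h : PosR y r) (hd : -32 * y.1 ^ 3 - 27 * y.2 ^ 2 < 0) :
    0 < 3 / 4 * r ^ 2 + 2 * y.1 := by
  have e := disc_id h.2.2
  have h2 := h.2.1
  have h3 : 0 < (3 / 4 * r ^ 2 + 2 * y.1) * (3 * r ^ 2 + 2 * y.1) ^ 2 := by linarith
  exact pos_of_mul_pos_left h3 (by positivity)

lemma PosR.facts (h : PosR y r) (hd : -32 * y.1 ^ 3 - 27 * y.2 ^ 2 < 0) :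
    (r * (3 / 4 * r ^ 2 + 2 * y.1)) ^ 2 ≤ y.2 ^ 2 ∧
    3 / 4 * r ^ 2 + 2 * y.1 ≤ (1 + 2 * |y.1| + |y.2|) ^ 2 + 2 * |y.1| ∧
    3 * r ^ 2 + 2 * y.1 ≤ 3 * (1 + 2 * |y.1| + |y.2|) ^ 2 + 2 * |y.1| ∧
    r ^ 2 ≤ (1 + 2 * |y.1| + |y.2|) ^ 2 ∧
    (3 / 4 * r ^ 2 + 2 * y.1) ^ 3 ≤ -(-32 * y.1 ^ 3 - 27 * y.2 ^ 2) := by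
  have hD := h.D_pos hd
  have hle := h.le
  have e := disc_id h.2.2
  obtain ⟨h1, h2, h3⟩ := h
  have hsq : r ^ 2 ≤ (1 + 2 * |y.1| + |y.2|) ^ 2 := pow_le_pow_left₀ h1.le hle 2
  have hu := le_abs_self y.1
  have hr2 : 0 < r ^ 2 := by positivity
  refine ⟨?_, by linarith, by linarith, hsq, ?_⟩
  · have hrD : 0 ≤ r * (3 / 4 * r ^ 2 + 2 * y.1) := by positivity
    have hr3 : 0 < r ^ 3 := by positivity
    have : r * (3 / 4 * r ^ 2 + 2 * y.1) ≤ -y.2 := by nlinarith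
    calc _ ≤ (-y.2) ^ 2 := pow_le_pow_left₀ hrD this 2
      _ = _ := by ring
  · rw [← e]
    have : (3 / 4 * r ^ 2 + 2 * y.1) ^ 2 ≤ (3 * r ^ 2 + 2 * y.1) ^ 2 :=
      pow_le_pow_left₀ hD.le (by linarith) 2
    have k : (3 / 4 * r ^ 2 + 2 * y.1) * (3 / 4 * r ^ 2 + 2 * y.1) ^ 2 ≤
      (3 / 4 * r ^ 2 + 2 * y.1) * (3 * r ^ 2 + 2 * y.1) ^ 2 := mul_le_mul_of_nonneg_left this hD.le
    have k2 : 0 ≤ (3 / 4 * r ^ 2 + 2 * y.1) * (3 * r ^ 2 + 2 * y.1) ^ 2 := by positivity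
    nlinarith

lemma bound_ell (h : PosR y r) (hd : -32 * y.1 ^ 3 - 27 * y.2 ^ 2 < 0) (hv : y.2 < 0) :
    r ^ 2 * (3 / 4 * r ^ 2 + 2 * y.1) ^ 3 ≤
      min (max (-y.2) 0 ^ 2 * ((1 + 2 * |y.1| + |y.2|) ^ 2 + 2 * |y.1|))
        ((1 + 2 * |y.1| + |y.2|) ^ 2 * max (-(-32 * y.1 ^ 3 - 27 * y.2 ^ 2)) 0) := by
  obtain ⟨f1, f2, f3, f4, f5⟩ := h.facts hd
  have hD := h.D_pos hd
  rw [max_eq_left (by linarith), max_eq_left (by linarith)]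
  refine le_min ?_ ?_
  · calc _ = (r * (3 / 4 * r ^ 2 + 2 * y.1)) ^ 2 * (3 / 4 * r ^ 2 + 2 * y.1) := by ring
      _ ≤ y.2 ^ 2 * ((1 + 2 * |y.1| + |y.2|) ^ 2 + 2 * |y.1|) :=
        mul_le_mul f1 f2 hD.le (by positivity)
      _ = _ := by ring
  · exact mul_le_mul f4 f5 (by positivity) (by positivity)

lemma bound_wave (h : PosR y r) (hd : -32 * y.1 ^ 3 - 27 * y.2 ^ 2 < 0) (hv : y.2 < 0) :
    (r * (3 / 4 * r ^ 2 + 2 * y.1) * (3 * r ^ 2 + 2 * y.1)) ^ 2 ≤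
      min (max (-y.2) 0 ^ 2 * (3 * (1 + 2 * |y.1| + |y.2|) ^ 2 + 2 * |y.1|) ^ 2)
        ((1 + 2 * |y.1| + |y.2|) ^ 2 * ((1 + 2 * |y.1| + |y.2|) ^ 2 + 2 * |y.1|) *
          max (-(-32 * y.1 ^ 3 - 27 * y.2 ^ 2)) 0) := by
  obtain ⟨f1, f2, f3, f4, f5⟩ := h.facts hd
  have hD := h.D_pos hd
  have e := disc_id h.2.2
  rw [max_eq_left (by linarith), max_eq_left (by linarith)]
  refine le_min ?_ ?_
  · calc _ = (r * (3 / 4 * r ^ 2 + 2 * y.1)) ^ 2 * (3 * r ^ 2 + 2 * y.1) ^ 2 := by ring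
      _ ≤ y.2 ^ 2 * (3 * (1 + 2 * |y.1| + |y.2|) ^ 2 + 2 * |y.1|) ^ 2 :=
        mul_le_mul f1 (pow_le_pow_left₀ h.2.1.le f3 2) (by positivity) (by positivity)
      _ = _ := by ring
  · calc _ = r ^ 2 * (3 / 4 * r ^ 2 + 2 * y.1) * ((3 / 4 * r ^ 2 + 2 * y.1) *
          (3 * r ^ 2 + 2 * y.1) ^ 2) := by ring
      _ ≤ _ := by
        refine mul_le_mul (mul_le_mul f4 f2 hD.le (by positivity)) (by linarith) (by positivity)
          (by positivity)

lemma bound_s (h : PosR y r) (hd : 0 ≤ -32 * y.1 ^ 3 - 27 * y.2 ^ 2) :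
    (3 * r ^ 2 + 2 * y.1) ^ 3 ≤ 2 * max (-32 * y.1 ^ 3 - 27 * y.2 ^ 2) 0 +
      81 * max (-y.2) 0 * (1 + 2 * |y.1| + |y.2|) ^ 3 := by
  have hle := h.le
  obtain ⟨h1, h2, h3⟩ := h
  have hu : y.1 ≤ 0 := by
    by_contra hc
    have : 0 < y.1 ^ 3 := pow_pos (not_le.1 hc) 3
    nlinarith [sq_nonneg y.2]
  have e : (3 * r ^ 2 + 2 * y.1) ^ 3 = 2 * (-32 * y.1 ^ 3 - 27 * y.2 ^ 2) +
      9 * (r ^ 2 + 2 * y.1) * (3 * r ^ 2 + 2 * y.1) ^ 2 := by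
    have : y.2 = -(r ^ 3 + 2 * y.1 * r) := by linarith
    rw [this]; ring
  rw [max_eq_left hd, e]
  have e2 : r * (r ^ 2 + 2 * y.1) = -y.2 := by linear_combination h3
  rcases le_or_gt 0 y.2 with hv | hv
  · have : r ^ 2 + 2 * y.1 ≤ 0 := by
      by_contra hc
      have := mul_pos h1 (not_le.1 hc)
      linarith
    have k : (r ^ 2 + 2 * y.1) * (3 * r ^ 2 + 2 * y.1) ^ 2 ≤ 0 :=
      mul_nonpos_of_nonpos_of_nonneg this (by positivity)
    have k2 : 0 ≤ 81 * max (-y.2) 0 * (1 + 2 * |y.1| + |y.2|) ^ 3 := by positivity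
    linarith
  · rw [max_eq_left (by linarith)]
    have hp : 0 < r ^ 2 + 2 * y.1 := pos_of_mul_pos_right (by rw [e2]; linarith) h1.le
    have k1 : (3 * r ^ 2 + 2 * y.1) ^ 2 ≤ (3 * r ^ 2) ^ 2 :=
      pow_le_pow_left₀ h2.le (by linarith) 2
    have k2 : r ^ 3 ≤ (1 + 2 * |y.1| + |y.2|) ^ 3 := pow_le_pow_left₀ h1.le hle 3
    have k3 := mul_le_mul_of_nonneg_left k1 hp.le
    have k4 := mul_le_mul_of_nonneg_left k2 (show 0 ≤ -y.2 by linarith)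
    have k5 : (r ^ 2 + 2 * y.1) * (3 * r ^ 2) ^ 2 = 9 * (-y.2 * r ^ 3) := by
      rw [← e2]; ring
    linarith

lemma bound_mid (h : MidR y r) (hd : 0 < -32 * y.1 ^ 3 - 27 * y.2 ^ 2) :
    (r * (3 / 4 * r ^ 2 + 2 * y.1) * (3 * r ^ 2 + 2 * y.1)) ^ 2 ≤
      y.1 ^ 2 * max (-32 * y.1 ^ 3 - 27 * y.2 ^ 2) 0 := by
  obtain ⟨h1, h2⟩ := h
  have e := disc_id h2
  rw [max_eq_left hd.le]
  have e2 : (r * (3 / 4 * r ^ 2 + 2 * y.1) * (3 * r ^ 2 + 2 * y.1)) ^ 2 =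
      r ^ 2 * (-(3 / 4 * r ^ 2 + 2 * y.1)) * ((-32 * y.1 ^ 3 - 27 * y.2 ^ 2) / 4) := by
    linear_combination (r ^ 2 * (3 / 4 * r ^ 2 + 2 * y.1)) / 4 * e
  rw [e2]
  have hr := sq_nonneg r
  have k1 : r ^ 2 ≤ -y.1 := by linarith
  have k2 : -(3 / 4 * r ^ 2 + 2 * y.1) ≤ 4 * (-y.1) := by linarith
  calc _ ≤ (-y.1) * (4 * (-y.1)) * ((-32 * y.1 ^ 3 - 27 * y.2 ^ 2) / 4) := by
        refine mul_le_mul_of_nonneg_right (mul_le_mul k1 k2 ?_ ?_) ?_ <;> linarith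
    _ = _ := by ring

end

section
variable {u v w a b c aq bq cq : ℝ × ℝ → ℝ}

lemma ell_pos (h : Sol u v w a b c aq bq cq) {x0 : ℝ × ℝ}
    (h1 : -32 * u x0 ^ 3 - 27 * v x0 ^ 2 < 0) (h2 : v x0 < 0) :
    ∀ x, a x = 0 ∧ b x = 0 ∧ c x = 0 := by
  have cu := h.cu
  have cv := h.cv
  let W : Set (ℝ × ℝ) := {y | -32 * y.1 ^ 3 - 27 * y.2 ^ 2 < 0 ∧ y.2 < 0}
  have hW : IsOpen W := by
    have o1 : IsOpen {y : ℝ × ℝ | -32 * y.1 ^ 3 - 27 * y.2 ^ 2 < 0} :=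
      isOpen_lt (by fun_prop) (by fun_prop)
    have o2 : IsOpen {y : ℝ × ℝ | y.2 < 0} := isOpen_lt (by fun_prop) (by fun_prop)
    exact o1.inter o2
  have hex : ∀ x, (u x, v x) ∈ W → ∃ p, PosR (u x, v x) p := fun x hx => exists_pos_of_neg hx.2
  have B := br_pos h hW hex
  have hz : ∀ x, x ∉ {x | (u x, v x) ∈ W} → max (-v x) 0 = 0 ∨
      max (-(-32 * u x ^ 3 - 27 * v x ^ 2)) 0 = 0 := by
    intro x hx
    by_contra hc
    push Not at hc
    apply hx
    constructor
    · by_contra hc'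
      have h0 := not_lt.1 hc'
      exact hc.2 (max_eq_right (neg_nonpos.2 h0))
    · by_contra hc'
      exact hc.1 (max_eq_right (by simpa using hc'))
  have S := step_ell h B (fun x hx => (rpos_spec (hex x hx)).1)
    (fun x hx => (rpos_spec (hex x hx)).D_pos hx.1)
    (out_of_bound (g := fun x => min (max (-v x) 0 ^ 2 * ((1 + 2 * |u x| + |v x|) ^ 2 + 2 * |u x|))
        ((1 + 2 * |u x| + |v x|) ^ 2 * max (-(-32 * u x ^ 3 - 27 * v x ^ 2)) 0))
      (by fun_prop) (fun x hx => by
        rcases hz x hx with e | e <;> simp only [e]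
        · simp only [ne_eq, OfNat.ofNat_ne_zero, not_false_eq_true, zero_pow, zero_mul]
          exact min_eq_left (by positivity)
        · simp only [mul_zero]
          exact min_eq_right (by positivity))
      (fun x hx => bound_ell (rpos_spec (hex x hx)) hx.1 hx.2))
  have T := step_wave h B (fun x hx => (S x hx).1) (fun x hx => (S x hx).2)
    (out_of_bound (g := fun x => min (max (-v x) 0 ^ 2 *
        (3 * (1 + 2 * |u x| + |v x|) ^ 2 + 2 * |u x|) ^ 2)
        ((1 + 2 * |u x| + |v x|) ^ 2 * ((1 + 2 * |u x| + |v x|) ^ 2 + 2 * |u x|) *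
          max (-(-32 * u x ^ 3 - 27 * v x ^ 2)) 0))
      (by fun_prop) (fun x hx => by
        rcases hz x hx with e | e <;> simp only [e]
        · simp only [ne_eq, OfNat.ofNat_ne_zero, not_false_eq_true, zero_pow, zero_mul]
          exact min_eq_left (by positivity)
        · simp only [mul_zero]
          exact min_eq_right (by positivity))
      (fun x hx => bound_wave (rpos_spec (hex x hx)) hx.1 hx.2))
  refine const_of h hW (x0 := x0) ⟨h1, h2⟩ fun x hx => ?_
  have e := T x hx (rpos_spec (hex x hx)).1.ne' ((rpos_spec (hex x hx)).D_pos hx.1).ne'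
  obtain ⟨s1, s2⟩ := S x hx
  rw [e] at s1 s2
  exact ⟨e, by simpa using s1, by simpa using s2⟩

lemma refl_zero (h : ∀ x : ℝ × ℝ, -a (-x.1, x.2) = 0 ∧ b (-x.1, x.2) = 0 ∧ -c (-x.1, x.2) = 0) :
    ∀ x, a x = 0 ∧ b x = 0 ∧ c x = 0 := by
  intro x
  simpa using h (-x.1, x.2)

lemma lax_pos (h : Sol u v w a b c aq bq cq)
    (hE : ∀ x, -32 * u x ^ 3 - 27 * v x ^ 2 < 0 → v x = 0) (x : ℝ × ℝ) (p : ℝ)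
    (hp : PosR (u x, v x) p) (hx : v x < 0 ∨ 0 < -32 * u x ^ 3 - 27 * v x ^ 2) :
    a x * p ^ 2 + b x * p + c x = 0 := by
  have cu := h.cu
  have cv := h.cv
  have ca := h.ca
  have cb := h.cb
  have cc := h.cc
  let W : Set (ℝ × ℝ) := {y | y.2 < 0 ∨ 0 < -32 * y.1 ^ 3 - 27 * y.2 ^ 2}
  have hW : IsOpen W := by
    have o1 : IsOpen {y : ℝ × ℝ | 0 < -32 * y.1 ^ 3 - 27 * y.2 ^ 2} :=
      isOpen_lt (by fun_prop) (by fun_prop)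
    have o2 : IsOpen {y : ℝ × ℝ | y.2 < 0} := isOpen_lt (by fun_prop) (by fun_prop)
    exact o2.union o1
  have hex : ∀ x, (u x, v x) ∈ W → ∃ p, PosR (u x, v x) p := fun x hx =>
    hx.elim exists_pos_of_neg exists_pos_of_disc
  have B := br_pos h hW hex
  have hd : ∀ x, (u x, v x) ∈ W → 0 ≤ -32 * u x ^ 3 - 27 * v x ^ 2 := by
    intro x hx
    rcases hx with hx | hx
    · by_contra hc
      have := hE x (not_le.1 hc)
      simp only at hx
      linarith
    · exact hx.le
  have S := step_lax h B (fun x hx => (rpos_spec (hex x hx)).1)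
    (out_of_bound3 (g := fun x => (|a x| * (1 + 2 * |u x| + |v x|) ^ 2 +
        |b x| * (1 + 2 * |u x| + |v x|) + |c x|) ^ 12 *
        (2 * max (-32 * u x ^ 3 - 27 * v x ^ 2) 0 +
          81 * max (-v x) 0 * (1 + 2 * |u x| + |v x|) ^ 3) ^ 2)
      (by fun_prop) (fun x hx => by
        have hx' : ¬ (v x < 0 ∨ 0 < -32 * u x ^ 3 - 27 * v x ^ 2) := hx
        push Not at hx'
        rw [max_eq_right hx'.2, max_eq_right (by linarith)]
        simp)
      (fun x hx => by
        have hr := rpos_spec (hex x hx)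
        have hb := bound_s hr (hd x hx)
        have hle := hr.le
        obtain ⟨r1, r2, r3⟩ := hr
        simp only at hb hle r2 r3 ⊢
        generalize rpos (u x, v x) = r at *
        have z1 : |a x * r ^ 2 + b x * r + c x| ≤ |a x| * (1 + 2 * |u x| + |v x|) ^ 2 +
            |b x| * (1 + 2 * |u x| + |v x|) + |c x| := by
          refine (abs_add_le _ _).trans (add_le_add_left ((abs_add_le _ _).trans ?_) _)
          rw [abs_mul, abs_mul, abs_pow, abs_of_pos r1]
          gcongr
        have z2 : (a x * r ^ 2 + b x * r + c x) ^ 12 ≤ (|a x| * (1 + 2 * |u x| + |v x|) ^ 2 +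
            |b x| * (1 + 2 * |u x| + |v x|) + |c x|) ^ 12 := by
          rw [← Even.pow_abs (by decide : Even 12)]
          exact pow_le_pow_left₀ (abs_nonneg _) z1 12
        calc _ = (a x * r ^ 2 + b x * r + c x) ^ 12 * ((3 * r ^ 2 + 2 * u x) ^ 3) ^ 2 := by ring
          _ ≤ _ := mul_le_mul z2 (pow_le_pow_left₀ (by positivity) hb 2) (by positivity)
            (by positivity)))
  have := S x hx
  rw [(rpos_spec (hex x hx)).unique hp] at this
  exact this

lemma lax_neg (h : Sol u v w a b c aq bq cq)
    (hE : ∀ x, -32 * u x ^ 3 - 27 * v x ^ 2 < 0 → v x = 0) (x : ℝ × ℝ) (p : ℝ)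
    (hp : PosR (u x, -v x) p) (hx : 0 < v x ∨ 0 < -32 * u x ^ 3 - 27 * v x ^ 2) :
    a x * p ^ 2 - b x * p + c x = 0 := by
  have := lax_pos h.refl (fun x hx => by simpa using hE (-x.1, x.2) (by simpa using hx))
    (-x.1, x.2) p (by simpa using hp) (by simpa using hx)
  simp only [neg_neg] at this
  linear_combination -this

lemma hyp_zero (h : Sol u v w a b c aq bq cq)
    (hE : ∀ x, -32 * u x ^ 3 - 27 * v x ^ 2 < 0 → v x = 0) {x0 : ℝ × ℝ}
    (h1 : 0 < -32 * u x0 ^ 3 - 27 * v x0 ^ 2) (h2 : v x0 ≠ 0) :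
    ∀ x, a x = 0 ∧ b x = 0 ∧ c x = 0 := by
  have cu := h.cu
  have cv := h.cv
  let W : Set (ℝ × ℝ) := {y | 0 < -32 * y.1 ^ 3 - 27 * y.2 ^ 2}
  have hW : IsOpen W := isOpen_lt (by fun_prop) (by fun_prop)
  have hex : ∀ x, (u x, v x) ∈ W → ∃ p, MidR (u x, v x) p := fun x hx => exists_mid_of_disc hx
  have B := br_mid h hW hex
  have S : ∀ x ∈ {x | (u x, v x) ∈ W}, b x = rmid (u x, v x) * a x ∧
      c x = (rmid (u x, v x) ^ 2 + 2 * u x) * a x := by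
    intro x hx
    have hx' : 0 < -32 * u x ^ 3 - 27 * v x ^ 2 := hx
    have hr := rmid_spec (hex x hx)
    obtain ⟨p, hp⟩ := exists_pos_of_disc (y := (u x, v x)) hx
    obtain ⟨p', hp'⟩ := exists_pos_of_disc (y := (u x, -v x)) (by simpa using hx')
    have z1 := lax_pos h hE x p hp (Or.inr hx')
    have z2 := lax_neg h hE x p' hp' (Or.inr hx')
    obtain ⟨q1, q2, q3⟩ := hp
    obtain ⟨s1, s2, s3⟩ := hp'
    obtain ⟨r1, r2⟩ := hr
    simp only at q2 q3 s2 s3 r1 r2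
    generalize rmid (u x, v x) = r at *
    have s3' : (-p') ^ 3 + 2 * u x * (-p') + v x = 0 := by linear_combination -s3
    have n1 : p ≠ r := by rintro rfl; linarith
    have n2 : -p' ≠ r := by rintro rfl; rw [neg_sq] at r1; linarith
    have e1 := vieta q3 r2 n1
    have e2 := vieta s3' r2 n2
    have e3 : r = p' - p := by
      have : (p + p') * (r - (p' - p)) = 0 := by linear_combination e1 - e2
      have := (mul_eq_zero.1 this).resolve_left (by positivity)
      linarith
    have e4 : b x = r * a x := by
      have : (p + p') * (b x - r * a x) = 0 := by
        rw [e3]; linear_combination z1 - z2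
      have := (mul_eq_zero.1 this).resolve_left (by positivity)
      linarith
    refine ⟨e4, ?_⟩
    rw [e4] at z1
    linear_combination z1 - a x * e1
  have T := step_wave h B (fun x hx => (S x hx).1) (fun x hx => (S x hx).2)
    (out_of_bound (g := fun x => u x ^ 2 * max (-32 * u x ^ 3 - 27 * v x ^ 2) 0)
      (by fun_prop) (fun x hx => by
        have hx' : ¬ (0 < -32 * u x ^ 3 - 27 * v x ^ 2) := hx
        rw [max_eq_right (not_lt.1 hx'), mul_zero])
      (fun x hx => bound_mid (rmid_spec (hex x hx)) hx))
  have hW2 : IsOpen (W ∩ {y | y.2 ≠ 0}) :=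
    hW.inter (isOpen_ne_fun (by fun_prop) (by fun_prop))
  refine const_of h hW2 (x0 := x0) ⟨h1, h2⟩ fun x hx => ?_
  have hr := rmid_spec (hex x hx.1)
  have hx1 : 0 < -32 * u x ^ 3 - 27 * v x ^ 2 := hx.1
  have e : a x = 0 := by
    refine T x hx.1 ?_ ?_
    · intro h0
      have := hr.2
      rw [h0] at this
      apply hx.2
      simpa using this
    · intro h0
      have := disc_id hr.2
      simp only at this
      rw [h0] at this
      linarith
  obtain ⟨s1, s2⟩ := S x hx.1
  rw [e] at s1 s2
  exact ⟨e, by simpa using s1, by simpa using s2⟩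

lemma par_zero (h : Sol u v w a b c aq bq cq)
    (hE : ∀ x, v x ≠ 0 → -32 * u x ^ 3 - 27 * v x ^ 2 = 0) {x0 : ℝ × ℝ} (h2 : v x0 < 0) :
    ∀ x, a x = 0 ∧ b x = 0 ∧ c x = 0 := by
  have hW : IsOpen {y : ℝ × ℝ | y.2 < 0} := isOpen_lt (by fun_prop) (by fun_prop)
  refine const_of h hW (x0 := x0) h2 fun x hx => ?_
  have hx' : v x < 0 := hx
  obtain ⟨r, hr⟩ := exists_pos_of_neg (y := (u x, v x)) hx
  have z := lax_pos h (fun x hx => by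
    by_contra hc
    rw [hE x hc] at hx
    exact lt_irrefl _ hx) x r hr (Or.inl hx')
  have hd := disc_id hr.2.2
  obtain ⟨r1, r2, r3⟩ := hr
  simp only at hd r2 r3
  rw [hE x hx'.ne] at hd
  have hD : 3 / 4 * r ^ 2 + 2 * u x = 0 := by
    have hs : (3 * r ^ 2 + 2 * u x) ^ 2 ≠ 0 := by positivity
    rw [neg_zero] at hd
    have := (mul_eq_zero.1 hd).resolve_right hs
    linarith
  have d1 := D_sub (D_cmul (-32) (D_pow 3 (h.hu x))) (D_cmul 27 (D_pow 2 (h.hv x)))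
  have d2 : HasFDerivAt (fun y => -32 * u y ^ 3 - 27 * v y ^ 2) (L 0 0) x := by
    refine (D_const 0 x).congr_of_eventuallyEq ?_
    filter_upwards [(hW.preimage h.cuv).mem_nhds hx] with y hy
    have hy' : v y < 0 := hy
    exact hE y hy'.ne
  obtain ⟨e1, e2⟩ := D_unique d1 d2
  norm_num at e1 e2
  have hu : u x = -3 / 8 * r ^ 2 := by linarith
  have hv : v x = -1 / 4 * r ^ 3 := by rw [hu] at r3; linarith
  rw [hu, hv] at e1 e2
  have hr3 : r ^ 3 ≠ 0 := by positivity
  have k1 : b x = r * a x := by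
    apply mul_left_cancel₀ hr3
    linear_combination (2 / 27) * e1
  have k2 : c x = r ^ 2 / 4 * a x := by
    apply mul_left_cancel₀ hr3
    rw [k1] at e2
    linear_combination (-2 / 27) * e2
  have k3 : a x = 0 := by
    rw [k1, k2] at z
    have : r ^ 2 * a x = 0 := by linear_combination 4 / 9 * z
    exact (mul_eq_zero.1 this).resolve_left (by positivity)
  rw [k3, mul_zero] at k1 k2
  exact ⟨k3, k1, k2⟩

theorem core (h : Sol u v w a b c aq bq cq) (x : ℝ × ℝ) :
    b x = 0 ∧ -c x + 2 * u x * a x = 0 ∧ v x * a x = 0 := by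
  by_cases hz : ∀ x, a x = 0 ∧ b x = 0 ∧ c x = 0
  · simp [hz x]
  have h1 : ∀ x, -32 * u x ^ 3 - 27 * v x ^ 2 < 0 → v x = 0 := by
    intro x hx
    by_contra hv
    rcases lt_or_gt_of_ne hv with hv | hv
    · exact hz (ell_pos h hx hv)
    · exact hz (refl_zero (ell_pos h.refl (x0 := (-x.1, x.2)) (by simpa using hx)
        (by simpa using hv)))
  have h2 : ∀ x, v x ≠ 0 → -32 * u x ^ 3 - 27 * v x ^ 2 = 0 := by
    intro x hv
    rcases lt_trichotomy (-32 * u x ^ 3 - 27 * v x ^ 2) 0 with hx | hx | hx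
    · exact absurd (h1 x hx) hv
    · exact hx
    · exact absurd (hyp_zero h h1 hx hv) hz
  have h3 : ∀ x, v x = 0 := by
    intro x
    by_contra hv
    rcases lt_or_gt_of_ne hv with hv | hv
    · exact hz (par_zero h h2 hv)
    · exact hz (refl_zero (par_zero h.refl (x0 := (-x.1, x.2))
        (fun y hy => by simpa using h2 (-y.1, y.2) (by simpa using hy)) (by simpa using hv)))
  have hv0 : v = fun _ => 0 := funext h3
  have hv := h.hv x
  have hc : HasFDerivAt v (L 0 0) x := by rw [hv0]; exact D_const 0 x
  obtain ⟨e1, e2⟩ := D_unique hv hc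
  exact ⟨e1, e2, by rw [h3, zero_mul]⟩

end
/-- space derivative -/
noncomputable def dq (f : ℝ × ℝ → ℝ) (x : ℝ × ℝ) : ℝ := fderiv ℝ f x (1, 0)
/-- time derivative -/
noncomputable def dt (f : ℝ × ℝ → ℝ) (x : ℝ × ℝ) : ℝ := fderiv ℝ f x (0, 1)

lemma has_L {f : ℝ × ℝ → ℝ} (hf : ContDiff ℝ (⊤ : ℕ∞) f) (x : ℝ × ℝ) :
    HasFDerivAt f (L (dq f x) (dt f x)) x := by
  have h : DifferentiableAt ℝ f x := (hf.differentiable (by simp)) x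
  unfold dq dt
  rw [← eq_L]
  exact h.hasFDerivAt

lemma smooth_dir {f : ℝ × ℝ → ℝ} (hf : ContDiff ℝ (⊤ : ℕ∞) f) (e : ℝ × ℝ) :
    ContDiff ℝ (⊤ : ℕ∞) (fun x => fderiv ℝ f x e) :=
  (hf.fderiv_right (m := (⊤ : ℕ∞)) (by simp)).clm_apply contDiff_const

lemma dt_dq {f : ℝ × ℝ → ℝ} (hf : ContDiff ℝ (⊤ : ℕ∞) f) (x : ℝ × ℝ) :
    dt (dq f) x = dq (dt f) x := by
  have hd : DifferentiableAt ℝ (fderiv ℝ f) x :=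
    ((hf.fderiv_right (m := (⊤ : ℕ∞)) (by simp)).differentiable (by simp)) x
  have hs : IsSymmSndFDerivAt ℝ f x := by
    have h2 : ContDiff ℝ 2 f := contDiff_infty.1 hf 2
    refine h2.contDiffAt.isSymmSndFDerivAt ?_
    simp
  have key : ∀ e e' : ℝ × ℝ, fderiv ℝ (fun y => fderiv ℝ f y e) x e' =
      fderiv ℝ (fderiv ℝ f) x e' e := by
    intro e e'
    have := (hd.hasFDerivAt.clm_apply (hasFDerivAt_const e x)).fderiv
    rw [this]
    simp
  change fderiv ℝ (fun y => fderiv ℝ f y (1, 0)) x (0, 1) =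
    fderiv ℝ (fun y => fderiv ℝ f y (0, 1)) x (1, 0)
  rw [key, key]
  exact hs _ _

lemma per_dq {f : ℝ × ℝ → ℝ} (hf : Per f) : Per (dq f) := by
  have key : ∀ e x : ℝ × ℝ, (∀ y, f (y + e) = f y) → dq f (x + e) = dq f x := by
    intro e x h
    unfold dq
    rw [← fderiv_comp_add_right]
    simp only [h]
  intro x
  constructor
  · have := key (1, 0) x (fun y => by
      have := (hf y).1
      convert this using 2
      ext <;> simp)
    convert this using 2
    ext <;> simp
  · have := key (0, 1) x (fun y => by
      have := (hf y).2
      convert this using 2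
      ext <;> simp)
    convert this using 2
    ext <;> simp

lemma deriv_fst_slice {g : ℝ → ℝ → ℝ} (hg : ContDiff ℝ (⊤ : ℕ∞) (fun z : ℝ × ℝ => g z.1 z.2))
    (q t : ℝ) : deriv (fun x => g x t) q = dq (fun z : ℝ × ℝ => g z.1 z.2) (q, t) := by
  have h := has_L hg (q, t)
  have h2 : HasDerivAt (fun x : ℝ => ((x, t) : ℝ × ℝ)) (1, 0) q :=
    (hasDerivAt_id q).prodMk (hasDerivAt_const q t)
  have := (HasFDerivAt.comp_hasDerivAt (f := fun x : ℝ => ((x, t) : ℝ × ℝ)) q h h2).deriv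
  simpa [Function.comp_def] using this

lemma deriv_snd_slice {g : ℝ → ℝ → ℝ} (hg : ContDiff ℝ (⊤ : ℕ∞) (fun z : ℝ × ℝ => g z.1 z.2))
    (q t : ℝ) : deriv (fun s => g q s) t = dt (fun z : ℝ × ℝ => g z.1 z.2) (q, t) := by
  have h := has_L hg (q, t)
  have h2 : HasDerivAt (fun x : ℝ => ((q, x) : ℝ × ℝ)) (0, 1) t :=
    (hasDerivAt_const t q).prodMk (hasDerivAt_id t)
  have := (HasFDerivAt.comp_hasDerivAt (f := fun x : ℝ => ((q, x) : ℝ × ℝ)) t h h2).deriv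
  simpa [Function.comp_def] using this

lemma dq_of {f : ℝ × ℝ → ℝ} {x : ℝ × ℝ} {p q : ℝ} (h : HasFDerivAt f (L p q) x) : dq f x = p := by
  unfold dq; rw [h.fderiv]; simp

lemma sol_of {u v w : ℝ × ℝ → ℝ} (hu : ContDiff ℝ (⊤ : ℕ∞) u) (hv : ContDiff ℝ (⊤ : ℕ∞) v)
    (hw : ContDiff ℝ (⊤ : ℕ∞) w) (pu : Per u) (pv : Per v) (pw : Per w)
    (e1 : ∀ x, dt u x = -dq v x) (e2 : ∀ x, dt v x = -dq w x + 2 * u x * dq u x)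
    (e3 : ∀ x, dt w x = v x * dq u x) :
    Sol u v w (dq u) (dq v) (dq w) (dq (dq u)) (dq (dq v)) (dq (dq w)) := by
  have su := smooth_dir hu (1, 0)
  have sv := smooth_dir hv (1, 0)
  have sw := smooth_dir hw (1, 0)
  have hu' := has_L hu
  have hv' := has_L hv
  have hw' := has_L hw
  have hau : ∀ x, HasFDerivAt (dq u) (L (dq (dq u) x) (dt (dq u) x)) x := has_L su
  have hav : ∀ x, HasFDerivAt (dq v) (L (dq (dq v) x) (dt (dq v) x)) x := has_L sv
  have haw : ∀ x, HasFDerivAt (dq w) (L (dq (dq w) x) (dt (dq w) x)) x := has_L sw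
  have f1 : ∀ x, dt (dq u) x = -dq (dq v) x := by
    intro x
    rw [dt_dq hu, funext e1]
    have := D_cmul (-1) (hav x)
    simp only [neg_one_mul] at this
    exact dq_of this
  have f2 : ∀ x, dt (dq v) x = -dq (dq w) x + 2 * dq u x ^ 2 + 2 * u x * dq (dq u) x := by
    intro x
    rw [dt_dq hv, funext e2]
    have := dq_of (D_add (D_cmul (-1) (haw x)) (D_mul (D_cmul 2 (hu' x)) (hau x)))
    simp only [neg_one_mul] at this
    rw [this]
    ring
  have f3 : ∀ x, dt (dq w) x = dq v x * dq u x + v x * dq (dq u) x := by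
    intro x
    rw [dt_dq hw, funext e3]
    exact dq_of (D_mul (hv' x) (hau x))
  exact
  { hu := fun x => by rw [← e1]; exact hu' x
    hv := fun x => by rw [← e2]; exact hv' x
    hw := fun x => by rw [← e3]; exact hw' x
    ha := fun x => by rw [← f1]; exact hau x
    hb := fun x => by rw [← f2]; exact hav x
    hc := fun x => by rw [← f3]; exact haw x
    pu := pu
    pv := pv
    pa := per_dq pu
    pb := per_dq pv
    pc := per_dq pw }

end Benney

/-- A smooth periodic solution of the n = 3 dispersionless Lax
reduction of the Benney chain does not depend on `t`. -/
theorem benney_n3_periodic_solutions_are_traveling_waves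
    (u₁ u₂ u₃ : ℝ → ℝ → ℝ)
    (hu₁ : ContDiff ℝ (⊤ : ℕ∞) (fun z : ℝ × ℝ => u₁ z.1 z.2))
    (hu₂ : ContDiff ℝ (⊤ : ℕ∞) (fun z : ℝ × ℝ => u₂ z.1 z.2))
    (hu₃ : ContDiff ℝ (⊤ : ℕ∞) (fun z : ℝ × ℝ => u₃ z.1 z.2))
    (hq₁ : ∀ t, Function.Periodic (fun q => u₁ q t) 1)
    (hq₂ : ∀ t, Function.Periodic (fun q => u₂ q t) 1)
    (hq₃ : ∀ t, Function.Periodic (fun q => u₃ q t) 1)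
    (ht₁ : ∀ q, Function.Periodic (fun t => u₁ q t) 1)
    (ht₂ : ∀ q, Function.Periodic (fun t => u₂ q t) 1)
    (ht₃ : ∀ q, Function.Periodic (fun t => u₃ q t) 1)
    (hsys₁ : ∀ q t, deriv (fun s => u₁ q s) t + deriv (fun x => u₂ x t) q = 0)
    (hsys₂ : ∀ q t, deriv (fun s => u₂ q s) t + deriv (fun x => u₃ x t) q
        - 2 * u₁ q t * deriv (fun x => u₁ x t) q = 0)
    (hsys₃ : ∀ q t, deriv (fun s => u₃ q s) t - u₂ q t * deriv (fun x => u₁ x t) q = 0) :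
    ∀ q t, deriv (fun s => u₁ q s) t = 0 ∧ deriv (fun s => u₂ q s) t = 0 ∧
      deriv (fun s => u₃ q s) t = 0 := by

  have es : ∀ x : ℝ × ℝ,
      Benney.dt (fun z : ℝ × ℝ => u₁ z.1 z.2) x = -Benney.dq (fun z : ℝ × ℝ => u₂ z.1 z.2) x ∧
      Benney.dt (fun z : ℝ × ℝ => u₂ z.1 z.2) x = -Benney.dq (fun z : ℝ × ℝ => u₃ z.1 z.2) x +
        2 * u₁ x.1 x.2 * Benney.dq (fun z : ℝ × ℝ => u₁ z.1 z.2) x ∧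
      Benney.dt (fun z : ℝ × ℝ => u₃ z.1 z.2) x =
        u₂ x.1 x.2 * Benney.dq (fun z : ℝ × ℝ => u₁ z.1 z.2) x := by
    intro x
    have h1 := hsys₁ x.1 x.2
    have h2 := hsys₂ x.1 x.2
    have h3 := hsys₃ x.1 x.2
    rw [Benney.deriv_snd_slice hu₁, Benney.deriv_fst_slice hu₂] at h1
    rw [Benney.deriv_snd_slice hu₂, Benney.deriv_fst_slice hu₃, Benney.deriv_fst_slice hu₁] at h2
    rw [Benney.deriv_snd_slice hu₃, Benney.deriv_fst_slice hu₁] at h3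
    exact ⟨by linarith, by linarith, by linarith⟩
  have S := Benney.sol_of hu₁ hu₂ hu₃ (fun x => ⟨hq₁ x.2 x.1, ht₁ x.1 x.2⟩)
    (fun x => ⟨hq₂ x.2 x.1, ht₂ x.1 x.2⟩) (fun x => ⟨hq₃ x.2 x.1, ht₃ x.1 x.2⟩)
    (fun x => (es x).1) (fun x => (es x).2.1) (fun x => (es x).2.2)
  intro q t
  obtain ⟨k1, k2, k3⟩ := Benney.core S (q, t)
  obtain ⟨l1, l2, l3⟩ := es (q, t)
  rw [Benney.deriv_snd_slice hu₁, Benney.deriv_snd_slice hu₂, Benney.deriv_snd_slice hu₃,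
    l1, l2, l3]
  exact ⟨by rw [k1, neg_zero], k2, k3⟩
end

section
/- Let F(p,q,t) = p⁴/4 + u₁(q,t)p² + u₂(q,t)p + u₃(q,t) be a polynomial of degree four in p whose smooth coefficients u₁, u₂, u₃ are periodic of period 1 in q and in t, and suppose F satisfies the conservation equation ∂_t F + p ∂_q F − (∂_q u₁) ∂_p F = 0 identically in p. Then either u₁, u₂, u₃ are all constant functions, or there exists a constant c ∈ ℝ such that u₂ ≡ 0, ∂_t u₁ ≡ 0, u₃ = u₁² + c, and hence F(p,q,t) = (p²/2 + u₁(q))² + c is, up to an additive constant, the square of the quadratic energy integral H = p²/2 + u₁. -/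
namespace QI

section
open Filter Topology Set

noncomputable def Dq (f : ℝ × ℝ → ℝ) (z : ℝ × ℝ) : ℝ := fderiv ℝ f z (1, 0)
noncomputable def Dt (f : ℝ × ℝ → ℝ) (z : ℝ × ℝ) : ℝ := fderiv ℝ f z (0, 1)

abbrev Sm (f : ℝ × ℝ → ℝ) : Prop := ContDiff ℝ (⊤ : ℕ∞) f

lemma Sm.dq {f : ℝ × ℝ → ℝ} (h : Sm f) : Sm (Dq f) := by
  have : ContDiff ℝ (⊤ : ℕ∞) (fderiv ℝ f) := h.fderiv_right (by simp)
  exact this.clm_apply contDiff_const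

lemma Sm.dt {f : ℝ × ℝ → ℝ} (h : Sm f) : Sm (Dt f) := by
  have : ContDiff ℝ (⊤ : ℕ∞) (fderiv ℝ f) := h.fderiv_right (by simp)
  exact this.clm_apply contDiff_const

lemma Sm.diff {f : ℝ × ℝ → ℝ} (h : Sm f) (z) : DifferentiableAt ℝ f z :=
  (h.differentiable (by simp)) z

lemma Sm.comm {f : ℝ × ℝ → ℝ} (h : Sm f) (z) : Dt (Dq f) z = Dq (Dt f) z := by
  have h1 : ContDiff ℝ (⊤ : ℕ∞) (fderiv ℝ f) := h.fderiv_right (by simp)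
  have h2 : DifferentiableAt ℝ (fderiv ℝ f) z := (h1.differentiable (by simp)) z
  have hs : IsSymmSndFDerivAt ℝ f z := by
    apply ContDiffAt.isSymmSndFDerivAt h.contDiffAt
    simp only [minSmoothness_of_isRCLikeNormedField]
    exact WithTop.coe_le_coe.2 le_top
  have e1 : ∀ a b, fderiv ℝ (fun z => fderiv ℝ f z a) z b = fderiv ℝ (fderiv ℝ f) z b a := by
    intro a b
    rw [fderiv_clm_apply h2 (differentiableAt_const a)]
    simp
  unfold Dq Dt
  rw [e1, e1]
  exact hs _ _

lemma fd_apply (f : ℝ × ℝ → ℝ) (z) (a b : ℝ) : fderiv ℝ f z (a, b) = a * Dq f z + b * Dt f z := by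
  have : ((a, b) : ℝ × ℝ) = a • (1, 0) + b • (0, 1) := by simp
  rw [this, map_add, map_smul, map_smul]; rfl

lemma Sm.line {f : ℝ × ℝ → ℝ} (h : Sm f) (z : ℝ × ℝ) (a b : ℝ) :
    HasDerivAt (fun s : ℝ => f (z.1 + a * s, z.2 + b * s)) (a * Dq f z + b * Dt f z) 0 := by
  rw [← fd_apply]
  have h1 : HasDerivAt (fun s : ℝ => ((z.1 + a * s, z.2 + b * s) : ℝ × ℝ)) (a, b) 0 := by
    have ha : HasDerivAt (fun s : ℝ => z.1 + a * s) a 0 := by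
      simpa using ((hasDerivAt_id (0:ℝ)).const_mul a).const_add z.1
    have hb : HasDerivAt (fun s : ℝ => z.2 + b * s) b 0 := by
      simpa using ((hasDerivAt_id (0:ℝ)).const_mul b).const_add z.2
    exact ha.prodMk hb
  have h2 : HasFDerivAt f (fderiv ℝ f z) ((fun s : ℝ => ((z.1 + a * s, z.2 + b * s) : ℝ × ℝ)) 0) := by
    simpa using (h.diff z).hasFDerivAt
  exact h2.comp_hasDerivAt 0 h1

def Per (f : ℝ × ℝ → ℝ) : Prop := ∀ q t, f (q + 1, t) = f (q, t) ∧ f (q, t + 1) = f (q, t)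

lemma per_fd {f : ℝ × ℝ → ℝ} (c : ℝ × ℝ) (hc : ∀ z, f (z + c) = f z) (z) :
    fderiv ℝ f (z + c) = fderiv ℝ f z := by
  have : (fun z => f (z + c)) = f := funext hc
  rw [← fderiv_comp_add_right, this]

lemma Per.dq {f : ℝ × ℝ → ℝ} (h : Per f) : Per (Dq f) := by
  intro q t
  have h1 := per_fd (f := f) (1, 0) (fun z => by obtain ⟨x, y⟩ := z; simpa using (h x y).1) (q, t)
  have h2 := per_fd (f := f) (0, 1) (fun z => by obtain ⟨x, y⟩ := z; simpa using (h x y).2) (q, t)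
  simp only [Prod.mk_add_mk, add_zero] at h1 h2
  unfold Dq
  rw [h1, h2]; simp

lemma Per.dt {f : ℝ × ℝ → ℝ} (h : Per f) : Per (Dt f) := by
  intro q t
  have h1 := per_fd (f := f) (1, 0) (fun z => by obtain ⟨x, y⟩ := z; simpa using (h x y).1) (q, t)
  have h2 := per_fd (f := f) (0, 1) (fun z => by obtain ⟨x, y⟩ := z; simpa using (h x y).2) (q, t)
  simp only [Prod.mk_add_mk, add_zero] at h1 h2
  unfold Dt
  rw [h1, h2]; simp

lemma Per.fract {f : ℝ × ℝ → ℝ} (h : Per f) (q t : ℝ) : f (q, t) = f (Int.fract q, Int.fract t) := by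
  have h1 : Function.Periodic (fun q => f (q, t)) 1 := fun q => (h q t).1
  have h2 : Function.Periodic (fun t => f (Int.fract q, t)) 1 := fun t => (h _ t).2
  have e1 := h1.sub_int_mul_eq (x := q) ⌊q⌋
  have e2 := h2.sub_int_mul_eq (x := t) ⌊t⌋
  simp only [mul_one, Int.self_sub_floor] at e1 e2
  rw [← e1, ← e2]

lemma Per.bdd {f : ℝ × ℝ → ℝ} (h : Per f) (hc : Continuous f) : ∃ M, ∀ z, |f z| ≤ M := by
  obtain ⟨M, hM⟩ := (isCompact_Icc (a := (0:ℝ)) (b := 1) |>.prod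
    (isCompact_Icc (a := (0:ℝ)) (b := 1))).exists_bound_of_continuousOn hc.continuousOn
  refine ⟨M, fun z => ?_⟩
  obtain ⟨q, t⟩ := z
  rw [h.fract]
  exact hM _ ⟨⟨Int.fract_nonneg _, (Int.fract_lt_one _).le⟩, ⟨Int.fract_nonneg _, (Int.fract_lt_one _).le⟩⟩

structure Sys (u v w : ℝ × ℝ → ℝ) : Prop where
  su : Sm u
  sv : Sm v
  sw : Sm w
  pu : Per u
  pv : Per v
  pw : Per w
  e1 : ∀ z, Dt u z = - Dq v z
  e2 : ∀ z, Dt v z = 2 * u z * Dq u z - Dq w z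
  e3 : ∀ z, Dt w z = v z * Dq u z

def Stat (u v w : ℝ × ℝ → ℝ) (z : ℝ × ℝ) : Prop := Dq u z = 0 ∧ Dq v z = 0 ∧ Dq w z = 0

/-- derivative of the quartic in the direction q at p -/
noncomputable def PP (u v w : ℝ × ℝ → ℝ) (z : ℝ × ℝ) (l : ℝ) : ℝ :=
  l ^ 2 * Dq u z + l * Dq v z + Dq w z

lemma dq_smul_sub {f g : ℝ × ℝ → ℝ} (hf : Sm f) (hg : Sm g) (z) :
    Dq (fun z => 2 * f z * Dq f z - Dq g z) z
      = 2 * Dq f z * Dq f z + 2 * f z * Dq (Dq f) z - Dq (Dq g) z := by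
  have h1 := (((hf.line z 1 0).const_mul 2).mul (hf.dq.line z 1 0)).sub (hg.dq.line z 1 0)
  have hs : Sm (fun z => 2 * f z * Dq f z - Dq g z) := by
    have := hf.dq; have := hg.dq
    unfold Sm at *
    fun_prop
  have h2 := hs.line z 1 0
  have := h2.unique h1
  simp at this
  linarith

lemma dq_mul {f g : ℝ × ℝ → ℝ} (hf : Sm f) (hg : Sm g) (z) :
    Dq (fun z => f z * g z) z = Dq f z * g z + f z * Dq g z := by
  have h1 := (hf.line z 1 0).mul (hg.line z 1 0)
  have h2 := Sm.line (f := fun z => f z * g z) (ContDiff.mul hf hg) z 1 0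
  have := h2.unique h1
  simpa using this

lemma dq_neg {f : ℝ × ℝ → ℝ} (z) : Dq (fun z => - f z) z = - Dq f z := by
  unfold Dq
  rw [fderiv_fun_neg]; rfl

section
variable {u v w : ℝ × ℝ → ℝ}

lemma Sys.x1 (S : Sys u v w) (z) : Dt (Dq u) z = - Dq (Dq v) z := by
  rw [S.su.comm, funext S.e1, dq_neg]
lemma Sys.x2 (S : Sys u v w) (z) : Dt (Dq v) z
    = 2 * Dq u z * Dq u z + 2 * u z * Dq (Dq u) z - Dq (Dq w) z := by
  rw [S.sv.comm, funext S.e2, dq_smul_sub S.su S.sw]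
lemma Sys.x3 (S : Sys u v w) (z) : Dt (Dq w) z = Dq v z * Dq u z + v z * Dq (Dq u) z := by
  rw [S.sw.comm, funext S.e3, dq_mul S.sv S.su.dq]

/-- pointwise multiplier argument -/
lemma Sys.point (S : Sys u v w) (q t l : ℝ) (k : ℕ) (e : ℝ)  (he : e ≠ 0)
    (hroot : l ^ 3 + 2 * u (q, t) * l + v (q, t) = 0)
    (hl : l ≠ 0) (hPi : 3 * l ^ 2 + 2 * u (q, t) ≠ 0) (hP : PP u v w (q, t) l ≠ 0)
    (hk : k = 0 ∨ PP u v w (q, t) l = Dq u (q, t) * (3 * l ^ 2 + 2 * u (q, t)))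
    (hmax : IsLocalMaxOn (fun x : (ℝ × ℝ) × ℝ => e * (x.2 ^ k * ((3 * x.2 ^ 2 + 2 * u x.1) * PP u v w x.1 x.2 ^ 2)))
      {x | x.2 ^ 3 + 2 * u x.1 * x.2 + v x.1 = 0} ((q, t), l)) : False := by
  set f : (ℝ × ℝ) × ℝ → ℝ := fun x => x.2 ^ 3 + 2 * u x.1 * x.2 + v x.1 with hf
  set Q : (ℝ × ℝ) × ℝ → ℝ := fun x => e * (x.2 ^ k * ((3 * x.2 ^ 2 + 2 * u x.1) * PP u v w x.1 x.2 ^ 2)) with hQ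
  have hu := S.su; have hv := S.sv; have hw := S.sw
  have hu' := S.su.dq; have hv' := S.sv.dq; have hw' := S.sw.dq
  have cf : ContDiff ℝ (⊤ : ℕ∞) f := by
    unfold Sm at *
    fun_prop
  have cQ : ContDiff ℝ (⊤ : ℕ∞) Q := by
    unfold Sm at *
    simp only [hQ, PP]
    fun_prop
  have sf := cf.contDiffAt.hasStrictFDerivAt (x := ((q, t), l)) (by simp)
  have sQ := cQ.contDiffAt.hasStrictFDerivAt (x := ((q, t), l)) (by simp)
  have hset : {x | f x = f ((q, t), l)} = {x : (ℝ × ℝ) × ℝ | x.2 ^ 3 + 2 * u x.1 * x.2 + v x.1 = 0} := by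
    ext x; simp only [hf, mem_ofPred_eq, hroot]
  rw [← hset] at hmax
  obtain ⟨a, b, hab, heq⟩ := IsLocalExtrOn.exists_multipliers_of_hasStrictFDerivAt_1d hmax.isExtr sf sQ
  set tau : ℝ := PP u v w (q, t) l / (3 * l ^ 2 + 2 * u (q, t)) - Dq u (q, t) with htau
  have lineD : ∀ (g : (ℝ × ℝ) × ℝ → ℝ), ContDiff ℝ (⊤ : ℕ∞) g → ∀ a b c : ℝ,
      HasDerivAt (fun s : ℝ => g ((q + a * s, t + b * s), l + c * s)) (fderiv ℝ g ((q, t), l) ((a, b), c)) 0 := by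
    intro g hg a b c
    have ha : ∀ x y : ℝ, HasDerivAt (fun s : ℝ => x + y * s) y 0 := fun x y => by
      simpa using ((hasDerivAt_id (0:ℝ)).const_mul y).const_add x
    have h1 := ((ha q a).prodMk (ha t b)).prodMk (ha l c)
    have h2 : HasFDerivAt g (fderiv ℝ g ((q, t), l)) ((fun s : ℝ => (((q + a * s, t + b * s), l + c * s) : (ℝ × ℝ) × ℝ)) 0) := by
      simpa using (hg.differentiable (by simp) ((q, t), l)).hasFDerivAt
    exact h2.comp_hasDerivAt 0 h1
  have hlin : ∀ x y : ℝ, HasDerivAt (fun s : ℝ => x + y * s) y 0 := fun x y => by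
      simpa using ((hasDerivAt_id (0:ℝ)).const_mul y).const_add x
  have fgen : ∀ a b c : ℝ, fderiv ℝ f ((q, t), l) ((a, b), c) =
      (3 * l ^ 2 + 2 * u (q, t)) * c + 2 * l * (a * Dq u (q, t) + b * Dt u (q, t)) + (a * Dq v (q, t) + b * Dt v (q, t)) := by
    intro a b c
    refine (lineD f cf a b c).unique ?_
    have := (((hlin l c).pow 3).add (((hu.line (q, t) a b).const_mul 2).mul (hlin l c))).add (hv.line (q, t) a b)
    refine this.congr_deriv ?_
    simp; ring
  have Qgen : ∀ a b c : ℝ, fderiv ℝ Q ((q, t), l) ((a, b), c) =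
      e * ((k * l ^ (k - 1) * c) * ((3 * l ^ 2 + 2 * u (q, t)) * PP u v w (q, t) l ^ 2) + l ^ k *
        ((6 * l * c + 2 * (a * Dq u (q, t) + b * Dt u (q, t))) * PP u v w (q, t) l ^ 2
        + (3 * l ^ 2 + 2 * u (q, t)) * (2 * PP u v w (q, t) l * ((2 * l * Dq u (q, t) + Dq v (q, t)) * c
          + l ^ 2 * (a * Dq (Dq u) (q, t) + b * Dt (Dq u) (q, t))
          + l * (a * Dq (Dq v) (q, t) + b * Dt (Dq v) (q, t)) + (a * Dq (Dq w) (q, t) + b * Dt (Dq w) (q, t)))))) := by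
    intro a b c
    refine (lineD Q cQ a b c).unique ?_
    have hPPd := ((((hlin l c).pow 2).mul (hu'.line (q, t) a b)).add ((hlin l c).mul (hv'.line (q, t) a b))).add (hw'.line (q, t) a b)
    have hPid := (((hlin l c).pow 2).const_mul 3).add ((hu.line (q, t) a b).const_mul 2)
    have := (((hlin l c).pow k).mul (hPid.mul (hPPd.pow 2))).const_mul e
    refine this.congr_deriv ?_
    simp only [Pi.mul_apply, Pi.pow_apply, Pi.add_apply, mul_zero, add_zero, PP]
    push_cast
    ring
  have key1 : fderiv ℝ f ((q, t), l) ((l, 1), tau) = 0 := by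
    rw [fgen, S.e1, S.e2, htau]
    unfold PP
    field_simp
    ring
  have key2 : fderiv ℝ f ((q, t), l) ((0, 0), 1) ≠ 0 := by
    rw [fgen]; simpa using hPi
  have hb : b ≠ 0 := by
    rintro rfl
    have h0 := DFunLike.congr_fun heq ((0, 0), 1)
    simp [key2] at h0
    exact hab (by simp [h0])
  have h0 := DFunLike.congr_fun heq ((l, 1), tau)
  simp [key1, hb] at h0
  rw [Qgen] at h0
  have hktau : (k : ℝ) * tau = 0 := by
    rcases hk with rfl | hk
    · simp
    · rw [htau, hk]; field_simp; ring
  have hv0 : v (q, t) = - (l ^ 3 + 2 * u (q, t) * l) := by linarith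
  have key3 : ((6 * l * tau + 2 * (l * Dq u (q, t) + 1 * Dt u (q, t))) * PP u v w (q, t) l ^ 2
        + (3 * l ^ 2 + 2 * u (q, t)) * (2 * PP u v w (q, t) l * ((2 * l * Dq u (q, t) + Dq v (q, t)) * tau
          + l ^ 2 * (l * Dq (Dq u) (q, t) + 1 * Dt (Dq u) (q, t))
          + l * (l * Dq (Dq v) (q, t) + 1 * Dt (Dq v) (q, t)) + (l * Dq (Dq w) (q, t) + 1 * Dt (Dq w) (q, t)))))
       = 6 * l * PP u v w (q, t) l ^ 3 / (3 * l ^ 2 + 2 * u (q, t)) := by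
    have ht : tau * (3 * l ^ 2 + 2 * u (q, t)) = PP u v w (q, t) l - Dq u (q, t) * (3 * l ^ 2 + 2 * u (q, t)) := by
      rw [htau, sub_mul, div_mul_cancel₀ _ hPi]
    rw [S.x1, S.x2, S.x3, S.e1, hv0, eq_div_iff hPi]
    clear_value tau
    have hPP : PP u v w (q, t) l = l ^ 2 * Dq u (q, t) + l * Dq v (q, t) + Dq w (q, t) := rfl
    rw [hPP] at ht ⊢
    linear_combination (6 * l * (l ^ 2 * Dq u (q, t) + l * Dq v (q, t) + Dq w (q, t)) ^ 2 +
      2 * (3 * l ^ 2 + 2 * u (q, t)) * (l ^ 2 * Dq u (q, t) + l * Dq v (q, t) + Dq w (q, t)) * (2 * l * Dq u (q, t) + Dq v (q, t))) * ht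
  rw [key3] at h0
  have : (k : ℝ) * l ^ (k - 1) * tau = 0 := by
    rw [mul_right_comm, hktau, zero_mul]
  rw [this] at h0
  simp [he, hl, hP, hPi] at h0

lemma Sys.root_bdd (S : Sys u v w) : ∃ R : ℝ, ∀ z l, l ^ 3 + 2 * u z * l + v z = 0 → |l| ≤ R := by
  obtain ⟨M, hM⟩ := S.pu.bdd S.su.continuous
  obtain ⟨N, hN⟩ := S.pv.bdd S.sv.continuous
  have hM0 := (abs_nonneg _).trans (hM 0)
  have hN0 := (abs_nonneg _).trans (hN 0)
  refine ⟨1 + 2 * M + N, fun z l h => ?_⟩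
  by_contra hc
  push Not at hc
  have h1 : |l| ^ 3 ≤ 2 * M * |l| + N := by
    rw [← abs_pow, show l ^ 3 = -(2 * u z * l + v z) by linarith, abs_neg]
    refine (abs_add_le _ _).trans (add_le_add ?_ (hN z))
    rw [abs_mul, abs_mul, abs_two]
    have := hM z
    gcongr
  have hl1 : 1 < |l| := by linarith
  nlinarith [mul_pos (by linarith : 0 < |l|) (by linarith : 0 < |l| - 1), mul_nonneg hN0 (by linarith : 0 ≤ |l| - 1),
    mul_nonneg (mul_nonneg hM0 (by linarith : 0 ≤ |l|)) (by linarith : 0 ≤ |l| - 1),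
    mul_pos (by linarith : 0 < |l|) (by linarith : 0 < |l| - (1 + 2 * M + N)), 
    mul_pos (mul_pos (by linarith : 0 < |l|) (by linarith : 0 < |l|)) (by linarith : 0 < |l| - (1 + 2 * M + N))]

/-- maximum principle -/
lemma Sys.maxp (S : Sys u v w) (k : ℕ) (e : ℝ) (he : e ≠ 0) (C : ℝ → Prop)
    (hC : IsClosed {x | C x})
    (hloc : ∀ z l, l ^ 3 + 2 * u z * l + v z = 0 → C (u z) →
      0 < e * (l ^ k * ((3 * l ^ 2 + 2 * u z) * PP u v w z l ^ 2)) →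
      l ≠ 0 ∧ (∀ᶠ x in 𝓝 (u z), C x) ∧
      (k = 0 ∨ PP u v w z l = Dq u z * (3 * l ^ 2 + 2 * u z))) :
    ∀ z l, l ^ 3 + 2 * u z * l + v z = 0 → C (u z) →
      e * (l ^ k * ((3 * l ^ 2 + 2 * u z) * PP u v w z l ^ 2)) ≤ 0 := by
  intro z0 l0 hr0 hC0
  by_contra hpos
  push Not at hpos
  obtain ⟨R, hR⟩ := S.root_bdd
  set Q : (ℝ × ℝ) × ℝ → ℝ := fun x => e * (x.2 ^ k * ((3 * x.2 ^ 2 + 2 * u x.1) * PP u v w x.1 x.2 ^ 2)) with hQ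
  have cu := S.su.continuous; have cv := S.sv.continuous
  have cu' := S.su.dq.continuous; have cv' := S.sv.dq.continuous; have cw' := S.sw.dq.continuous
  have cQ : Continuous Q := by
    simp only [hQ, PP]
    fun_prop
  have perQ : ∀ q t l, Q ((q, t), l) = Q ((Int.fract q, Int.fract t), l) := by
    intro q t l
    simp only [hQ, PP]
    rw [S.pu.fract, S.pu.dq.fract, S.pv.dq.fract, S.pw.dq.fract]
  set K : Set ((ℝ × ℝ) × ℝ) := ((Icc 0 1 ×ˢ Icc 0 1) ×ˢ Icc (-R) R) ∩ {x | x.2 ^ 3 + 2 * u x.1 * x.2 + v x.1 = 0} ∩ {x | C (u x.1)} with hK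
  have compK : IsCompact K := by
    refine ((isCompact_Icc.prod isCompact_Icc).prod isCompact_Icc).inter_right ?_ |>.inter_right ?_
    · exact isClosed_eq (by fun_prop) continuous_const
    · exact hC.preimage (f := fun x : (ℝ × ℝ) × ℝ => u x.1) (by fun_prop)
  have memK : ∀ q t l, l ^ 3 + 2 * u (q, t) * l + v (q, t) = 0 → C (u (q, t)) → ((Int.fract q, Int.fract t), l) ∈ K := by
    intro q t l h1 h2
    refine ⟨⟨⟨⟨⟨Int.fract_nonneg _, (Int.fract_lt_one _).le⟩, ⟨Int.fract_nonneg _, (Int.fract_lt_one _).le⟩⟩, abs_le.mp (hR _ _ h1)⟩, ?_⟩, ?_⟩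
    · rw [S.pu.fract, S.pv.fract] at h1; exact h1
    · rw [S.pu.fract] at h2; exact h2
  obtain ⟨⟨⟨q, t⟩, l⟩, hx, hmax⟩ := compK.exists_isMaxOn ⟨_, memK z0.1 z0.2 l0 hr0 hC0⟩ cQ.continuousOn
  have hgl : ∀ z' l', l' ^ 3 + 2 * u z' * l' + v z' = 0 → C (u z') → Q (z', l') ≤ Q ((q, t), l) := by
    rintro ⟨q', t'⟩ l' h1 h2
    rw [perQ]
    exact hmax (memK q' t' l' h1 h2)
  have hr : l ^ 3 + 2 * u (q, t) * l + v (q, t) = 0 := hx.1.2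
  have hc : C (u (q, t)) := hx.2
  have hQp : 0 < Q ((q, t), l) := lt_of_lt_of_le hpos (hgl z0 l0 hr0 hC0)
  obtain ⟨hl, hev, hk⟩ := hloc (q, t) l hr hc hQp
  have hne : Q ((q, t), l) ≠ 0 := hQp.ne'
  simp only [hQ] at hne
  have hPi : 3 * l ^ 2 + 2 * u (q, t) ≠ 0 := by intro h; simp [h] at hne
  have hP : PP u v w (q, t) l ≠ 0 := by intro h; simp [h] at hne
  refine S.point q t l k e he hr hl hPi hP hk ?_
  have hev' : ∀ᶠ x in 𝓝 (((q, t), l) : (ℝ × ℝ) × ℝ), C (u x.1) := by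
    have : Tendsto (fun x : (ℝ × ℝ) × ℝ => u x.1) (𝓝 ((q, t), l)) (𝓝 (u (q, t))) :=
      (cu.comp continuous_fst).tendsto _
    exact this.eventually hev
  have h3 := hev'.filter_mono (nhdsWithin_le_nhds (s := {x | x.2 ^ 3 + 2 * u x.1 * x.2 + v x.1 = 0}))
  filter_upwards [h3, self_mem_nhdsWithin] with x hx1 hx2
  exact hgl x.1 x.2 hx2 hx1
end
end

section
open Filter Topology Set
section
variable {u v w : ℝ × ℝ → ℝ}

lemma exists_root (x y : ℝ) (hy : 0 < y) : ∃ a : ℝ, 0 < a ∧ 8 * a ^ 3 + 4 * x * a = y := by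
  have hc : ContinuousOn (fun a : ℝ => 8 * a ^ 3 + 4 * x * a) (Icc 0 (1 + |x| + y)) := by fun_prop
  have h := intermediate_value_Icc (by positivity) hc
  have hx := neg_abs_le x
  have hx0 := abs_nonneg x
  obtain ⟨a, ha, hay⟩ := h (show y ∈ _ by
    refine ⟨by simpa using hy.le, ?_⟩
    set b := 1 + |x| + y with hb
    have h1 : 1 ≤ b := by linarith
    have h2 : b * 1 ≤ b * b := by nlinarith
    have h3 : -(|x| * b) ≤ x * b := by nlinarith
    have h4 : |x| * b ≤ b * b := by nlinarith
    have h5 : b * b * 1 ≤ b * b * b := by gcongr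
    show y ≤ 8 * b ^ 3 + 4 * x * b
    nlinarith)
  refine ⟨a, lt_of_le_of_ne ha.1 ?_, hay⟩
  rintro rfl
  simp at hay
  linarith

lemma disc_id (x a : ℝ) : 32 * x ^ 3 + 27 * (8 * a ^ 3 + 4 * x * a) ^ 2
    = 4 * (2 * x + 3 * a ^ 2) * (12 * a ^ 2 + 2 * x) ^ 2 := by ring

lemma Sys.fin1 (S : Sys u v w) (h : ∀ z, v z ≠ 0 → 32 * u z ^ 3 + 27 * v z ^ 2 ≤ 0)
    (z : ℝ × ℝ) (l : ℝ) (hr : l ^ 3 + 2 * u z * l + v z = 0) (hu : u z ≤ 0)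
    (hPi : 0 < 3 * l ^ 2 + 2 * u z) : PP u v w z l = 0 := by
  have := S.maxp 0 1 one_ne_zero (fun x => x ≤ 0) isClosed_Iic (by
    intro z l hr hu hpos
    have hPi : 0 < 3 * l ^ 2 + 2 * u z := by
      by_contra hc
      push Not at hc
      simp only [pow_zero, one_mul] at hpos
      nlinarith [mul_nonneg (neg_nonneg.2 hc) (sq_nonneg (PP u v w z l))]
    have hl : l ≠ 0 := by rintro rfl; nlinarith
    refine ⟨hl, ?_, Or.inl rfl⟩
    have hlt : u z < 0 := by
      refine lt_of_le_of_ne hu fun h0 => ?_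
      have hv : v z = 0 := by
        by_contra hv
        have := h z hv
        rw [h0] at this
        have := sq_pos_of_ne_zero hv
        nlinarith
      rw [h0, hv] at hr
      simp at hr
      exact hl hr
    filter_upwards [Iio_mem_nhds hlt] with x hx
    exact le_of_lt hx) z l hr hu
  simp only [pow_zero, one_mul] at this
  by_contra hne
  have h2 := sq_pos_of_ne_zero hne
  nlinarith [mul_pos hPi h2]

lemma Sys.fin2 (S : Sys u v w) (h : ∀ z, v z ≠ 0 → 32 * u z ^ 3 + 27 * v z ^ 2 ≤ 0)
    (z : ℝ × ℝ) (l : ℝ) (hr : l ^ 3 + 2 * u z * l + v z = 0) (hl : l ≠ 0)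
    (hPi : 3 * l ^ 2 + 2 * u z < 0) : PP u v w z l = 0 := by
  have hu : u z ≤ 0 := by nlinarith [sq_nonneg l]
  have := S.maxp 2 (-1) (by norm_num) (fun x => x ≤ 0) isClosed_Iic (by
    intro z l hr hu hpos
    have hl : l ≠ 0 := by rintro rfl; simp at hpos
    have hl2 := sq_pos_of_ne_zero hl
    have hPi : 3 * l ^ 2 + 2 * u z < 0 := by
      by_contra hc
      push Not at hc
      nlinarith [mul_nonneg hl2.le (mul_nonneg hc (sq_nonneg (PP u v w z l)))]
    have hlt : u z < 0 := by nlinarith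
    refine ⟨hl, ?_, Or.inr ?_⟩
    · filter_upwards [Iio_mem_nhds hlt] with x hx
      exact le_of_lt hx
    · have hd : 0 < -3 * l ^ 2 - 8 * u z := by nlinarith
      set c := √(-3 * l ^ 2 - 8 * u z) with hc
      have hc2 : c ^ 2 = -3 * l ^ 2 - 8 * u z := Real.sq_sqrt hd.le
      have hc0 : 0 < c := Real.sqrt_pos.2 hd
      have hcl : 0 < c ^ 2 - 9 * l ^ 2 := by nlinarith
      have hpm : 0 < c + 3 * l ∧ 0 < c - 3 * l := by
        constructor <;> nlinarith
      have huz : u z = (-3 * l ^ 2 - c ^ 2) / 8 := by linarith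
      have hvz : v z = - l ^ 3 - 2 * u z * l := by linarith
      have r1 := S.fin1 h z ((-l + c) / 2) (by rw [hvz, huz]; ring) hu
        (by rw [huz]; nlinarith [mul_pos hc0 hpm.2])
      have r2 := S.fin1 h z ((-l - c) / 2) (by rw [hvz, huz]; ring) hu
        (by rw [huz]; nlinarith [mul_pos hc0 hpm.1])
      unfold PP at r1 r2 ⊢
      have e1 : Dq v z = l * Dq u z := by
        have : c * (Dq v z - l * Dq u z) = 0 := by linear_combination r1 - r2
        have := (mul_eq_zero.1 this).resolve_left hc0.ne'
        linarith
      have e2 : Dq w z = (l ^ 2 + 2 * u z) * Dq u z := by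
        rw [e1] at r1
        rw [huz]
        linear_combination r1
      rw [e1, e2]; ring) z l hr hu
  by_contra hne
  have h2 := sq_pos_of_ne_zero hne
  have h3 := sq_pos_of_ne_zero hl
  nlinarith [mul_pos h3 (mul_pos (neg_pos.2 hPi) h2)]

lemma Sys.fin (S : Sys u v w) (h : ∀ z, v z ≠ 0 → 32 * u z ^ 3 + 27 * v z ^ 2 ≤ 0)
    (z : ℝ × ℝ) (hv : 0 < v z) : Stat u v w z := by
  obtain ⟨a, ha, hav⟩ := exists_root (u z) (v z) hv
  have hD := h z hv.ne'
  have hPi : 0 < 12 * a ^ 2 + 2 * u z := by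
    have : 0 < a * (8 * a ^ 2 + 4 * u z) := by nlinarith
    have := pos_of_mul_pos_right this ha.le
    nlinarith [sq_nonneg a]
  have hb : 2 * u z + 3 * a ^ 2 ≤ 0 := by
    rw [← hav, disc_id] at hD
    by_contra hc
    push Not at hc
    have := mul_pos (mul_pos (by norm_num : (0:ℝ) < 4) hc) (pow_pos hPi 2)
    linarith
  have ha2 := pow_pos ha 2
  have hu : u z ≤ 0 := by nlinarith
  have r1 := S.fin1 h z (-2 * a) (by rw [← hav]; ring) hu (by nlinarith)
  unfold PP at r1
  rcases hb.lt_or_eq with hb | hb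
  · set c := √(-(2 * u z + 3 * a ^ 2)) with hc
    have hc2 : c ^ 2 = -(2 * u z + 3 * a ^ 2) := Real.sq_sqrt (by linarith)
    have hc0 : 0 < c := Real.sqrt_pos.2 (by linarith)
    have huz : u z = (-c ^ 2 - 3 * a ^ 2) / 2 := by linarith
    have hca : c < a := by
      have : 0 < a * (a ^ 2 - c ^ 2) := by
        have : 2 * (a * (a ^ 2 - c ^ 2)) = v z := by rw [← hav, huz]; ring
        linarith
      have := pos_of_mul_pos_right this ha.le
      nlinarith
    have r2 := S.fin1 h z (a + c) (by rw [← hav, huz]; ring) hu (by rw [huz]; nlinarith)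
    have r3 := S.fin2 h z (a - c) (by rw [← hav, huz]; ring) (by linarith) (by rw [huz]; nlinarith)
    unfold PP at r2 r3
    have e1 : Dq v z = - 2 * a * Dq u z := by
      have : c * (Dq v z + 2 * a * Dq u z) = 0 := by linear_combination (r2 - r3) / 2
      have := (mul_eq_zero.1 this).resolve_left hc0.ne'
      linarith
    have e2 : Dq u z = 0 := by
      rw [e1] at r1 r2
      have : (9 * a ^ 2 - c ^ 2) * Dq u z = 0 := by linear_combination r1 - r2
      refine (mul_eq_zero.1 this).resolve_left ?_
      nlinarith
    rw [e2] at e1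
    rw [e1, e2] at r1
    exact ⟨e2, by linarith, by linarith⟩
  · have huz : u z = -3 * a ^ 2 / 2 := by linarith
    have hvz : v z = 2 * a ^ 3 := by rw [← hav, huz]; ring
    set D : ℝ × ℝ → ℝ := fun z => 32 * u z ^ 3 + 27 * v z ^ 2 with hDd
    have hD0 : D z = 0 := by simp only [hDd]; rw [← hav, disc_id, hb]; ring
    have hmax : IsLocalMax D z := by
      have : ∀ᶠ y in 𝓝 z, 0 < v y := S.sv.continuous.continuousAt.eventually (lt_mem_nhds hv)
      filter_upwards [this] with y hy
      rw [hD0]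
      exact h y hy.ne'
    have sD : Sm D := by
      have := S.su; have := S.sv
      unfold Sm at *
      fun_prop
    have hfd := hmax.fderiv_eq_zero
    have gen : ∀ x y : ℝ, 96 * u z ^ 2 * (x * Dq u z + y * Dt u z) + 54 * v z * (x * Dq v z + y * Dt v z) = 0 := by
      intro x y
      have h1 := sD.line z x y
      have h2 := (((S.su.line z x y).pow 3).const_mul 32).add (((S.sv.line z x y).pow 2).const_mul 27)
      have h3 := h1.unique h2
      rw [← fd_apply, hfd] at h3
      simp at h3
      linear_combination -h3
    have g1 := gen 1 0
    have g2 := gen 0 1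
    rw [S.e1, S.e2] at g2
    rw [hvz, huz] at g1 g2
    have ha3 : a ^ 3 ≠ 0 := by positivity
    have e1 : Dq v z = -2 * a * Dq u z := by
      have : a ^ 3 * (Dq v z + 2 * a * Dq u z) = 0 := by linear_combination g1 / 108
      have := (mul_eq_zero.1 this).resolve_left ha3
      linarith
    have e2 : Dq w z = a ^ 2 * Dq u z := by
      rw [e1] at g2
      have : a ^ 3 * (Dq w z - a ^ 2 * Dq u z) = 0 := by linear_combination -g2 / 108
      have := (mul_eq_zero.1 this).resolve_left ha3
      linarith
    have e3 : Dq u z = 0 := by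
      rw [e1, e2] at r1
      have : a ^ 2 * Dq u z = 0 := by linear_combination r1 / 9
      exact (mul_eq_zero.1 this).resolve_left ha2.ne'
    rw [e3] at e1 e2
    exact ⟨e3, by linarith, by linarith⟩

/-- time reversal -/
lemma rev_fd (f : ℝ × ℝ → ℝ) (hf : Sm f) :
    Sm (fun z => f (z.1, -z.2)) ∧ (∀ z, Dq (fun z => f (z.1, -z.2)) z = Dq f (z.1, -z.2)) ∧
    (∀ z, Dt (fun z => f (z.1, -z.2)) z = - Dt f (z.1, -z.2)) := by
  have hs : Sm (fun z => f (z.1, -z.2)) := ContDiff.comp hf (by fun_prop)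
  refine ⟨hs, fun z => ?_, fun z => ?_⟩
  · have h1 := hs.line z 1 0
    have h2 := hf.line (z.1, -z.2) 1 0
    simp only [zero_mul, add_zero] at h1 h2
    simpa using h1.unique h2
  · have h1 := hs.line z 0 1
    have h2 := hf.line (z.1, -z.2) 0 (-1)
    have e : (fun s : ℝ => f (z.1 + 0 * s, -(z.2 + 1 * s))) = (fun s : ℝ => f (z.1 + 0 * s, -z.2 + -1 * s)) := by
      funext s; congr 2; ring
    simp only [e] at h1
    simpa using h1.unique h2

lemma Per.rev {f : ℝ × ℝ → ℝ} (h : Per f) : Per (fun z => f (z.1, -z.2)) := by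
  intro q t
  refine ⟨(h q (-t)).1, ?_⟩
  have := (h q (-t - 1)).2
  simp only [sub_add_cancel] at this
  show f (q, -(t + 1)) = f (q, -t)
  rw [this]; congr 2; ring

lemma Sys.rev (S : Sys u v w) : Sys (fun z => u (z.1, -z.2)) (fun z => - v (z.1, -z.2)) (fun z => w (z.1, -z.2)) := by
  obtain ⟨u1, u2, u3⟩ := rev_fd u S.su
  obtain ⟨v1, v2, v3⟩ := rev_fd v S.sv
  obtain ⟨w1, w2, w3⟩ := rev_fd w S.sw
  have hneg : ∀ z, Dt (fun z => - v (z.1, -z.2)) z = - Dt (fun z => v (z.1, -z.2)) z := by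
    intro z
    unfold Dt
    rw [fderiv_fun_neg]; rfl
  refine ⟨u1, ContDiff.neg v1, w1, S.pu.rev, ?_, S.pw.rev, ?_, ?_, ?_⟩
  · intro q t
    have := S.pv.rev q t
    exact ⟨congrArg Neg.neg this.1, congrArg Neg.neg this.2⟩
  · intro z
    rw [u3, dq_neg, v2, S.e1]
  · intro z
    rw [hneg, v3, u2, w2, S.e2]; ring
  · intro z
    rw [w3, u2, S.e3]; ring

lemma Sys.stat_rev (S : Sys u v w) (z : ℝ × ℝ) 
    (h : Stat (fun z => u (z.1, -z.2)) (fun z => - v (z.1, -z.2)) (fun z => w (z.1, -z.2)) (z.1, -z.2)) :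
    Stat u v w z := by
  obtain ⟨h1, h2, h3⟩ := h
  rw [(rev_fd u S.su).2.1] at h1
  rw [dq_neg, (rev_fd v S.sv).2.1] at h2
  rw [(rev_fd w S.sw).2.1] at h3
  simp at h1 h2 h3
  exact ⟨h1, h2, h3⟩

end
end

section
open Filter Topology Set MeasureTheory

lemma line_diff {f : ℝ × ℝ → ℝ} {z : ℝ × ℝ} (h : DifferentiableAt ℝ f z) (a b : ℝ) :
    HasDerivAt (fun s : ℝ => f (z.1 + a * s, z.2 + b * s)) (a * Dq f z + b * Dt f z) 0 := by
  rw [← fd_apply]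
  have h1 : HasDerivAt (fun s : ℝ => ((z.1 + a * s, z.2 + b * s) : ℝ × ℝ)) (a, b) 0 := by
    have ha : HasDerivAt (fun s : ℝ => z.1 + a * s) a 0 := by
      simpa using ((hasDerivAt_id (0:ℝ)).const_mul a).const_add z.1
    have hb : HasDerivAt (fun s : ℝ => z.2 + b * s) b 0 := by
      simpa using ((hasDerivAt_id (0:ℝ)).const_mul b).const_add z.2
    exact ha.prodMk hb
  have h2 : HasFDerivAt f (fderiv ℝ f z) ((fun s : ℝ => ((z.1 + a * s, z.2 + b * s) : ℝ × ℝ)) 0) := by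
    simpa using h.hasFDerivAt
  exact h2.comp_hasDerivAt 0 h1

lemma hasDeriv_cube (s : ℝ) : HasDerivAt (fun s : ℝ => max s 0 ^ 3) (3 * max s 0 ^ 2) s := by
  rcases lt_trichotomy s 0 with h | rfl | h
  · rw [max_eq_right h.le]
    refine ((hasDerivAt_const s (0:ℝ)).congr_of_eventuallyEq ?_).congr_deriv (by simp)
    filter_upwards [gt_mem_nhds h] with x hx
    rw [max_eq_right (le_of_lt hx)]; simp
  · have : HasFDerivAt (fun s : ℝ => max s 0 ^ 3) (0 : ℝ →L[ℝ] ℝ) 0 := by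
      refine Asymptotics.IsBigO.hasFDerivAt (n := 3) ?_ (by norm_num)
      refine Asymptotics.IsBigO.of_bound 1 (Eventually.of_forall fun x => ?_)
      simp only [sub_zero, norm_pow, norm_norm, one_mul]
      gcongr
      simp only [Real.norm_eq_abs]
      rw [abs_of_nonneg (le_max_right _ _)]
      exact max_le (le_abs_self _) (abs_nonneg _)
    refine this.hasDerivAt.congr_deriv (by simp)
  · rw [max_eq_left h.le]
    have := (hasDerivAt_id s).pow 3
    refine (this.congr_of_eventuallyEq ?_).congr_deriv (by simp)
    filter_upwards [lt_mem_nhds h] with x hx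
    rw [max_eq_left (le_of_lt hx)]; simp

open Classical in
noncomputable def rho (x y : ℝ) : ℝ := if h : 0 < y then (exists_root x y h).choose else 0

lemma rho_pos {x y : ℝ} (h : 0 < y) : 0 < rho x y := by
  unfold rho; rw [dif_pos h]; exact (exists_root x y h).choose_spec.1
lemma rho_eq {x y : ℝ} (h : 0 < y) : 8 * rho x y ^ 3 + 4 * x * rho x y = y := by
  unfold rho; rw [dif_pos h]; exact (exists_root x y h).choose_spec.2
lemma rho_zero {x y : ℝ} (h : ¬ 0 < y) : rho x y = 0 := by
  unfold rho; rw [dif_neg h]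
lemma rho_nonneg (x y : ℝ) : 0 ≤ rho x y := by
  by_cases h : 0 < y
  · exact (rho_pos h).le
  · rw [rho_zero h]
lemma rho_uniq {x y a : ℝ} (h : 0 < y) (ha : 0 < a) (he : 8 * a ^ 3 + 4 * x * a = y) : rho x y = a := by
  have h1 := rho_pos (x := x) h
  have h2 := rho_eq (x := x) h
  set r := rho x y
  have h3 : (r - a) * (8 * (r ^ 2 + r * a + a ^ 2) + 4 * x) = 0 := by linear_combination h2 - he
  have h4 : 0 < 8 * a ^ 2 + 4 * x := by
    have : 0 < a * (8 * a ^ 2 + 4 * x) := by nlinarith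
    exact pos_of_mul_pos_right this ha.le
  have := (mul_eq_zero.1 h3).resolve_right (by nlinarith [mul_pos h1 ha, pow_pos h1 2])
  linarith

section
variable {u v w : ℝ × ℝ → ℝ}

lemma rho_Pi {x y : ℝ} (h : 0 < y) : 0 < 24 * rho x y ^ 2 + 4 * x := by
  have h1 := rho_pos (x := x) h
  have h2 := rho_eq (x := x) h
  have : 0 < rho x y * (8 * rho x y ^ 2 + 4 * x) := by nlinarith
  have := pos_of_mul_pos_right this h1.le
  nlinarith [pow_pos h1 2]

lemma rho_diff (hu : Sm u) (hv : Sm v) {z : ℝ × ℝ} (hz : 0 < v z) :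
    DifferentiableAt ℝ (fun z => rho (u z) (v z)) z := by
  set a := rho (u z) (v z) with ha
  set f : (ℝ × ℝ) × ℝ → ℝ := fun x => 8 * x.2 ^ 3 + 4 * u x.1 * x.2 - v x.1 with hf
  have cf : ContDiff ℝ (⊤ : ℕ∞) f := by
    unfold Sm at *
    fun_prop
  have sf := cf.contDiffAt.hasStrictFDerivAt (x := (z, a)) (by simp)
  have hf0 : f (z, a) = 0 := by
    simp only [hf]; have := rho_eq (x := u z) hz; rw [← ha] at this; linarith
  have hd : fderiv ℝ f (z, a) (0, 1) = 24 * a ^ 2 + 4 * u z := by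
    have h1 : HasDerivAt (fun s : ℝ => ((z, s) : (ℝ × ℝ) × ℝ)) (0, 1) a :=
      (hasDerivAt_const a z).prodMk (hasDerivAt_id a)
    have h2 := (sf.hasFDerivAt).comp_hasDerivAt a h1
    have h3 := ((((hasDerivAt_id a).pow 3).const_mul 8).add ((hasDerivAt_id a).const_mul (4 * u z))).sub_const (v z)
    refine h2.unique (h3.congr_deriv ?_)
    simp; ring
  have hinv : (fderiv ℝ f (z, a) ∘L .inr ℝ (ℝ × ℝ) ℝ).IsInvertible := by
    have hne : 24 * a ^ 2 + 4 * u z ≠ 0 := (rho_Pi hz).ne'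
    refine ⟨ContinuousLinearEquiv.unitsEquivAut ℝ (Units.mk0 _ hne), ?_⟩
    ext
    simp [hd]
  have h1 := (sf.hasStrictFDerivAt_implicitFunctionOfProdDomain hinv).hasFDerivAt.differentiableAt
  have h2 := sf.tendsto_implicitFunctionOfProdDomain hinv
  have h3 := sf.eventually_apply_implicitFunctionOfProdDomain hinv
  refine h1.congr_of_eventuallyEq ?_
  have h4 : ∀ᶠ y in 𝓝 z, 0 < v y := hv.continuous.continuousAt.eventually (lt_mem_nhds hz)
  have h5 := h2.eventually (lt_mem_nhds (rho_pos hz : 0 < a))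
  filter_upwards [h3, h4, h5] with y h3 h4 h5
  rw [hf0] at h3
  exact rho_uniq h4 h5 (by simp only [hf] at h3; linarith)

noncomputable def aa (u v : ℝ × ℝ → ℝ) (z : ℝ × ℝ) : ℝ := rho (u z) (v z)
noncomputable def be (u v : ℝ × ℝ → ℝ) (z : ℝ × ℝ) : ℝ := 2 * u z + 3 * aa u v z ^ 2
noncomputable def YY (u v : ℝ × ℝ → ℝ) (z : ℝ × ℝ) : ℝ := aa u v z ^ 2 * max (be u v z) 0 ^ 3
noncomputable def LL (u v p1 p2 p3 : ℝ × ℝ → ℝ) (z : ℝ × ℝ) : ℝ :=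
  (aa u v z ^ 2 - be u v z) * p1 z + aa u v z * p2 z + p3 z
noncomputable def GG (u v w : ℝ × ℝ → ℝ) (z : ℝ × ℝ) : ℝ :=
  aa u v z * max (be u v z) 0 ^ 2 *
    (LL u v (Dq u) (Dq v) (Dq w) z ^ 2 + be u v z * (2 * aa u v z * Dq u z + Dq v z) ^ 2)

/-- basic bounds -/
lemma basic_bd (z : ℝ × ℝ) (hb : 0 < be u v z) :
    aa u v z * be u v z ≤ max (v z) 0 ∧ aa u v z ≤ 1 + |v z| ∧ 0 ≤ aa u v z := by
  refine ⟨?_, ?_, rho_nonneg _ _⟩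
  · by_cases h : 0 < v z
    · have h1 := rho_eq (x := u z) h
      have h2 : 0 < aa u v z := rho_pos (x := u z) h
      rw [max_eq_left h.le]
      have : v z = 2 * aa u v z ^ 3 + 2 * (aa u v z * be u v z) := by
        rw [← h1]; unfold be aa; ring
      nlinarith [pow_pos h2 3, mul_pos h2 hb]
    · have : aa u v z = 0 := rho_zero h
      rw [this]; simp
  · by_cases h : 0 < v z
    · have h1 := rho_eq (x := u z) h
      have h2 : 0 < aa u v z := rho_pos (x := u z) h
      rw [abs_of_pos h]
      have : v z = 2 * aa u v z ^ 3 + 2 * (aa u v z * be u v z) := by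
        rw [← h1]; unfold be aa; ring
      by_contra hc
      push Not at hc
      have h3 : 1 < aa u v z := by linarith
      have h4 : aa u v z * 1 ≤ aa u v z * aa u v z ^ 2 := by gcongr; nlinarith
      nlinarith [mul_pos h2 hb]
    · have : aa u v z = 0 := rho_zero h
      rw [this]; positivity

lemma Sys.bd0 (S : Sys u v w) : ∃ B : ℝ, 0 ≤ B ∧ ∀ z, 0 < be u v z → aa u v z ≤ B ∧ be u v z ≤ B := by
  obtain ⟨M, hM⟩ := S.pu.bdd S.su.continuous
  obtain ⟨N, hN⟩ := S.pv.bdd S.sv.continuous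
  have hM0 := (abs_nonneg _).trans (hM 0)
  have hN0 := (abs_nonneg _).trans (hN 0)
  refine ⟨2 * M + 3 * (1 + N) ^ 2, by positivity, fun z hb => ?_⟩
  obtain ⟨h1, h2, h3⟩ := basic_bd z hb
  have h4 : aa u v z ≤ 1 + N := h2.trans (by linarith [hN z])
  have h5 : aa u v z ^ 2 ≤ (1 + N) ^ 2 := by gcongr
  have h6 := (abs_le.1 (hM z)).2
  constructor
  · nlinarith
  · unfold be; linarith

lemma Sys.bdL (S : Sys u v w) (p1 p2 p3 : ℝ × ℝ → ℝ) (h1 : Sm p1) (h2 : Sm p2) (h3 : Sm p3)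
    (q1 : Per p1) (q2 : Per p2) (q3 : Per p3) :
    ∃ C : ℝ, 0 ≤ C ∧ ∀ z, 0 < be u v z → |LL u v p1 p2 p3 z| ≤ C := by
  obtain ⟨B, hB0, hB⟩ := S.bd0
  obtain ⟨M1, hM1⟩ := q1.bdd h1.continuous
  obtain ⟨M2, hM2⟩ := q2.bdd h2.continuous
  obtain ⟨M3, hM3⟩ := q3.bdd h3.continuous
  have hM10 := (abs_nonneg _).trans (hM1 0)
  have hM20 := (abs_nonneg _).trans (hM2 0)
  have hM30 := (abs_nonneg _).trans (hM3 0)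
  refine ⟨(B ^ 2 + B) * M1 + B * M2 + M3, by positivity, fun z hb => ?_⟩
  obtain ⟨ha, hbe⟩ := hB z hb
  have ha0 : 0 ≤ aa u v z := rho_nonneg _ _
  unfold LL
  refine (abs_add_le _ _).trans (add_le_add ((abs_add_le _ _).trans (add_le_add ?_ ?_)) (hM3 z))
  · rw [abs_mul]
    have : |aa u v z ^ 2 - be u v z| ≤ B ^ 2 + B := by
      have : aa u v z ^ 2 ≤ B ^ 2 := by gcongr
      rw [abs_le]; constructor <;> nlinarith [sq_nonneg (aa u v z)]
    have := hM1 z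
    gcongr
  · rw [abs_mul, abs_of_nonneg ha0]
    have := hM2 z
    gcongr

lemma Sys.bdYL (S : Sys u v w) (p1 p2 p3 : ℝ × ℝ → ℝ) (h1 : Sm p1) (h2 : Sm p2) (h3 : Sm p3)
    (q1 : Per p1) (q2 : Per p2) (q3 : Per p3) :
    ∃ C : ℝ, 0 ≤ C ∧ ∀ z, |YY u v z * LL u v p1 p2 p3 z| ≤ C * max (v z) 0 ^ 2 := by
  obtain ⟨B, hB0, hB⟩ := S.bd0
  obtain ⟨C, hC0, hC⟩ := S.bdL p1 p2 p3 h1 h2 h3 q1 q2 q3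
  refine ⟨B * C, by positivity, fun z => ?_⟩
  by_cases hb : 0 < be u v z
  · obtain ⟨e1, e2, e3⟩ := basic_bd z hb
    have e4 := (hB z hb).2
    have e5 := hC z hb
    have : YY u v z = (aa u v z * be u v z) ^ 2 * be u v z := by
      unfold YY; rw [max_eq_left hb.le]; ring
    rw [abs_mul, this, abs_of_nonneg (by positivity)]
    calc _ ≤ max (v z) 0 ^ 2 * B * C := by gcongr
      _ = _ := by ring
  · have : YY u v z = 0 := by unfold YY; rw [max_eq_right (not_lt.1 hb)]; simp
    rw [this]; simp; positivity

lemma Sys.bdG (S : Sys u v w) : ∃ C : ℝ, 0 ≤ C ∧ ∀ z, |GG u v w z| ≤ C * max (v z) 0 := by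
  obtain ⟨B, hB0, hB⟩ := S.bd0
  obtain ⟨C, hC0, hC⟩ := S.bdL _ _ _ S.su.dq S.sv.dq S.sw.dq S.pu.dq S.pv.dq S.pw.dq
  obtain ⟨M1, hM1⟩ := S.pu.dq.bdd S.su.dq.continuous
  obtain ⟨M2, hM2⟩ := S.pv.dq.bdd S.sv.dq.continuous
  have hM10 := (abs_nonneg _).trans (hM1 0)
  have hM20 := (abs_nonneg _).trans (hM2 0)
  refine ⟨B * (C ^ 2 + B * (2 * B * M1 + M2) ^ 2), by positivity, fun z => ?_⟩
  by_cases hb : 0 < be u v z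
  · obtain ⟨e1, e2, e3⟩ := basic_bd z hb
    obtain ⟨e6, e4⟩ := (hB z hb)
    have e5 := hC z hb
    unfold GG
    rw [max_eq_left hb.le, abs_of_nonneg (by positivity)]
    have f1 : LL u v (Dq u) (Dq v) (Dq w) z ^ 2 ≤ C ^ 2 := by
      rw [← sq_abs]; gcongr
    have f2 : (2 * aa u v z * Dq u z + Dq v z) ^ 2 ≤ (2 * B * M1 + M2) ^ 2 := by
      rw [← sq_abs]
      have := hM1 z
      have : |2 * aa u v z * Dq u z + Dq v z| ≤ 2 * B * M1 + M2 := by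
        refine (abs_add_le _ _).trans (add_le_add ?_ (hM2 z))
        rw [abs_mul, abs_of_nonneg (by positivity : 0 ≤ 2 * aa u v z)]
        gcongr
      gcongr
    calc _ = (aa u v z * be u v z) * be u v z * (LL u v (Dq u) (Dq v) (Dq w) z ^ 2 + be u v z * (2 * aa u v z * Dq u z + Dq v z) ^ 2) := by ring
      _ ≤ max (v z) 0 * B * (C ^ 2 + B * (2 * B * M1 + M2) ^ 2) := by gcongr
      _ = _ := by ring
  · have : GG u v w z = 0 := by unfold GG; rw [max_eq_right (not_lt.1 hb)]; simp
    rw [this]; simp; positivity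

lemma fd_zero_of_bd (hv : Sm v) {h : ℝ × ℝ → ℝ} {C : ℝ} (hC : ∀ z, |h z| ≤ C * max (v z) 0 ^ 2)
    {z : ℝ × ℝ} (hz : v z ≤ 0) : HasFDerivAt h (0 : ℝ × ℝ →L[ℝ] ℝ) z := by
  refine Asymptotics.IsBigO.hasFDerivAt (n := 2) ?_ (by norm_num)
  have h1 : h =O[𝓝 z] fun x => max (v x) 0 ^ 2 := by
    refine Asymptotics.IsBigO.of_bound C (Eventually.of_forall fun x => ?_)
    simpa [abs_of_nonneg (sq_nonneg (max (v x) 0))] using hC x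
  refine h1.trans ?_
  have h2 : (fun x => max (v x) 0) =O[𝓝 z] fun x => v x - v z := by
    refine Asymptotics.IsBigO.of_bound 1 (Eventually.of_forall fun x => ?_)
    rw [one_mul, Real.norm_eq_abs, abs_of_nonneg (le_max_right _ _)]
    exact max_le (by rw [Real.norm_eq_abs]; exact le_trans (by linarith) (le_abs_self _)) (norm_nonneg _)
  have h3 := h2.trans (hv.diff z).hasFDerivAt.isBigO_sub
  exact (h3.norm_right).pow 2

lemma aa_line (hu : Sm u) (hv : Sm v) {z : ℝ × ℝ} (hz : 0 < v z) (x y : ℝ) :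
    (24 * aa u v z ^ 2 + 4 * u z) * (x * Dq (aa u v) z + y * Dt (aa u v) z) + 4 * aa u v z * (x * Dq u z + y * Dt u z)
      = x * Dq v z + y * Dt v z := by
  have hd : DifferentiableAt ℝ (aa u v) z := rho_diff hu hv hz
  have h1 := (((line_diff hd x y).pow 3).const_mul 8).add (((hu.line z x y).const_mul 4).mul (line_diff hd x y))
  have h2 := hv.line z x y
  have hc : ContinuousAt (fun s : ℝ => v (z.1 + x * s, z.2 + y * s)) 0 := h2.continuousAt
  have hev : ∀ᶠ s in 𝓝 (0:ℝ), 0 < v (z.1 + x * s, z.2 + y * s) :=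
    hc.eventually (lt_mem_nhds (by simpa using hz))
  have h3 := h2.congr_of_eventuallyEq (f₁ := _) (hev.mono fun s hs => rho_eq (x := u (z.1 + x * s, z.2 + y * s)) hs)
  have h4 := h3.unique h1
  simp at h4
  rw [h4]; ring

lemma YY_line (hu : Sm u) (hv : Sm v) {z : ℝ × ℝ} (hz : 0 < v z) (x y : ℝ) :
    HasDerivAt (fun s : ℝ => YY u v (z.1 + x * s, z.2 + y * s))
     (aa u v z * max (be u v z) 0 ^ 2 * (2 * aa u v z * (x * Dq u z + y * Dt u z) + (x * Dq v z + y * Dt v z))) 0 := by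
  have hd : DifferentiableAt ℝ (aa u v) z := rho_diff hu hv hz
  have ha := line_diff hd x y
  have hb : HasDerivAt (fun s : ℝ => be u v (z.1 + x * s, z.2 + y * s)) _ 0 :=
    ((hu.line z x y).const_mul 2).add ((ha.pow 2).const_mul 3)
  have hb3 := (hasDeriv_cube (be u v (z.1 + x * 0, z.2 + y * 0))).comp (0:ℝ) hb
  have h1 := (ha.pow 2).mul hb3
  refine h1.congr_deriv ?_
  have hl := aa_line hu hv hz x y
  simp
  rcases le_or_gt (be u v z) 0 with h | h
  · rw [max_eq_right h]; simp
  · rw [max_eq_left h.le, ← hl]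
    unfold be
    ring

lemma YY_diff (hu : Sm u) (hv : Sm v) {z : ℝ × ℝ} (hz : 0 < v z) : DifferentiableAt ℝ (YY u v) z := by
  have hd : DifferentiableAt ℝ (aa u v) z := rho_diff hu hv hz
  have hb : DifferentiableAt ℝ (be u v) z := by
    unfold be; have := hu.diff z; fun_prop
  have := (hasDeriv_cube (be u v z)).differentiableAt.comp z hb
  exact (hd.pow 2).mul this

lemma LL_diff (hu : Sm u) (hv : Sm v) {p1 p2 p3 : ℝ × ℝ → ℝ} (h1 : Sm p1) (h2 : Sm p2) (h3 : Sm p3)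
    {z : ℝ × ℝ} (hz : 0 < v z) : DifferentiableAt ℝ (LL u v p1 p2 p3) z := by
  have hd : DifferentiableAt ℝ (aa u v) z := rho_diff hu hv hz
  have := hu.diff z
  have := h1.diff z
  have := h2.diff z
  have := h3.diff z
  unfold LL be
  fun_prop

lemma LL_line (hu : Sm u) (hv : Sm v) {p1 p2 p3 : ℝ × ℝ → ℝ} (h1 : Sm p1) (h2 : Sm p2) (h3 : Sm p3)
    {z : ℝ × ℝ} (hz : 0 < v z) (x y : ℝ) : 
    HasDerivAt (fun s : ℝ => LL u v p1 p2 p3 (z.1 + x * s, z.2 + y * s))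
     ((-4 * aa u v z * (x * Dq (aa u v) z + y * Dt (aa u v) z) - 2 * (x * Dq u z + y * Dt u z)) * p1 z
      + (aa u v z ^ 2 - be u v z) * (x * Dq p1 z + y * Dt p1 z)
      + (x * Dq (aa u v) z + y * Dt (aa u v) z) * p2 z + aa u v z * (x * Dq p2 z + y * Dt p2 z)
      + (x * Dq p3 z + y * Dt p3 z)) 0 := by
  have hd : DifferentiableAt ℝ (aa u v) z := rho_diff hu hv hz
  have ha := line_diff hd x y
  have hb : HasDerivAt (fun s : ℝ => be u v (z.1 + x * s, z.2 + y * s)) _ 0 :=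
    ((hu.line z x y).const_mul 2).add ((ha.pow 2).const_mul 3)
  have h := ((((ha.pow 2).sub hb).mul (h1.line z x y)).add (ha.mul (h2.line z x y))).add (h3.line z x y)
  refine h.congr_deriv ?_
  simp
  ring

lemma YL_diff (S : Sys u v w) (p1 p2 p3 : ℝ × ℝ → ℝ) (h1 : Sm p1) (h2 : Sm p2) (h3 : Sm p3)
    (q1 : Per p1) (q2 : Per p2) (q3 : Per p3) (z) :
    DifferentiableAt ℝ (fun z => YY u v z * LL u v p1 p2 p3 z) z ∧
     (v z ≤ 0 → fderiv ℝ (fun z => YY u v z * LL u v p1 p2 p3 z) z = 0) := by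
  obtain ⟨C, hC0, hC⟩ := S.bdYL p1 p2 p3 h1 h2 h3 q1 q2 q3
  by_cases hz : 0 < v z
  · exact ⟨(YY_diff S.su S.sv hz).mul (LL_diff S.su S.sv h1 h2 h3 hz), fun h => absurd hz (not_lt.2 h)⟩
  · have := fd_zero_of_bd S.sv hC (not_lt.1 hz)
    exact ⟨this.differentiableAt, fun _ => this.fderiv⟩

lemma Sys.div (S : Sys u v w) (z : ℝ × ℝ) :
    Dq (fun z => YY u v z * LL u v (Dt u) (Dt v) (Dt w) z) z
     - Dt (fun z => YY u v z * LL u v (Dq u) (Dq v) (Dq w) z) z = GG u v w z := by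
  have d1 := YL_diff S _ _ _ S.su.dt S.sv.dt S.sw.dt S.pu.dt S.pv.dt S.pw.dt z
  have d2 := YL_diff S _ _ _ S.su.dq S.sv.dq S.sw.dq S.pu.dq S.pv.dq S.pw.dq z
  by_cases hz : 0 < v z
  · have e1 := (line_diff d1.1 1 0).unique
      ((YY_line S.su S.sv hz 1 0).mul (LL_line S.su S.sv S.su.dt S.sv.dt S.sw.dt hz 1 0))
    have e2 := (line_diff d2.1 0 1).unique
      ((YY_line S.su S.sv hz 0 1).mul (LL_line S.su S.sv S.su.dq S.sv.dq S.sw.dq hz 0 1))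
    simp only [one_mul, zero_mul, add_zero, zero_add, mul_zero] at e1 e2
    rw [e1, e2]
    have l1 := aa_line S.su S.sv hz 1 0
    have l2 := aa_line S.su S.sv hz 0 1
    simp only [one_mul, zero_mul, add_zero, zero_add] at l1 l2
    rw [S.su.comm, S.sv.comm, S.sw.comm]
    have key : (-4 * aa u v z * Dq (aa u v) z - 2 * Dq u z) * Dt u z + Dq (aa u v) z * Dt v z
       = (-4 * aa u v z * Dt (aa u v) z - 2 * Dt u z) * Dq u z + Dt (aa u v) z * Dq v z := by
      linear_combination -(Dq (aa u v) z) * l2 + Dt (aa u v) z * l1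
    have hrho : v z = 8 * aa u v z ^ 3 + 4 * u z * aa u v z := (rho_eq hz).symm
    have mid : aa u v z * max (be u v z) 0 ^ 2 *
       ((2 * aa u v z * Dq u z + Dq v z) * LL u v (Dt u) (Dt v) (Dt w) z
        - (2 * aa u v z * Dt u z + Dt v z) * LL u v (Dq u) (Dq v) (Dq w) z) = GG u v w z := by
      unfold GG
      congr 1
      unfold LL be
      rw [S.e1, S.e2, S.e3, hrho]
      ring
    rw [← mid]
    linear_combination (YY u v z) * key
  · have hz' := not_lt.1 hz
    have ha : aa u v z = 0 := rho_zero hz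
    unfold Dq Dt at *
    rw [d1.2 hz', d2.2 hz']
    simp [GG, ha]

lemma GG_nonneg (z) : 0 ≤ GG u v w z := by
  have ha : 0 ≤ aa u v z := rho_nonneg _ _
  unfold GG
  rcases le_or_gt (be u v z) 0 with h | h
  · rw [max_eq_right h]; simp
  · positivity

lemma Sys.GG_cont (S : Sys u v w) : Continuous (GG u v w) := by
  rw [continuous_iff_continuousAt]
  intro z
  by_cases hz : 0 < v z
  · have hd : ContinuousAt (aa u v) z := (rho_diff S.su S.sv hz).continuousAt
    have := S.su.continuous.continuousAt (x := z)
    have := S.su.dq.continuous.continuousAt (x := z)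
    have := S.sv.dq.continuous.continuousAt (x := z)
    have := S.sw.dq.continuous.continuousAt (x := z)
    unfold GG LL be
    fun_prop
  · obtain ⟨C, hC0, hC⟩ := S.bdG
    have h0 : GG u v w z = 0 := by
      have ha : aa u v z = 0 := rho_zero hz
      simp [GG, ha]
    rw [ContinuousAt, h0]
    refine squeeze_zero_norm hC ?_
    have hc := S.sv.continuous
    have : Continuous (fun z => C * max (v z) 0) := by fun_prop
    have := this.tendsto z
    rwa [max_eq_right (not_lt.1 hz), mul_zero] at this

lemma Sys.GG_zero (S : Sys u v w) (z : ℝ × ℝ) : GG u v w z = 0 := by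
  set A : ℝ × ℝ → ℝ := fun z => - (YY u v z * LL u v (Dq u) (Dq v) (Dq w) z) with hA
  set B : ℝ × ℝ → ℝ := fun z => YY u v z * LL u v (Dt u) (Dt v) (Dt w) z with hB
  have d1 := fun z => (YL_diff S _ _ _ S.su.dt S.sv.dt S.sw.dt S.pu.dt S.pv.dt S.pw.dt z).1
  have d2 := fun z => (YL_diff S _ _ _ S.su.dq S.sv.dq S.sw.dq S.pu.dq S.pv.dq S.pw.dq z).1.neg
  have hdiv : ∀ z, fderiv ℝ B z (1, 0) + fderiv ℝ A z (0, 1) = GG u v w z := by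
    intro z
    rw [← S.div z, hA, fderiv_fun_neg]
    rfl
  have hpB : ∀ q t, B (q + 1, t) = B (q, t) := by
    intro q t
    simp only [hB, YY, LL, be, aa]
    rw [(S.pu q t).1, (S.pv q t).1, (S.pu.dt q t).1, (S.pv.dt q t).1, (S.pw.dt q t).1]
  have hpA : ∀ q t, A (q, t + 1) = A (q, t) := by
    intro q t
    simp only [hA, YY, LL, be, aa]
    rw [(S.pu q t).2, (S.pv q t).2, (S.pu.dq q t).2, (S.pv.dq q t).2, (S.pw.dq q t).2]
  obtain ⟨q, t⟩ := z
  set lo : ℝ × ℝ := (q - 1/2, t - 1/2) with hlo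
  set hi : ℝ × ℝ := (q - 1/2 + 1, t - 1/2 + 1) with hhi
  have hle : lo ≤ hi := ⟨by simp [hlo, hhi], by simp [hlo, hhi]⟩
  have hint : IntegrableOn (GG u v w) (Icc lo hi) :=
    S.GG_cont.continuousOn.integrableOn_compact isCompact_Icc
  have cB : Continuous B := continuous_iff_continuousAt.2 fun z => (d1 z).continuousAt
  have cA : Continuous A := continuous_iff_continuousAt.2 fun z => (d2 z).continuousAt
  have hI := integral_divergence_prod_Icc_of_hasFDerivAt_of_le B A (fderiv ℝ B) (fderiv ℝ A) lo hi hle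
    cB.continuousOn cA.continuousOn (fun x _ => (d1 x).hasFDerivAt) (fun x _ => (d2 x).hasFDerivAt)
    (by simpa only [hdiv] using hint)
  simp only [hdiv] at hI
  have h0 : ∫ x in Icc lo hi, GG u v w x = 0 := by
    rw [hI]
    simp only [hlo, hhi, hpA, hpB]
    ring
  rw [setIntegral_eq_zero_iff_of_nonneg_ae (Eventually.of_forall fun x => GG_nonneg x) hint] at h0
  have hsub : Ioo (q - 1/2) (q - 1/2 + 1) ×ˢ Ioo (t - 1/2) (t - 1/2 + 1) ⊆ Icc lo hi := by
    rintro ⟨x, y⟩ ⟨hx, hy⟩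
    exact ⟨⟨hx.1.le, hy.1.le⟩, ⟨hx.2.le, hy.2.le⟩⟩
  have h1 := ae_restrict_of_ae_restrict_of_subset hsub h0
  have h2 := Measure.eqOn_open_of_ae_eq h1 (isOpen_Ioo.prod isOpen_Ioo) S.GG_cont.continuousOn continuousOn_const
  exact h2 (show ((q, t) : ℝ × ℝ) ∈ _ from ⟨⟨by linarith, by linarith⟩, ⟨by linarith, by linarith⟩⟩)

lemma Sys.deg (S : Sys u v w) (z : ℝ × ℝ) (hz : 0 < v z) (hb : 0 < be u v z) :
    LL u v (Dq u) (Dq v) (Dq w) z = 0 ∧ 2 * aa u v z * Dq u z + Dq v z = 0 := by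
  have h := S.GG_zero z
  have ha : 0 < aa u v z := rho_pos hz
  unfold GG at h
  rw [max_eq_left hb.le] at h
  have h1 := (mul_eq_zero.1 h).resolve_left (by positivity)
  have h2 := sq_nonneg (LL u v (Dq u) (Dq v) (Dq w) z)
  have h3 : 0 ≤ be u v z * (2 * aa u v z * Dq u z + Dq v z) ^ 2 := by positivity
  constructor
  · exact pow_eq_zero_iff (n := 2) (by norm_num) |>.1 (by linarith)
  · have : be u v z * (2 * aa u v z * Dq u z + Dq v z) ^ 2 = 0 := by linarith
    exact pow_eq_zero_iff (n := 2) (by norm_num) |>.1 ((mul_eq_zero.1 this).resolve_left hb.ne')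

lemma Per.const (c : ℝ) : Per (fun _ => c) := fun _ _ => ⟨rfl, rfl⟩

lemma Sys.YY_const (S : Sys u v w) (z z' : ℝ × ℝ) : YY u v z = YY u v z' := by
  have hY : (fun z => YY u v z * LL u v (fun _ => 0) (fun _ => 0) (fun _ => 1) z) = YY u v := by
    funext z; simp [LL]
  have hd := YL_diff S (fun _ => 0) (fun _ => 0) (fun _ => 1) contDiff_const contDiff_const contDiff_const
    (Per.const 0) (Per.const 0) (Per.const 1)
  rw [hY] at hd
  refine is_const_of_fderiv_eq_zero (𝕜 := ℝ) (fun z => (hd z).1) (fun z => ?_) z z'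
  by_cases hz : 0 < v z
  · ext1 <;> ext <;> simp only [ContinuousLinearMap.comp_apply, ContinuousLinearMap.inl_apply, ContinuousLinearMap.inr_apply, ContinuousLinearMap.zero_apply]
    all_goals
      rw [fd_apply, (line_diff (hd z).1 _ _).unique (YY_line S.su S.sv hz _ _)]
      rcases le_or_gt (be u v z) 0 with h | h
      · rw [max_eq_right h]; simp
      · obtain ⟨h1, h2⟩ := S.deg z hz h
        unfold LL be at h1
        rw [S.e1, S.e2]
        first
        | linear_combination (aa u v z * max (be u v z) 0 ^ 2) * h2
        | linear_combination (aa u v z * max (be u v z) 0 ^ 2) * (-h1 - aa u v z * h2)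
  · exact (hd z).2 (not_lt.1 hz)

lemma Sys.ell (S : Sys u v w) :
    (∀ z, 0 < v z → 32 * u z ^ 3 + 27 * v z ^ 2 ≤ 0) ∨ ∀ z, Stat u v w z := by
  by_cases h : ∃ z0, YY u v z0 ≠ 0
  · right
    obtain ⟨z0, h0⟩ := h
    have hne : ∀ z, YY u v z ≠ 0 := fun z => by rw [S.YY_const z z0]; exact h0
    have hv : ∀ z, 0 < v z := by
      intro z
      by_contra hz
      have ha : aa u v z = 0 := rho_zero hz
      exact hne z (by simp [YY, ha])
    have hb : ∀ z, 0 < be u v z := by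
      intro z
      by_contra hz
      exact hne z (by simp [YY, max_eq_right (not_lt.1 hz)])
    have hm := S.maxp 0 1 one_ne_zero (fun _ => True) isClosed_univ (by
      intro z l hr _ _
      refine ⟨?_, by simp, Or.inl rfl⟩
      rintro rfl
      have := hv z
      simp at hr
      linarith)
    intro z
    have ha : 0 < aa u v z := rho_pos (hv z)
    have hrho : 8 * aa u v z ^ 3 + 4 * u z * aa u v z = v z := rho_eq (hv z)
    have h1 := hm z (-2 * aa u v z) (by rw [← hrho]; ring) trivial
    have hbz := hb z
    have hbe : be u v z = 2 * u z + 3 * aa u v z ^ 2 := rfl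
    have hPi : 0 < 3 * (-2 * aa u v z) ^ 2 + 2 * u z := by nlinarith [pow_pos ha 2]
    have hP : PP u v w z (-2 * aa u v z) = 0 := by
      by_contra hne
      have h2 := sq_pos_of_ne_zero hne
      simp only [pow_zero, one_mul] at h1
      nlinarith [mul_pos hPi h2]
    obtain ⟨k1, k2⟩ := S.deg z (hv z) hbz
    unfold LL at k1
    unfold PP at hP
    have e1 : Dq u z = 0 := by
      have : (9 * aa u v z ^ 2 + be u v z) * Dq u z = 0 := by
        linear_combination hP - k1 + 3 * aa u v z * k2
      exact (mul_eq_zero.1 this).resolve_left (by positivity)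
    rw [e1] at k1 k2 hP
    have e2 : Dq v z = 0 := by linarith
    rw [e2] at hP
    exact ⟨e1, e2, by linarith⟩
  · left
    push Not at h
    intro z hz
    have ha : 0 < aa u v z := rho_pos hz
    have hrho : 8 * aa u v z ^ 3 + 4 * u z * aa u v z = v z := rho_eq hz
    have hb : be u v z ≤ 0 := by
      by_contra hb
      push Not at hb
      have := h z
      unfold YY at this
      rw [max_eq_left hb.le] at this
      have : 0 < aa u v z ^ 2 * be u v z ^ 3 := by positivity
      linarith
    rw [← hrho, disc_id]
    have : 2 * u z + 3 * aa u v z ^ 2 ≤ 0 := hb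
    nlinarith [mul_nonneg (neg_nonneg.2 this) (sq_nonneg (12 * aa u v z ^ 2 + 2 * u z))]

lemma Sys.final (S : Sys u v w) : (∀ z, v z = 0) ∨ ∀ z, Stat u v w z := by
  rcases S.ell with h1 | h1
  swap
  · exact Or.inr h1
  rcases S.rev.ell with h2 | h2
  swap
  · exact Or.inr fun z => S.stat_rev z (h2 _)
  have h : ∀ z, v z ≠ 0 → 32 * u z ^ 3 + 27 * v z ^ 2 ≤ 0 := by
    intro z hz
    rcases lt_or_gt_of_ne hz with hz | hz
    · have := h2 (z.1, -z.2)
      simp at this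
      exact this hz
    · exact h1 z hz
  have h' : ∀ z : ℝ × ℝ, - v (z.1, -z.2) ≠ 0 → 32 * u (z.1, -z.2) ^ 3 + 27 * (- v (z.1, -z.2)) ^ 2 ≤ 0 := by
    intro z hz
    have := h (z.1, -z.2) (by simpa using hz)
    simpa using this
  have hst : ∀ z, v z ≠ 0 → Stat u v w z := by
    intro z hz
    rcases lt_or_gt_of_ne hz with hz | hz
    · exact S.stat_rev z (S.rev.fin h' _ (by simpa using hz))
    · exact S.fin h z hz
  have hconst : ∀ z z', v z ^ 2 = v z' ^ 2 := by
    intro z z'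
    refine is_const_of_fderiv_eq_zero (𝕜 := ℝ) (f := fun z => v z ^ 2) (fun z => (S.sv.diff z).pow 2) (fun z => ?_) z z'
    have := ((S.sv.diff z).hasFDerivAt.pow 2).fderiv
    rw [this]
    by_cases hz : v z = 0
    · simp [hz]
    · obtain ⟨a1, a2, a3⟩ := hst z hz
      have : fderiv ℝ v z = 0 := by
        have hfd : ∀ a b, fderiv ℝ v z (a, b) = 0 := by
          intro a b
          rw [fd_apply, S.e2, a1, a2, a3]; simp
        ext1 <;> ext <;> simp [hfd]
      rw [this]; simp
  by_cases hv : ∀ z, v z = 0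
  · exact Or.inl hv
  · right
    push Not at hv
    obtain ⟨z0, h0⟩ := hv
    intro z
    refine hst z fun hz => h0 ?_
    have := hconst z0 z
    rw [hz] at this
    simpa using this

end
end


lemma Sm.hdq {f : ℝ × ℝ → ℝ} (h : Sm f) (q t : ℝ) :
    HasDerivAt (fun x => f (x, t)) (Dq f (q, t)) q := by
  have h1 : HasDerivAt (fun x : ℝ => ((x, t) : ℝ × ℝ)) (1, 0) q :=
    (hasDerivAt_id q).prodMk (hasDerivAt_const q t)
  exact (h.diff (q, t)).hasFDerivAt.comp_hasDerivAt q h1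

lemma Sm.hdt {f : ℝ × ℝ → ℝ} (h : Sm f) (q t : ℝ) :
    HasDerivAt (fun s => f (q, s)) (Dt f (q, t)) t := by
  have h1 : HasDerivAt (fun s : ℝ => ((q, s) : ℝ × ℝ)) (0, 1) t :=
    (hasDerivAt_const t q).prodMk (hasDerivAt_id t)
  exact (h.diff (q, t)).hasFDerivAt.comp_hasDerivAt t h1

lemma Sm.const_of {f : ℝ × ℝ → ℝ} (h : Sm f) (h1 : ∀ z, Dq f z = 0) (h2 : ∀ z, Dt f z = 0) :
    ∀ z z', f z = f z' := by
  refine is_const_of_fderiv_eq_zero (𝕜 := ℝ) h.diff fun z => ?_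
  have hfd : ∀ a b, fderiv ℝ f z (a, b) = 0 := by
    intro a b
    rw [fd_apply, h1, h2]; simp
  ext1 <;> ext <;> simp [hfd]

end QI


/-- A quartic polynomial first integral of `H = p²/2 + u₁` with
periodic coefficients is either built from constant coefficients, or is (up to
an additive constant) the square of the quadratic energy integral. -/
theorem quartic_integral_is_square_of_energy
    (u₁ u₂ u₃ : ℝ → ℝ → ℝ) (F : ℝ → ℝ → ℝ → ℝ)
    (hu₁ : ContDiff ℝ (⊤ : ℕ∞) (fun z : ℝ × ℝ => u₁ z.1 z.2))
    (hu₂ : ContDiff ℝ (⊤ : ℕ∞) (fun z : ℝ × ℝ => u₂ z.1 z.2))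
    (hu₃ : ContDiff ℝ (⊤ : ℕ∞) (fun z : ℝ × ℝ => u₃ z.1 z.2))
    (hq₁ : ∀ t, Function.Periodic (fun q => u₁ q t) 1)
    (hq₂ : ∀ t, Function.Periodic (fun q => u₂ q t) 1)
    (hq₃ : ∀ t, Function.Periodic (fun q => u₃ q t) 1)
    (ht₁ : ∀ q, Function.Periodic (fun t => u₁ q t) 1)
    (ht₂ : ∀ q, Function.Periodic (fun t => u₂ q t) 1)
    (ht₃ : ∀ q, Function.Periodic (fun t => u₃ q t) 1)
    (hF : ∀ p q t, F p q t = p ^ 4 / 4 + u₁ q t * p ^ 2 + u₂ q t * p + u₃ q t)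
    (hcons : ∀ p q t,
      deriv (fun s => F p q s) t + p * deriv (fun x => F p x t) q
        - deriv (fun x => u₁ x t) q * deriv (fun y => F y q t) p = 0) :
    (∃ c₁ c₂ c₃ : ℝ, ∀ q t, u₁ q t = c₁ ∧ u₂ q t = c₂ ∧ u₃ q t = c₃) ∨
    (∃ c : ℝ, (∀ q t, u₂ q t = 0) ∧ (∀ q t, deriv (fun s => u₁ q s) t = 0) ∧
      (∀ q t, u₃ q t = u₁ q t ^ 2 + c) ∧
      (∀ p q t, F p q t = (p ^ 2 / 2 + u₁ q t) ^ 2 + c)) := by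
  let u : ℝ × ℝ → ℝ := fun z => u₁ z.1 z.2
  let v : ℝ × ℝ → ℝ := fun z => u₂ z.1 z.2
  let w : ℝ × ℝ → ℝ := fun z => u₃ z.1 z.2
  have su : QI.Sm u := hu₁
  have sv : QI.Sm v := hu₂
  have sw : QI.Sm w := hu₃
  have key : ∀ p q t, p ^ 2 * (QI.Dt u (q, t) + QI.Dq v (q, t))
      + p * (QI.Dt v (q, t) + QI.Dq w (q, t) - 2 * u (q, t) * QI.Dq u (q, t))
      + (QI.Dt w (q, t) - v (q, t) * QI.Dq u (q, t)) = 0 := by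
    intro p q t
    have hc := hcons p q t
    have d1 : HasDerivAt (fun s => F p q s)
        (QI.Dt u (q, t) * p ^ 2 + QI.Dt v (q, t) * p + QI.Dt w (q, t)) t := by
      have : (fun s => F p q s)
          = fun s => p ^ 4 / 4 + u (q, s) * p ^ 2 + v (q, s) * p + w (q, s) := by
        funext s; exact hF p q s
      rw [this]
      exact ((((su.hdt q t).mul_const (p ^ 2)).const_add (p ^ 4 / 4)).add
        ((sv.hdt q t).mul_const p)).add (sw.hdt q t)
    have d2 : HasDerivAt (fun x => F p x t)
        (QI.Dq u (q, t) * p ^ 2 + QI.Dq v (q, t) * p + QI.Dq w (q, t)) q := by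
      have : (fun x => F p x t)
          = fun x => p ^ 4 / 4 + u (x, t) * p ^ 2 + v (x, t) * p + w (x, t) := by
        funext x; exact hF p x t
      rw [this]
      exact ((((su.hdq q t).mul_const (p ^ 2)).const_add (p ^ 4 / 4)).add
        ((sv.hdq q t).mul_const p)).add (sw.hdq q t)
    have d3 : HasDerivAt (fun y => F y q t)
        (p ^ 3 + 2 * u (q, t) * p + v (q, t)) p := by
      have : (fun y => F y q t)
          = fun y => y ^ 4 / 4 + u (q, t) * y ^ 2 + v (q, t) * y + w (q, t) := by
        funext y; exact hF y q t
      rw [this]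
      have hh := (((((hasDerivAt_pow 4 p).div_const 4).add
        ((hasDerivAt_pow 2 p).const_mul (u (q, t)))).add
        ((hasDerivAt_id p).const_mul (v (q, t)))).add_const (w (q, t)))
      refine hh.congr_deriv ?_
      norm_num
      ring
    have d4 : deriv (fun x => u₁ x t) q = QI.Dq u (q, t) := (su.hdq q t).deriv
    rw [d1.deriv, d2.deriv, d3.deriv, d4] at hc
    linear_combination hc
  have S : QI.Sys u v w :=
    { su := su, sv := sv, sw := sw
      pu := fun q t => ⟨hq₁ t q, ht₁ q t⟩
      pv := fun q t => ⟨hq₂ t q, ht₂ q t⟩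
      pw := fun q t => ⟨hq₃ t q, ht₃ q t⟩
      e1 := fun z => by
        have h0 := key 0 z.1 z.2
        have h1 := key 1 z.1 z.2
        have h2 := key (-1) z.1 z.2
        simp only [Prod.mk.eta] at h0 h1 h2
        linarith
      e2 := fun z => by
        have h0 := key 0 z.1 z.2
        have h1 := key 1 z.1 z.2
        have h2 := key (-1) z.1 z.2
        simp only [Prod.mk.eta] at h0 h1 h2
        linarith
      e3 := fun z => by
        have h0 := key 0 z.1 z.2
        simp only [Prod.mk.eta] at h0
        linarith }
  rcases S.final with hv | hst
  · right
    have hv0 : v = fun _ => 0 := funext hv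
    have vq : ∀ z, QI.Dq v z = 0 := by intro z; rw [hv0]; simp [QI.Dq]
    have vt : ∀ z, QI.Dt v z = 0 := by intro z; rw [hv0]; simp [QI.Dt]
    have ut : ∀ z, QI.Dt u z = 0 := by intro z; rw [S.e1, vq]; simp
    have hg : QI.Sm (fun z => w z - u z ^ 2) := sw.sub (su.pow 2)
    have hgc := hg.const_of
      (fun z => by
        have h1 := (hg.hdq z.1 z.2).deriv
        have h2 := ((sw.hdq z.1 z.2).sub ((su.hdq z.1 z.2).pow 2)).deriv
        have h3 := S.e2 z
        rw [vt] at h3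
        have h4 := h1.symm.trans h2
        simp only [Prod.mk.eta] at h4
        rw [h4]
        norm_num
        linarith)
      (fun z => by
        have h1 := (hg.hdt z.1 z.2).deriv
        have h2 := ((sw.hdt z.1 z.2).sub ((su.hdt z.1 z.2).pow 2)).deriv
        have h3 := S.e3 z
        rw [hv] at h3
        have h4 := h1.symm.trans h2
        simp only [Prod.mk.eta] at h4
        rw [h4, ut, h3]
        simp)
    have h3 : ∀ q t, u₃ q t = u₁ q t ^ 2 + (w (0, 0) - u (0, 0) ^ 2) := by
      intro q t
      have : u₃ q t - u₁ q t ^ 2 = w (0, 0) - u (0, 0) ^ 2 := hgc (q, t) (0, 0)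
      linarith
    have h2 : ∀ q t, u₂ q t = 0 := fun q t => hv (q, t)
    refine ⟨w (0, 0) - u (0, 0) ^ 2, h2, fun q t => ?_, h3, fun p q t => ?_⟩
    · exact (su.hdt q t).deriv.trans (ut _)
    · rw [hF, h2, h3]; ring
  · left
    have cu := su.const_of (fun z => (hst z).1) (fun z => by rw [S.e1, (hst z).2.1]; simp)
    have cv := sv.const_of (fun z => (hst z).2.1)
      (fun z => by rw [S.e2, (hst z).1, (hst z).2.2]; simp)
    have cw := sw.const_of (fun z => (hst z).2.2) (fun z => by rw [S.e3, (hst z).1]; simp)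
    exact ⟨u (0, 0), v (0, 0), w (0, 0), fun q t =>
      ⟨cu (q, t) (0, 0), cv (q, t) (0, 0), cw (q, t) (0, 0)⟩⟩
end

section
/- For every r ∈ Ω and every i = 1,…,n, the partial derivative of λ_i in the coordinate r_i satisfies ∂_{r_i} λ_i(r) = −(1 / F_pp(r, λ_i(r))) · Σ_{k ≠ i} 1/(λ_i(r) − λ_k(r)). -/
open Finset

open Polynomial in
lemma aux_poly_basis (n : ℕ) (lam : Fin n → ℝ) (hinj : Function.Injective lam) (i : Fin n)
    (a : Fin n → ℝ)
    (h : ∀ j, ∑ k : Fin n, a k * lam j ^ (n - 1 - (k : ℕ)) = if j = i then 1 else 0) :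
    ∑ k : Fin n, a k * (((n - 1 - (k : ℕ) : ℕ) : ℝ) * lam i ^ (n - 1 - (k : ℕ) - 1)) =
      ∑ k ∈ univ.erase i, 1 / (lam i - lam k) := by
  set G : ℝ[X] := ∑ k : Fin n, C (a k) * X ^ (n - 1 - (k : ℕ)) with hG
  have hGe : G = Lagrange.basis univ lam i := by
    apply Polynomial.eq_of_degrees_lt_of_eval_index_eq (s := univ) (v := lam) hinj.injOn
    · rw [hG]
      refine (Polynomial.degree_sum_le _ _).trans_lt ?_
      rw [Finset.sup_lt_iff (by simp)]
      intro k _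
      refine (degree_C_mul_X_pow_le _ _).trans_lt ?_
      have := k.2
      simp only [card_univ, Fintype.card_fin]
      exact_mod_cast (by omega : n - 1 - (k : ℕ) < n)
    · rw [Lagrange.degree_basis hinj.injOn (mem_univ _)]
      have := i.2
      simp only [card_univ, Fintype.card_fin]
      exact_mod_cast (by omega : n - 1 < n)
    · intro j _
      have h1 : G.eval (lam j) = if j = i then 1 else 0 := by
        rw [← h j, hG]; simp [eval_finsetSum]
      rw [h1]
      split_ifs with hj
      · subst hj; rw [Lagrange.eval_basis_self hinj.injOn (mem_univ _)]
      · rw [Lagrange.eval_basis_of_ne (Ne.symm hj) (mem_univ _)]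
  have h2 : (derivative G).eval (lam i) =
      ∑ k : Fin n, a k * (((n - 1 - (k : ℕ) : ℕ) : ℝ) * lam i ^ (n - 1 - (k : ℕ) - 1)) := by
    rw [hG]; simp [eval_finsetSum, derivative_X_pow, -map_natCast]
  rw [← h2, hGe, Lagrange.basis, derivative_prod_finset, eval_finsetSum]
  refine Finset.sum_congr rfl fun k hk => ?_
  rw [eval_mul, eval_prod, Finset.prod_eq_one, one_mul]
  · simp [Lagrange.basisDivisor]
  · intro j hj
    apply Lagrange.eval_basisDivisor_left_of_ne
    intro he
    have := hinj he
    subst this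
    simp at hj

open Polynomial in
lemma aux_poly_ne (n : ℕ) (lam : Fin n → ℝ) (hinj : Function.Injective lam) (i : Fin n)
    (a : Fin n → ℝ)
    (h : ∀ j, lam j ^ n + ∑ k : Fin n, a k * (((n - 1 - (k : ℕ) : ℕ) : ℝ) *
      lam j ^ (n - 1 - (k : ℕ) - 1)) = 0) :
    (n : ℝ) * lam i ^ (n - 1) + ∑ k : Fin n, a k * (((n - 1 - (k : ℕ) : ℕ) : ℝ) *
      (((n - 1 - (k : ℕ) - 1 : ℕ) : ℝ) * lam i ^ (n - 1 - (k : ℕ) - 1 - 1))) ≠ 0 := by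
  set S : ℝ[X] := ∑ k : Fin n, C (a k) * (C (((n - 1 - (k : ℕ) : ℕ) : ℝ)) *
      X ^ (n - 1 - (k : ℕ) - 1)) with hS
  have hSd : S.degree < n := by
    rw [hS]
    refine (Polynomial.degree_sum_le _ _).trans_lt ?_
    rw [Finset.sup_lt_iff (by exact_mod_cast WithBot.bot_lt_coe n)]
    intro k _
    rw [← mul_assoc, ← C_mul]
    refine (degree_C_mul_X_pow_le _ _).trans_lt ?_
    have := k.2
    exact_mod_cast (by omega : n - 1 - (k : ℕ) - 1 < n)
  set Q : ℝ[X] := X ^ n + S with hQ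
  have hQm : Q.Monic := monic_X_pow_add hSd
  have hQd : Q.degree = n := by
    rw [hQ, degree_add_eq_left_of_degree_lt (by rwa [degree_X_pow]), degree_X_pow]
  have hQe : Q = Lagrange.nodal univ lam := by
    apply Polynomial.eq_of_degree_sub_lt_of_eval_index_eq (s := univ) (v := lam) hinj.injOn
    · have : (Q - Lagrange.nodal univ lam).degree < Q.degree := by
        apply degree_sub_lt_left
        · rw [hQd, Lagrange.degree_nodal]; simp
        · exact hQm.ne_zero
        · rw [hQm.leadingCoeff, Lagrange.nodal_monic.leadingCoeff]
      rw [hQd] at this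
      simpa using this
    · intro j _
      rw [Lagrange.eval_nodal_at_node (mem_univ _), ← h j, hQ, hS]
      simp [eval_finsetSum]
  have h2 : (derivative Q).eval (lam i) = (n : ℝ) * lam i ^ (n - 1) +
      ∑ k : Fin n, a k * (((n - 1 - (k : ℕ) : ℕ) : ℝ) *
      (((n - 1 - (k : ℕ) - 1 : ℕ) : ℝ) * lam i ^ (n - 1 - (k : ℕ) - 1 - 1))) := by
    rw [hQ, hS]; simp [eval_finsetSum, derivative_X_pow, -map_natCast]
  rw [← h2, hQe, Lagrange.eval_nodal_derivative_eval_node_eq (mem_univ _), Lagrange.eval_nodal]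
  refine Finset.prod_ne_zero_iff.2 fun k hk => sub_ne_zero.2 fun he => ?_
  have := hinj he
  subst this
  simp at hk

/-- formula (a) of Lemma 1 for the derivative of `λᵢ` in the
Riemann invariant `rᵢ`:
`∂_{rᵢ} λᵢ = -(1 / F_pp(λᵢ)) · ∑_{k ≠ i} 1 / (λᵢ - λ_k)`. -/
theorem deriv_lambda_i_in_r_i
    (n : ℕ) (hn : 2 ≤ n)
    (Ω : Set (Fin n → ℝ)) (hΩ : IsOpen Ω)
    (u lam : Fin n → (Fin n → ℝ) → ℝ)
    (hu : ∀ k, ContDiffOn ℝ (⊤ : ℕ∞) (u k) Ω)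
    (hlam : ∀ i, ContDiffOn ℝ (⊤ : ℕ∞) (lam i) Ω)
    (F : (Fin n → ℝ) → ℝ → ℝ)
    (hF : ∀ r p, F r p =
      p ^ (n + 1) / ((n : ℝ) + 1) + ∑ k : Fin n, u k r * p ^ (n - 1 - (k : ℕ)))
    (hdist : ∀ r ∈ Ω, ∀ i j : Fin n, i ≠ j → lam i r ≠ lam j r)
    (hcrit : ∀ r ∈ Ω, ∀ i, deriv (F r) (lam i r) = 0)
    (hval : ∀ r ∈ Ω, ∀ i, F r (lam i r) = r i) :
    ∀ r ∈ Ω, ∀ i : Fin n,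
      fderiv ℝ (lam i) r (Pi.single i 1) =
        -(1 / deriv (deriv (F r)) (lam i r)) *
          ∑ k ∈ univ.erase i, 1 / (lam i r - lam k r) := by
  intro r hr i
  have hF1 : ∀ r p, HasDerivAt (F r) (p ^ n + ∑ k : Fin n, u k r *
      (((n - 1 - (k : ℕ) : ℕ) : ℝ) * p ^ (n - 1 - (k : ℕ) - 1))) p := by
    intro r p
    have hfun : F r = fun p => p ^ (n + 1) / ((n : ℝ) + 1) +
        ∑ k : Fin n, u k r * p ^ (n - 1 - (k : ℕ)) := funext (hF r)
    rw [hfun]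
    have h0 := (hasDerivAt_pow (n + 1) p).div_const ((n : ℝ) + 1)
    have hne : (n : ℝ) + 1 ≠ 0 := by positivity
    have h0' : HasDerivAt (fun p : ℝ => p ^ (n + 1) / ((n : ℝ) + 1)) (p ^ n) p := by
      have h3 : ((n + 1 : ℕ) : ℝ) * p ^ (n + 1 - 1) / ((n : ℝ) + 1) = p ^ n := by
        push_cast
        field_simp
      rw [h3] at h0
      exact h0
    exact h0'.add (HasDerivAt.fun_sum fun k _ =>
      (hasDerivAt_pow (n - 1 - (k : ℕ)) p).const_mul (u k r))
  have hF1' : ∀ r, deriv (F r) = fun p => p ^ n + ∑ k : Fin n, u k r *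
      (((n - 1 - (k : ℕ) : ℕ) : ℝ) * p ^ (n - 1 - (k : ℕ) - 1)) :=
    fun r => funext fun p => (hF1 r p).deriv
  have hF2 : ∀ r p, deriv (deriv (F r)) p = (n : ℝ) * p ^ (n - 1) + ∑ k : Fin n, u k r *
      (((n - 1 - (k : ℕ) : ℕ) : ℝ) *
      (((n - 1 - (k : ℕ) - 1 : ℕ) : ℝ) * p ^ (n - 1 - (k : ℕ) - 1 - 1))) := by
    intro r p
    rw [hF1']
    exact ((hasDerivAt_pow n p).add (HasDerivAt.fun_sum fun (k : Fin n) _ =>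
      (((hasDerivAt_pow (n - 1 - (k : ℕ) - 1) p).const_mul _).const_mul (u k r)))).deriv
  have hinj : Function.Injective (fun j => lam j r) := by
    intro j k hjk
    by_contra hne
    exact hdist r hr j k hne hjk
  have hne : deriv (deriv (F r)) (lam i r) ≠ 0 := by
    rw [hF2]
    apply aux_poly_ne n (fun j => lam j r) hinj i (fun k => u k r)
    intro j
    have := hcrit r hr j
    rw [hF1'] at this
    exact this
  -- the curve
  set e : Fin n → ℝ := Pi.single i 1 with he
  set c : ℝ → Fin n → ℝ := fun t => r + t • e with hc
  have hc0 : c 0 = r := by simp [hc]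
  have hcd : HasDerivAt c e 0 := by
    have := ((hasDerivAt_id (0 : ℝ)).smul_const e).const_add r
    simpa [hc] using this
  have hcΩ : ∀ᶠ t in nhds (0 : ℝ), c t ∈ Ω := by
    apply hcd.continuousAt.eventually_mem
    rw [hc0]; exact hΩ.mem_nhds hr
  have hcomp : ∀ f : (Fin n → ℝ) → ℝ, ContDiffOn ℝ (⊤ : ℕ∞) f Ω →
      HasDerivAt (fun t => f (c t)) (fderiv ℝ f r e) 0 := by
    intro f hf
    have h1 : DifferentiableAt ℝ f r :=
      (hf.contDiffAt (hΩ.mem_nhds hr)).differentiableAt (by simp)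
    have h2 : HasFDerivAt f (fderiv ℝ f r) (c 0) := by rw [hc0]; exact h1.hasFDerivAt
    exact h2.comp_hasDerivAt (0 : ℝ) hcd
  have hud := fun k => hcomp (u k) (hu k)
  have hld := fun k => hcomp (lam k) (hlam k)
  have hbasis : ∀ j, ∑ k : Fin n, fderiv ℝ (u k) r e * lam j r ^ (n - 1 - (k : ℕ)) =
      if j = i then 1 else 0 := by
    intro j
    have hA : HasDerivAt (fun t => (lam j (c t)) ^ (n + 1) / ((n : ℝ) + 1) +
        ∑ k : Fin n, u k (c t) * (lam j (c t)) ^ (n - 1 - (k : ℕ))) _ 0 :=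
      (((hld j).fun_pow (n + 1)).div_const ((n : ℝ) + 1)).add
        (HasDerivAt.fun_sum fun k _ => (hud k).mul ((hld j).fun_pow (n - 1 - (k : ℕ))))
    have hB : HasDerivAt (fun t => c t j) (e j) 0 := (hasDerivAt_pi.1 hcd) j
    have hEq : (fun t => (lam j (c t)) ^ (n + 1) / ((n : ℝ) + 1) +
        ∑ k : Fin n, u k (c t) * (lam j (c t)) ^ (n - 1 - (k : ℕ))) =ᶠ[nhds 0]
        (fun t => c t j) := by
      filter_upwards [hcΩ] with t ht
      rw [← hF, hval _ ht]
    have hU := hA.unique (hB.congr_of_eventuallyEq hEq)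
    have hcr := hcrit r hr j
    rw [hF1'] at hcr
    simp only [hc0] at hU hcr
    have hej : e j = if j = i then 1 else 0 := by rw [he, Pi.single_apply]
    rw [← hej, ← hU, sum_add_distrib]
    have hne' : (n : ℝ) + 1 ≠ 0 := by positivity
    have h1 : (((n + 1 : ℕ) : ℝ) * lam j r ^ (n + 1 - 1) * fderiv ℝ (lam j) r e) / ((n : ℝ) + 1)
        = lam j r ^ n * fderiv ℝ (lam j) r e := by
      push_cast
      field_simp
    have h2 : ∑ k : Fin n, u k r * (((n - 1 - (k : ℕ) : ℕ) : ℝ) *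
        lam j r ^ (n - 1 - (k : ℕ) - 1) * fderiv ℝ (lam j) r e) =
        (∑ k : Fin n, u k r * (((n - 1 - (k : ℕ) : ℕ) : ℝ) *
        lam j r ^ (n - 1 - (k : ℕ) - 1))) * fderiv ℝ (lam j) r e := by
      rw [sum_mul]
      exact sum_congr rfl fun k _ => by ring
    rw [h1, h2]
    linear_combination (-fderiv ℝ (lam j) r e) * hcr
  have hkey := aux_poly_basis n (fun j => lam j r) hinj i (fun k => fderiv ℝ (u k) r e) hbasis
  rw [← hkey]
  have hA : HasDerivAt (fun t => (lam i (c t)) ^ n +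
      ∑ k : Fin n, u k (c t) * (((n - 1 - (k : ℕ) : ℕ) : ℝ) *
        (lam i (c t)) ^ (n - 1 - (k : ℕ) - 1))) _ 0 :=
    ((hld i).fun_pow n).add
      (HasDerivAt.fun_sum fun k _ => (hud k).mul
        (((hld i).fun_pow (n - 1 - (k : ℕ) - 1)).const_mul ((n - 1 - (k : ℕ) : ℕ) : ℝ)))
  have hEq : (fun t => (lam i (c t)) ^ n +
      ∑ k : Fin n, u k (c t) * (((n - 1 - (k : ℕ) : ℕ) : ℝ) *
        (lam i (c t)) ^ (n - 1 - (k : ℕ) - 1))) =ᶠ[nhds 0] (fun _ => (0 : ℝ)) := by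
    filter_upwards [hcΩ] with t ht
    have := hcrit _ ht i
    rw [hF1'] at this
    exact this
  have hU := hA.unique ((hasDerivAt_const (0 : ℝ) (0 : ℝ)).congr_of_eventuallyEq hEq)
  simp only [hc0] at hU
  rw [sum_add_distrib] at hU
  have h2 : ∑ k : Fin n, u k r * (((n - 1 - (k : ℕ) : ℕ) : ℝ) *
      (((n - 1 - (k : ℕ) - 1 : ℕ) : ℝ) *
        lam i r ^ (n - 1 - (k : ℕ) - 1 - 1) * fderiv ℝ (lam i) r e)) =
      (∑ k : Fin n, u k r * (((n - 1 - (k : ℕ) : ℕ) : ℝ) *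
      (((n - 1 - (k : ℕ) - 1 : ℕ) : ℝ) *
        lam i r ^ (n - 1 - (k : ℕ) - 1 - 1)))) * fderiv ℝ (lam i) r e := by
    rw [sum_mul]
    exact sum_congr rfl fun k _ => by ring
  rw [h2] at hU
  have hD := hF2 r (lam i r)
  rw [neg_mul, one_div_mul_eq_div, ← neg_div, eq_div_iff hne, hD]
  linear_combination hU
end

section
/- For every r ∈ Ω and all indices i ≠ j, the partial derivative of λ_j in the coordinate r_i satisfies ∂_{r_i} λ_j(r) = −(1 / F_pp(r, λ_i(r))) · 1/(λ_j(r) − λ_i(r)). -/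
open Finset

open Polynomial in
lemma aux_hasDeriv {n : ℕ} (Q : ℝ[X]) (q : Fin n → ℝ[X]) (V : Fin n → ℝ → ℝ) (V' : Fin n → ℝ)
    (L : ℝ → ℝ) (L' : ℝ) (hV : ∀ k, HasDerivAt (V k) (V' k) 0) (hL : HasDerivAt L L' 0) :
    HasDerivAt (fun t => (Q + ∑ k, C (V k t) * q k).eval (L t))
      ((∑ k, C (V' k) * q k).eval (L 0) +
        (derivative (Q + ∑ k, C (V k 0) * q k)).eval (L 0) * L') 0 := by
  have h1 : ∀ p : ℝ[X], HasDerivAt (fun t => p.eval (L t)) ((derivative p).eval (L 0) * L') 0 :=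
    fun p => (p.hasDerivAt (L 0)).comp 0 hL
  have h2 := (h1 Q).add (HasDerivAt.fun_sum (u := Finset.univ) fun k _ => (hV k).mul (h1 (q k)))
  have e : (fun t => (Q + ∑ k, C (V k t) * q k).eval (L t)) =
      (fun t => Q.eval (L t)) + fun t => ∑ k, (V k * fun t => (q k).eval (L t)) t := by
    funext t
    simp [eval_finsetSum]
  rw [e]
  refine h2.congr_deriv ?_
  simp only [eval_finsetSum, derivative_add, derivative_sum, derivative_mul, derivative_C,
    zero_mul, zero_add, eval_add, eval_mul, eval_C, add_mul, Finset.sum_mul,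
    Finset.sum_add_distrib, mul_assoc]
  ring

open Polynomial in
lemma aux_alg {n : ℕ} (D G : ℝ[X]) (x : Fin n → ℝ) (hx : Function.Injective x)
    (hD : D.Monic) (hDn : D.natDegree = n) (hroot : ∀ i, D.eval (x i) = 0)
    (i j : Fin n) (hij : i ≠ j) (hG : G.degree < n) (hGi : ∀ k, G.eval (x k) = if k = i then 1 else 0)
    (l : ℝ) (hl : (derivative G).eval (x j) + (derivative D).eval (x j) * l = 0) :
    l = -(1 / (derivative D).eval (x i)) * (1 / (x j - x i)) := by
  have hD' : D = Lagrange.nodal Finset.univ x := by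
    apply Polynomial.eq_of_degree_sub_lt_of_eval_index_eq Finset.univ (v := x) hx.injOn
    · have hdeg : D.degree = n := by rw [degree_eq_natDegree hD.ne_zero, hDn]
      have := degree_sub_lt (p := D) (q := Lagrange.nodal Finset.univ x)
        (by rw [Lagrange.degree_nodal, hdeg]; simp) hD.ne_zero
        (by rw [hD.leadingCoeff, (Lagrange.nodal_monic).leadingCoeff])
      simpa [hdeg] using this
    · intro k _
      rw [hroot, Lagrange.eval_nodal_at_node (Finset.mem_univ k)]
  have hne : ∀ k, (derivative D).eval (x k) ≠ 0 := by
    intro k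
    rw [hD', Lagrange.eval_nodal_derivative_eval_node_eq (Finset.mem_univ k), Lagrange.eval_nodal,
      Finset.prod_ne_zero_iff]
    intro m hm h
    exact (Finset.mem_erase.1 hm).1 (hx (sub_eq_zero.1 h)).symm
  have hE : C ((derivative D).eval (x i)) * G = Lagrange.nodal (Finset.univ.erase i) x := by
    apply Polynomial.eq_of_degrees_lt_of_eval_index_eq Finset.univ (v := x) hx.injOn
    · rw [degree_C_mul (hne i)]; simpa using hG
    · rw [Lagrange.degree_nodal]
      exact_mod_cast Finset.card_erase_lt_of_mem (Finset.mem_univ i)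
    · intro k _
      rw [eval_mul, eval_C, hGi]
      split_ifs with h
      · subst h
        rw [hD', Lagrange.eval_nodal_derivative_eval_node_eq (Finset.mem_univ k), mul_one]
      · rw [Lagrange.eval_nodal_at_node (by simp [h]), mul_zero]
  have hF : D = (X - C (x i)) * (C ((derivative D).eval (x i)) * G) := by
    rw [hE, ← Lagrange.nodal_eq_mul_nodal_erase (Finset.mem_univ i), ← hD']
  have h3 := congrArg (fun p => (derivative p).eval (x j)) hF
  simp only [derivative_mul, derivative_sub, derivative_X, derivative_C, eval_mul, eval_add,
    eval_sub, eval_X, eval_C, hGi, if_neg hij.symm, sub_zero, mul_zero, zero_mul, zero_add] at h3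
  have hd : x j - x i ≠ 0 := fun h => hij (hx (sub_eq_zero.1 h)).symm
  have hi := hne i
  have hj := hne j
  have h4 : (derivative D).eval (x j) *
      (l * ((derivative D).eval (x i) * (x j - x i)) + 1) = 0 := by
    linear_combination h3 + ((derivative D).eval (x i) * (x j - x i)) * hl
  have h5 := (mul_eq_zero.1 h4).resolve_left hj
  field_simp
  linear_combination h5

/-- formula (b) of Lemma 1 for the derivative of `λⱼ` in the
Riemann invariant `rᵢ`, `i ≠ j`:
`∂_{rᵢ} λⱼ = -(1 / F_pp(λᵢ)) · 1 / (λⱼ - λᵢ)`. -/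
theorem deriv_lambda_j_in_r_i
    (n : ℕ) (hn : 2 ≤ n)
    (Ω : Set (Fin n → ℝ)) (hΩ : IsOpen Ω)
    (u lam : Fin n → (Fin n → ℝ) → ℝ)
    (hu : ∀ k, ContDiffOn ℝ (⊤ : ℕ∞) (u k) Ω)
    (hlam : ∀ i, ContDiffOn ℝ (⊤ : ℕ∞) (lam i) Ω)
    (F : (Fin n → ℝ) → ℝ → ℝ)
    (hF : ∀ r p, F r p =
      p ^ (n + 1) / ((n : ℝ) + 1) + ∑ k : Fin n, u k r * p ^ (n - 1 - (k : ℕ)))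
    (hdist : ∀ r ∈ Ω, ∀ i j : Fin n, i ≠ j → lam i r ≠ lam j r)
    (hcrit : ∀ r ∈ Ω, ∀ i, deriv (F r) (lam i r) = 0)
    (hval : ∀ r ∈ Ω, ∀ i, F r (lam i r) = r i) :
    ∀ r ∈ Ω, ∀ i j : Fin n, i ≠ j →
      fderiv ℝ (lam j) r (Pi.single i 1) =
        -(1 / deriv (deriv (F r)) (lam i r)) * (1 / (lam j r - lam i r)) := by
  intro r hr i j hij
  classical
  let P : (Fin n → ℝ) → Polynomial ℝ := fun s =>
    Polynomial.C (1 / ((n : ℝ) + 1)) * Polynomial.X ^ (n + 1) +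
      ∑ k : Fin n, Polynomial.C (u k s) * Polynomial.X ^ (n - 1 - (k : ℕ))
  have hn1 : (n : ℝ) + 1 ≠ 0 := by positivity
  have hFP : ∀ s, F s = fun p => (P s).eval p := by
    intro s
    funext p
    simp only [hF, P, Polynomial.eval_add, Polynomial.eval_finsetSum, Polynomial.eval_mul,
      Polynomial.eval_C, Polynomial.eval_pow, Polynomial.eval_X]
    ring
  have hdF : ∀ s, deriv (F s) = fun p => (Polynomial.derivative (P s)).eval p := by
    intro s
    funext p
    rw [hFP, Polynomial.deriv]
  have hddF : ∀ s p, deriv (deriv (F s)) p =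
      (Polynomial.derivative (Polynomial.derivative (P s))).eval p := by
    intro s p
    rw [hdF, Polynomial.deriv]
  have hdP : ∀ s, Polynomial.derivative (P s) = Polynomial.X ^ n +
      ∑ k : Fin n, Polynomial.C (u k s) *
        Polynomial.derivative (Polynomial.X ^ (n - 1 - (k : ℕ))) := by
    intro s
    simp only [P, Polynomial.derivative_add, Polynomial.derivative_sum,
      Polynomial.derivative_C_mul]
    congr 1
    rw [Polynomial.derivative_X_pow, ← mul_assoc, ← Polynomial.C_mul]
    push_cast
    rw [one_div_mul_cancel hn1]
    simp
  have hlow : (∑ k : Fin n, Polynomial.C (u k r) *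
        Polynomial.derivative (Polynomial.X ^ (n - 1 - (k : ℕ)))).degree < (n : WithBot ℕ) := by
    refine lt_of_le_of_lt (Polynomial.degree_sum_le _ _) ?_
    refine (Finset.sup_lt_iff (WithBot.bot_lt_coe n)).2 ?_
    intro k _
    rw [Polynomial.C_mul']
    refine lt_of_le_of_lt (Polynomial.degree_smul_le _ _) ?_
    refine lt_of_le_of_lt Polynomial.degree_derivative_le ?_
    rw [Polynomial.degree_X_pow]
    exact WithBot.coe_lt_coe.2 (by have := k.2; simp only [Nat.cast_id]; omega)
  -- curve
  let c : ℝ → (Fin n → ℝ) := fun t => r + t • Pi.single i 1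
  have hc0 : c 0 = r := by simp [c]
  have hc : HasDerivAt c (Pi.single i 1) 0 := by
    have := ((hasDerivAt_id (0 : ℝ)).smul_const (Pi.single i (1 : ℝ) : Fin n → ℝ)).const_add r
    simpa [c] using this
  have hcΩ : ∀ᶠ t in nhds (0 : ℝ), c t ∈ Ω :=
    hc.continuousAt.eventually_mem (by rw [hc0]; exact hΩ.mem_nhds hr)
  have hcomp : ∀ f : (Fin n → ℝ) → ℝ, ContDiffOn ℝ (⊤ : ℕ∞) f Ω →
      HasDerivAt (fun t => f (c t)) (fderiv ℝ f r (Pi.single i 1)) 0 := by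
    intro f hf
    have h1 : DifferentiableAt ℝ f (c 0) := by
      rw [hc0]
      exact (hf.contDiffAt (hΩ.mem_nhds hr)).differentiableAt (by simp)
    have := h1.hasFDerivAt.comp_hasDerivAt 0 hc
    rw [hc0] at this
    exact this
  have hroot : ∀ s ∈ Ω, ∀ k, (Polynomial.derivative (P s)).eval (lam k s) = 0 := by
    intro s hs k
    have := hcrit s hs k
    rwa [hdF] at this
  let G : Polynomial ℝ := ∑ k : Fin n,
    Polynomial.C (fderiv ℝ (u k) r (Pi.single i 1)) * Polynomial.X ^ (n - 1 - (k : ℕ))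
  rw [hddF]
  refine aux_alg (Polynomial.derivative (P r)) G (fun k => lam k r) ?_ ?_ ?_ (hroot r hr) i j hij
    ?_ ?_ _ ?_
  · intro a b hab
    by_contra h
    exact hdist r hr a b h hab
  · rw [hdP]
    exact Polynomial.monic_X_pow_add hlow
  · rw [hdP]
    apply Polynomial.natDegree_eq_of_degree_eq_some
    rw [Polynomial.degree_add_eq_left_of_degree_lt] <;> rw [Polynomial.degree_X_pow]
    exact hlow
  · refine lt_of_le_of_lt (Polynomial.degree_sum_le _ _) ?_
    refine (Finset.sup_lt_iff (WithBot.bot_lt_coe n)).2 ?_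
    intro k _
    rw [Polynomial.C_mul']
    refine lt_of_le_of_lt (Polynomial.degree_smul_le _ _) ?_
    rw [Polynomial.degree_X_pow]
    exact WithBot.coe_lt_coe.2 (by have := k.2; simp only [Nat.cast_id]; omega)
  · intro k
    have h1 := aux_hasDeriv (Polynomial.C (1 / ((n : ℝ) + 1)) * Polynomial.X ^ (n + 1))
      (fun k : Fin n => Polynomial.X ^ (n - 1 - (k : ℕ))) (fun k t => u k (c t)) _
      (fun t => lam k (c t)) _ (fun k => hcomp _ (hu k)) (hcomp _ (hlam k))
    have h2 : HasDerivAt (fun t => c t k) ((Pi.single i 1 : Fin n → ℝ) k) 0 :=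
      (hasDerivAt_pi.1 hc) k
    have h3 : (fun t => c t k) =ᶠ[nhds 0] fun t => (P (c t)).eval (lam k (c t)) := by
      filter_upwards [hcΩ] with t ht
      have := hval _ ht k
      rw [hFP] at this
      exact this.symm
    have h4 := h1.unique (h2.congr_of_eventuallyEq h3.symm)
    simp only [hc0] at h4
    have h5 := hroot r hr k
    simp only [P] at h5
    rw [h5, zero_mul, add_zero] at h4
    simpa [G, Pi.single_apply] using h4
  · have h1 := aux_hasDeriv (Polynomial.X ^ n)
      (fun k : Fin n => Polynomial.derivative (Polynomial.X ^ (n - 1 - (k : ℕ))))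
      (fun k t => u k (c t)) _
      (fun t => lam j (c t)) _ (fun k => hcomp _ (hu k)) (hcomp _ (hlam j))
    have h3 : (fun _ => (0 : ℝ)) =ᶠ[nhds 0]
        fun t => (Polynomial.X ^ n + ∑ k : Fin n, Polynomial.C (u k (c t)) *
        Polynomial.derivative (Polynomial.X ^ (n - 1 - (k : ℕ)))).eval (lam j (c t)) := by
      filter_upwards [hcΩ] with t ht
      rw [← hdP]
      exact (hroot _ ht j).symm
    have h4 := h1.unique ((hasDerivAt_const (0 : ℝ) (0 : ℝ)).congr_of_eventuallyEq h3.symm)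
    simp only [hc0] at h4
    rw [← hdP] at h4
    have h6 : Polynomial.derivative G = ∑ k : Fin n,
        Polynomial.C (fderiv ℝ (u k) r (Pi.single i 1)) *
          Polynomial.derivative (Polynomial.X ^ (n - 1 - (k : ℕ))) := by
      simp only [G, Polynomial.derivative_sum, Polynomial.derivative_C_mul]
    rw [h6]
    exact h4
end

section
/- For every r ∈ Ω and every i = 1,…,n, one has F_pp(r, λ_i(r)) · ∂_{r_i} u₁(r) = 1; in particular ∂_{r_i} u₁ never vanishes. -/
open Finset

open Polynomial in
theorem aux_coeff (n : ℕ) (h0 : 0 < n) (a : Fin n → ℝ) :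
    (∑ k : Fin n, C (a k) * X ^ (n - 1 - (k : ℕ))).coeff (n - 1) = a ⟨0, h0⟩ := by
  rw [finsetSum_coeff, Finset.sum_eq_single ⟨0, h0⟩]
  · simp
  · intro k _ hk
    have : (k : ℕ) ≠ 0 := fun h => hk (Fin.ext h)
    have h2 := k.2
    rw [coeff_C_mul_X_pow, if_neg (by omega)]
  · simp

open Polynomial in
theorem aux_coeff_big (n : ℕ) (a : Fin n → ℝ) (m : ℕ) (hm : n ≤ m) :
    (∑ k : Fin n, C (a k) * X ^ (n - 1 - (k : ℕ))).coeff m = 0 := by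
  rw [finsetSum_coeff]
  refine Finset.sum_eq_zero fun k _ => ?_
  have h2 := k.2
  rw [coeff_C_mul_X_pow, if_neg (by omega)]

open Polynomial in
theorem aux_alg_s4 (n : ℕ) (h0 : 0 < n) (a q l : Fin n → ℝ) (P Q : ℝ[X])
    (hP : P = C (1 / ((n : ℝ) + 1)) * X ^ (n + 1) + ∑ k : Fin n, C (a k) * X ^ (n - 1 - (k : ℕ)))
    (hQ : Q = ∑ k : Fin n, C (q k) * X ^ (n - 1 - (k : ℕ)))
    (hl : Function.Injective l) (i : Fin n)
    (hc : ∀ j, (derivative P).eval (l j) = 0)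
    (hq : ∀ j, Q.eval (l j) = if j = i then 1 else 0) :
    (derivative (derivative P)).eval (l i) * q ⟨0, h0⟩ = 1 := by
  have hD : Q * (X - C (l i)) - C (q ⟨0, h0⟩) * derivative P = 0 := by
    apply Polynomial.eq_zero_of_degree_lt_of_eval_index_eq_zero (v := l) Finset.univ hl.injOn
    · rw [Finset.card_univ, Fintype.card_fin, degree_lt_iff_coeff_zero]
      intro m hm
      obtain ⟨m, rfl⟩ : ∃ k, m = k + 1 := ⟨m - 1, by omega⟩
      rw [coeff_sub, coeff_mul_X_sub_C, coeff_C_mul, coeff_derivative, hP, coeff_add,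
        coeff_C_mul_X_pow, aux_coeff_big n a _ (by omega), hQ, aux_coeff_big n q (m+1) hm]
      by_cases h : m + 1 = n
      · obtain rfl : m = n - 1 := by omega
        rw [aux_coeff n h0, if_pos (by omega)]
        have : ((n - 1 : ℕ) : ℝ) = n - 1 := by rw [Nat.cast_sub (by omega)]; simp
        push_cast
        rw [this]
        have : (n : ℝ) + 1 ≠ 0 := by positivity
        field_simp
        ring
      · rw [if_neg (by omega), aux_coeff_big n q _ (by omega)]
        simp
    · intro j _
      simp only [eval_sub, eval_mul, hc, hq, eval_X, eval_C]
      split_ifs with h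
      · simp [h]
      · simp
  have h2 := congrArg (fun p => (derivative p).eval (l i)) hD
  simp [hq] at h2
  linarith

/-- formula (c) of Lemma 1: `F_pp(λᵢ) · ∂_{rᵢ} u₁ = 1`;
in particular `∂_{rᵢ} u₁` never vanishes. -/
theorem Fpp_mul_deriv_u_eq_one
    (n : ℕ) (hn : 2 ≤ n)
    (Ω : Set (Fin n → ℝ)) (hΩ : IsOpen Ω)
    (u lam : Fin n → (Fin n → ℝ) → ℝ)
    (hu : ∀ k, ContDiffOn ℝ (⊤ : ℕ∞) (u k) Ω)
    (hlam : ∀ i, ContDiffOn ℝ (⊤ : ℕ∞) (lam i) Ω)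
    (F : (Fin n → ℝ) → ℝ → ℝ)
    (hF : ∀ r p, F r p =
      p ^ (n + 1) / ((n : ℝ) + 1) + ∑ k : Fin n, u k r * p ^ (n - 1 - (k : ℕ)))
    (hdist : ∀ r ∈ Ω, ∀ i j : Fin n, i ≠ j → lam i r ≠ lam j r)
    (hcrit : ∀ r ∈ Ω, ∀ i, deriv (F r) (lam i r) = 0)
    (hval : ∀ r ∈ Ω, ∀ i, F r (lam i r) = r i) :
    ∀ r ∈ Ω, ∀ i : Fin n,
      deriv (deriv (F r)) (lam i r) * fderiv ℝ (u ⟨0, by omega⟩) r (Pi.single i 1) = 1 ∧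
      fderiv ℝ (u ⟨0, by omega⟩) r (Pi.single i 1) ≠ 0 := by
  intro r hr i
  have key : deriv (deriv (F r)) (lam i r) *
      fderiv ℝ (u ⟨0, by omega⟩) r (Pi.single i 1) = 1 := by
    set P : Polynomial ℝ := Polynomial.C (1 / ((n : ℝ) + 1)) * Polynomial.X ^ (n + 1) +
      ∑ k : Fin n, Polynomial.C (u k r) * Polynomial.X ^ (n - 1 - (k : ℕ)) with hP
    have hFP : F r = fun p => P.eval p := by
      funext p
      rw [hF, hP]
      simp [Polynomial.eval_finsetSum]
      ring
    have hd1 : deriv (F r) = fun p => (Polynomial.derivative P).eval p := by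
      funext p
      rw [hFP, Polynomial.deriv]
    have hd2 : deriv (deriv (F r)) (lam i r) =
        (Polynomial.derivative (Polynomial.derivative P)).eval (lam i r) := by
      rw [hd1, Polynomial.deriv]
    rw [hd2]
    refine aux_alg_s4 n (by omega) (fun k => u k r) (fun k => fderiv ℝ (u k) r (Pi.single i 1))
      (fun j => lam j r) P _ hP rfl ?_ i ?_ ?_
    · intro a b hab
      by_contra h
      exact hdist r hr a b h hab
    · intro j
      have := hcrit r hr j
      rwa [hd1] at this
    · intro j
      set v : Fin n → ℝ := Pi.single i 1 with hv
      have hnh : Ω ∈ nhds r := hΩ.mem_nhds hr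
      have hline : HasDerivAt (fun t : ℝ => r + t • v) v 0 := by
        simpa using ((hasDerivAt_id (0 : ℝ)).smul_const v).const_add r
      have hcomp : ∀ f : (Fin n → ℝ) → ℝ, ContDiffOn ℝ (⊤ : ℕ∞) f Ω →
          HasDerivAt (fun t : ℝ => f (r + t • v)) (fderiv ℝ f r v) 0 := by
        intro f hf
        have h1 : HasFDerivAt f (fderiv ℝ f r) (r + (0 : ℝ) • v) := by
          have := ((hf.contDiffAt hnh).differentiableAt (by simp)).hasFDerivAt
          simpa using this
        exact h1.comp_hasDerivAt (0 : ℝ) hline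
      have hl := hcomp (lam j) (hlam j)
      have hG := ((hl.pow (n + 1)).div_const ((n : ℝ) + 1)).add
        (HasDerivAt.fun_sum (u := Finset.univ) fun (k : Fin n) _ =>
          (hcomp (u k) (hu k)).mul (hl.pow (n - 1 - (k : ℕ))))
      have hR : HasDerivAt (fun t : ℝ => (r + t • v) j) (v j) 0 := (hasDerivAt_pi.1 hline) j
      have hev : ∀ᶠ t : ℝ in nhds 0, r + t • v ∈ Ω := by
        apply hline.continuousAt.eventually_mem
        simpa using hnh
      have hR2 := hR.congr_of_eventuallyEq (f₁ := fun t : ℝ => F (r + t • v) (lam j (r + t • v)))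
        (hev.mono fun t ht => hval _ ht j)
      have hR3 := hR2.unique (hG.congr_of_eventuallyEq (Filter.Eventually.of_forall fun t => by
        simp [hF]))
      have hc := hcrit r hr j
      rw [hd1, hP] at hc
      simp [Polynomial.eval_finsetSum, Polynomial.derivative_X_pow] at hc
      simp [Finset.sum_add_distrib] at hR3
      have hvj : v j = if j = i then 1 else 0 := by simp [hv, Pi.single_apply]
      rw [← hvj, hR3]
      simp only [Polynomial.eval_finsetSum, Polynomial.eval_mul, Polynomial.eval_C,
        Polynomial.eval_pow, Polynomial.eval_X]
      have hc2 := congrArg (· * fderiv ℝ (lam j) r v) hc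
      simp only [add_mul, Finset.sum_mul, zero_mul] at hc2
      have e : ∀ k : Fin n, u k r * (((n - 1 - (k:ℕ) : ℕ) : ℝ) * lam j r ^ (n - 1 - (k:ℕ) - 1) *
          fderiv ℝ (lam j) r v) = u k r * (((n - 1 - (k:ℕ) : ℕ) : ℝ) *
          lam j r ^ (n - 1 - (k:ℕ) - 1)) * fderiv ℝ (lam j) r v := fun k => by ring
      simp only [e]
      have hn1 : (n : ℝ) + 1 ≠ 0 := by positivity
      field_simp at hc2 ⊢
      linarith
  exact ⟨key, fun h => by rw [h] at key; simp at key⟩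
end
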